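/- arXiv:1110.3110 — 2 statements merged into one kernel-verified Lean document; each statement's English description precedes it below -/
import Mathlib

section
/- Let Ω ⊆ ℂ be a nonempty open simply connected set and let h, g : Ω → ℂ be holomorphic functions with no common zero such that the conformal metric (|h(z)|² + |g(z)|²)|dz|² on Ω is complete. Let q be a positive integer, let α₁, …, α_{q−1} ∈ ℂ be distinct, and let m₁, …, m_q be positive integers with ∑_{j=1}^{q} (1 − 1/m_j) > 3. Suppose that for each j ∈ {1, …, q−1} every zero of the holomorphic function g − α_j·h has order at least m_j, and every zero of h has order at least m_q. Then the meromorphic function ρ = g/h is constant, i.e. there exist constants (a, b) ∈ ℂ² ∖ {(0,0)} with a·g + b·h ≡ 0 on Ω. (This is the analytic content of the paper's main ramification theorem: for a weakly complete flat front f : Σ → H³ whose ratio of canonical forms ρ = θ/ω satisfies that all α_j-points have multiplicity at least m_j with ∑(1−1/m_j) > 3, the front must be a horosphere or a hyperbolic cylinder.) -/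
open MeasureTheory

/-- A path `γ : [0,1) → ℂ` is *divergent* in an open set `U ⊆ ℂ`: it eventually
leaves every compact subset of `U`. -/
def DivergentPath (U : Set ℂ) (γ : ℝ → ℂ) : Prop :=
  ∀ K : Set ℂ, K ⊆ U → IsCompact K →
    ∃ t₀ ∈ Set.Ico (0 : ℝ) 1, ∀ t, t₀ < t → t < 1 → γ t ∉ K

/-- `γ : [0,1) → ℂ` is continuous and piecewise continuously differentiable,
with derivative `γ'` away from a locally finite set of exceptional points. -/
def PiecewiseC1 (γ γ' : ℝ → ℂ) : Prop :=
  ContinuousOn γ (Set.Ico 0 1) ∧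
  ∃ D : Set ℝ, (∀ b : ℝ, b < 1 → (D ∩ Set.Icc 0 b).Finite) ∧
    (∀ t ∈ Set.Ico (0 : ℝ) 1 \ D, HasDerivAt γ (γ' t) t) ∧
    ContinuousOn γ' (Set.Ico 0 1 \ D)

/-- The conformal metric `lam(z)² |dz|²` on `U` is *complete*: every divergent
piecewise C¹ path in `U` has infinite length. -/
def MetricComplete (U : Set ℂ) (lam : ℂ → ℝ) : Prop :=
  ∀ γ γ' : ℝ → ℂ, (∀ t ∈ Set.Ico (0 : ℝ) 1, γ t ∈ U) →
    PiecewiseC1 γ γ' → DivergentPath U γ →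
    ∫⁻ t in Set.Ico (0 : ℝ) 1, ENNReal.ofReal (lam (γ t) * ‖γ' t‖) = ⊤

namespace FlatFront
open Filter Topology Asymptotics

/-- second order jet: `b = 2 ∂u`, `A = ∂∂̄ u` -/
def Jet (u : ℂ → ℝ) (z : ℂ) (b : ℂ) (A : ℝ) : Prop :=
  ∃ c : ℂ, (fun w : ℂ => u (z + w) - u z - (b * w).re - (c * w ^ 2).re - A * ‖w‖ ^ 2)
    =o[𝓝 0] (fun w : ℂ => ‖w‖ ^ 2)

lemma Jet.add {u v : ℂ → ℝ} {z b b' : ℂ} {A A' : ℝ} (hu : Jet u z b A) (hv : Jet v z b' A') :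
    Jet (fun w => u w + v w) z (b + b') (A + A') := by
  obtain ⟨c, hc⟩ := hu
  obtain ⟨c', hc'⟩ := hv
  refine ⟨c + c', (hc.add hc').congr_left fun w => ?_⟩
  simp only [add_mul, Complex.add_re]
  ring

lemma Jet.const_mul {u : ℂ → ℝ} {z b : ℂ} {A : ℝ} (k : ℝ) (hu : Jet u z b A) :
    Jet (fun w => k * u w) z (k * b) (k * A) := by
  obtain ⟨c, hc⟩ := hu
  refine ⟨k * c, (hc.const_mul_left k).congr_left fun w => ?_⟩
  simp only [mul_assoc, Complex.re_ofReal_mul]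
  ring

lemma Jet.const (k : ℝ) (z : ℂ) : Jet (fun _ => k) z 0 0 :=
  ⟨0, by simp⟩

lemma Jet.sum {ι : Type*} (s : Finset ι) {u : ι → ℂ → ℝ} {z : ℂ} {b : ι → ℂ} {A : ι → ℝ}
    (h : ∀ i ∈ s, Jet (u i) z (b i) (A i)) :
    Jet (fun w => ∑ i ∈ s, u i w) z (∑ i ∈ s, b i) (∑ i ∈ s, A i) := by
  classical
  induction s using Finset.induction_on with
  | empty => simpa using Jet.const 0 z
  | insert i s hi ih =>
    simp only [Finset.sum_insert hi]
    exact (h i (by simp)).add (ih fun j hj => h j (by simp [hj]))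

lemma Jet.congr {u v : ℂ → ℝ} {z b : ℂ} {A : ℝ} (hu : Jet u z b A) (h : u =ᶠ[𝓝 z] v) :
    Jet v z b A := by
  obtain ⟨c, hc⟩ := hu
  refine ⟨c, hc.congr' ?_ EventuallyEq.rfl⟩
  have ht : Tendsto (fun w : ℂ => z + w) (𝓝 0) (𝓝 z) := by
    have : Continuous fun w : ℂ => z + w := by fun_prop
    simpa using this.tendsto 0
  filter_upwards [ht.eventually h] with w hw
  rw [hw, h.eq_of_nhds]

lemma isLittleO_cube_sq : (fun w : ℂ => ‖w‖ ^ 3) =o[𝓝 0] (fun w : ℂ => ‖w‖ ^ 2) := by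
  have h := (isLittleO_pow_pow (𝕜 := ℝ) (m := 2) (n := 3) (by norm_num)).comp_tendsto
    (tendsto_norm_zero (E := ℂ))
  exact h

lemma re_mul_isBigO (b : ℂ) : (fun w : ℂ => (b * w).re) =O[𝓝 0] (fun w : ℂ => ‖w‖) := by
  refine IsBigO.of_bound ‖b‖ (Eventually.of_forall fun w => ?_)
  simpa [norm_mul] using Complex.abs_re_le_norm (b * w)

lemma re_mul_sq_isBigO (c : ℂ) :
    (fun w : ℂ => (c * w ^ 2).re) =O[𝓝 0] (fun w : ℂ => ‖w‖ ^ 2) := by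
  refine IsBigO.of_bound ‖c‖ (Eventually.of_forall fun w => ?_)
  have := Complex.abs_re_le_norm (c * w ^ 2)
  rw [norm_mul, norm_pow] at this
  rwa [Real.norm_eq_abs, norm_pow, norm_norm]

lemma sq_isBigO_one : (fun w : ℂ => ‖w‖ ^ 2) =O[𝓝 0] (fun w : ℂ => ‖w‖) := by
  have h := (isLittleO_pow_pow (𝕜 := ℝ) (m := 1) (n := 2) (by norm_num)).comp_tendsto
    (tendsto_norm_zero (E := ℂ))
  simpa [Function.comp_def] using h.isBigO

lemma Jet.comp {u : ℂ → ℝ} {z b : ℂ} {A : ℝ} (hu : Jet u z b A) {φ : ℝ → ℝ} {p q : ℝ}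
    (hφ : (fun y => φ y - φ (u z) - p * (y - u z) - q / 2 * (y - u z) ^ 2)
      =o[𝓝 (u z)] (fun y => (y - u z) ^ 2)) :
    Jet (fun w => φ (u w)) z (p * b) (p * A + q * ‖b‖ ^ 2 / 4) := by
  obtain ⟨c, hc⟩ := hu
  set s : ℂ → ℝ := fun w => u (z + w) - u z with hs
  have h1 : (fun w => s w - (b * w).re) =O[𝓝 0] (fun w : ℂ => ‖w‖ ^ 2) := by
    have := (hc.isBigO.add (re_mul_sq_isBigO c)).add
      ((isBigO_refl (fun w : ℂ => ‖w‖ ^ 2) (𝓝 0)).const_mul_left A)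
    refine this.congr_left fun w => ?_
    simp only [hs]; ring
  have h2 : s =O[𝓝 0] (fun w : ℂ => ‖w‖) := by
    refine ((h1.trans sq_isBigO_one).add (re_mul_isBigO b)).congr_left fun w => ?_
    ring
  have h3 : (fun w => s w ^ 2 - (b * w).re ^ 2) =o[𝓝 0] (fun w : ℂ => ‖w‖ ^ 2) := by
    refine IsBigO.trans_isLittleO ?_ isLittleO_cube_sq
    refine (h1.mul (h2.add (re_mul_isBigO b))).congr (fun w => ?_) (fun w => ?_) <;> ring
  have ht : Tendsto (fun w => u (z + w)) (𝓝 0) (𝓝 (u z)) := by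
    have h0 : Tendsto s (𝓝 0) (𝓝 0) := h2.trans_tendsto (tendsto_norm_zero (E := ℂ))
    have := h0.add_const (u z)
    simpa [hs] using this
  have h4 : (fun w => φ (u (z + w)) - φ (u z) - p * s w - q / 2 * s w ^ 2)
      =o[𝓝 0] (fun w : ℂ => ‖w‖ ^ 2) :=
    (hφ.comp_tendsto ht).trans_isBigO (h2.pow 2)
  refine ⟨p * c + q / 4 * b ^ 2, ?_⟩
  refine ((h4.add (hc.const_mul_left p)).add (h3.const_mul_left (q / 2))).congr_left fun w => ?_
  have e : ‖b‖ ^ 2 * ‖w‖ ^ 2 = (b.re ^ 2 + b.im ^ 2) * (w.re ^ 2 + w.im ^ 2) := by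
    rw [← Complex.normSq_eq_norm_sq, ← Complex.normSq_eq_norm_sq, Complex.normSq_apply,
      Complex.normSq_apply]; ring
  have e2 : (p * A + q * ‖b‖ ^ 2 / 4) * ‖w‖ ^ 2 = p * A * ‖w‖ ^ 2 +
    q / 4 * ((b.re ^ 2 + b.im ^ 2) * (w.re ^ 2 + w.im ^ 2)) := by rw [← e]; ring
  rw [e2]
  have e3 : ((q : ℂ) / 4 * b ^ 2 * w ^ 2).re = q / 4 * (b ^ 2 * w ^ 2).re := by
    rw [show (q : ℂ) / 4 * b ^ 2 * w ^ 2 = ((q / 4 : ℝ) : ℂ) * (b ^ 2 * w ^ 2) by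
      push_cast; ring, Complex.re_ofReal_mul]
  simp only [hs, add_mul, Complex.add_re, e3, mul_assoc (p : ℂ), Complex.re_ofReal_mul]
  simp only [pow_two, Complex.mul_re, Complex.mul_im]
  ring

lemma taylor_two {φ φ' : ℝ → ℝ} {y q : ℝ} (h1 : ∀ᶠ t in 𝓝 y, HasDerivAt φ (φ' t) t)
    (h2 : HasDerivAt φ' q y) :
    (fun t => φ t - φ y - φ' y * (t - y) - q / 2 * (t - y) ^ 2) =o[𝓝 y]
      (fun t => (t - y) ^ 2) := by
  rw [isLittleO_iff]
  intro ε hε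
  have h2' := (hasDerivAt_iff_isLittleO.1 h2)
  have h3 := (isLittleO_iff.1 h2') hε
  obtain ⟨δ, hδ, hb⟩ := Metric.eventually_nhds_iff_ball.1 (h1.and h3)
  filter_upwards [Metric.ball_mem_nhds y hδ] with t ht
  set ψ : ℝ → ℝ := fun t => φ t - φ' y * (t - y) - q / 2 * (t - y) ^ 2
  have hsub : Set.uIcc y t ⊆ Metric.ball y δ :=
    (convex_ball y δ).ordConnected.uIcc_subset (Metric.mem_ball_self hδ) ht
  have hd : ∀ x ∈ Set.uIcc y t, HasDerivWithinAt ψ (φ' x - φ' y - q * (x - y))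
      (Set.uIcc y t) x := by
    intro x hx
    have := (((hb x (hsub hx)).1).sub (((hasDerivAt_id x).sub_const y).const_mul (φ' y))).sub
      ((((hasDerivAt_id x).sub_const y).pow 2).const_mul (q / 2))
    refine (this.congr_deriv ?_).hasDerivWithinAt
    simp; ring
  have hbd : ∀ x ∈ Set.uIcc y t, ‖φ' x - φ' y - q * (x - y)‖ ≤ ε * |t - y| := by
    intro x hx
    have h5 := (hb x (hsub hx)).2
    have : |x - y| ≤ |t - y| := Set.abs_sub_left_of_mem_uIcc hx
    simp only [smul_eq_mul, Real.norm_eq_abs] at h5 ⊢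
    rw [mul_comm q]
    exact h5.trans (by gcongr)
  have := (convex_uIcc y t).norm_image_sub_le_of_norm_hasDerivWithin_le hd hbd
    Set.left_mem_uIcc Set.right_mem_uIcc
  simp only [ψ] at this
  simp only [Real.norm_eq_abs] at this ⊢
  calc _ = |φ t - φ' y * (t - y) - q / 2 * (t - y) ^ 2 -
      (φ y - φ' y * (y - y) - q / 2 * (y - y) ^ 2)| := by congr 1; ring
    _ ≤ _ := this
    _ = _ := by rw [abs_pow]; ring

lemma Jet.log {u : ℂ → ℝ} {z b : ℂ} {A : ℝ} (hu : Jet u z b A) (h0 : 0 < u z) :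
    Jet (fun w => Real.log (u w)) z ((1 / u z : ℝ) * b) (A / u z - ‖b‖ ^ 2 / (4 * u z ^ 2)) := by
  have := hu.comp (φ := Real.log) (p := (u z)⁻¹) (q := -(u z ^ 2)⁻¹)
    (taylor_two (φ' := fun t => t⁻¹) ?_ ?_)
  · convert this using 1
    · simp
    · field_simp; ring
  · filter_upwards [eventually_ne_nhds h0.ne'] with t ht
    exact Real.hasDerivAt_log ht
  · exact hasDerivAt_inv h0.ne'

lemma Jet.softplus {u : ℂ → ℝ} {z b : ℂ} {A : ℝ} (hu : Jet u z b A) {σ : ℝ}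
    (hσ : σ = Real.exp (u z) / (1 + Real.exp (u z))) :
    Jet (fun w => Real.log (1 + Real.exp (u w))) z (σ * b)
      (σ * A + σ * (1 - σ) * ‖b‖ ^ 2 / 4) := by
  have hp : ∀ t : ℝ, 0 < 1 + Real.exp t := fun t => by positivity
  have := hu.comp (φ := fun t => Real.log (1 + Real.exp t)) (p := σ) (q := σ * (1 - σ)) ?_
  · exact this
  · have h := taylor_two (φ := fun t => Real.log (1 + Real.exp t))
      (φ' := fun t => Real.exp t / (1 + Real.exp t)) (y := u z) (q := σ * (1 - σ)) ?_ ?_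
    · simpa only [hσ] using h
    · refine Eventually.of_forall fun t => ?_
      exact ((Real.hasDerivAt_exp t).const_add 1).log (hp t).ne'
    · refine ((Real.hasDerivAt_exp (u z)).div ((Real.hasDerivAt_exp (u z)).const_add 1)
        (hp _).ne').congr_deriv ?_
      rw [hσ]
      have := (hp (u z)).ne'
      field_simp

lemma Jet.normSq {f : ℂ → ℂ} {z : ℂ} (hf : AnalyticAt ℂ f z) :
    Jet (fun w => ‖f w‖ ^ 2) z (2 * (starRingEnd ℂ (f z)) * deriv f z) (‖deriv f z‖ ^ 2) := by
  obtain ⟨F0, hF0, hE0⟩ := (show AnalyticAt ℂ (fun w => f (z + w)) 0 from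
    AnalyticAt.fun_comp (by simpa using hf) (by fun_prop)).exists_eventuallyEq_sum_add_pow_mul 3
  have ht : Tendsto (fun w : ℂ => z + w) (𝓝 0) (𝓝 z) := by
    have : Continuous fun w : ℂ => z + w := by fun_prop
    simpa using this.tendsto 0
  obtain ⟨a2, ha2⟩ : ∃ a2, a2 = (1 / 2 : ℂ) * iteratedDeriv 2 (fun w => f (z + w)) 0 := ⟨_, rfl⟩
  have hE' : ∀ᶠ w in 𝓝 (0 : ℂ), f (z + w) = f z + deriv f z * w + a2 * w ^ 2 + F0 w * w ^ 3 := by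
    filter_upwards [hE0] with w hw
    rw [hw]
    simp [Finset.sum_range_succ, ha2, iteratedDeriv_one, deriv_comp_const_add]
    ring
  have hFb : (fun w => F0 w) =O[𝓝 0] (fun _ : ℂ => (1 : ℝ)) := by
    exact hF0.continuousAt.tendsto.isBigO_one ℝ
  set p := f z
  set q := deriv f z
  have hid : (fun w : ℂ => w) =O[𝓝 0] (fun w : ℂ => ‖w‖) :=
    (isBigO_refl (fun w : ℂ => w) (𝓝 0)).norm_right
  have hone : (fun w : ℂ => w) =O[𝓝 0] (fun _ : ℂ => (1 : ℝ)) := by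
    have : Tendsto (fun w : ℂ => w) (𝓝 0) (𝓝 0) := tendsto_id
    exact this.isBigO_one ℝ
  refine ⟨2 * (starRingEnd ℂ p) * a2, ?_⟩
  -- remainder
  have hrem : (fun w : ℂ => (2 * (starRingEnd ℂ (p + q * w + a2 * w ^ 2)) * (F0 w * w ^ 3)).re
      + ‖F0 w * w ^ 3‖ ^ 2 + 2 * (starRingEnd ℂ (q * w) * (a2 * w ^ 2)).re + ‖a2 * w ^ 2‖ ^ 2)
      =o[𝓝 0] (fun w : ℂ => ‖w‖ ^ 2) := by
    refine IsBigO.trans_isLittleO ?_ isLittleO_cube_sq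
    have hre : ∀ k : ℂ → ℂ, k =O[𝓝 0] (fun w : ℂ => ‖w‖ ^ 3) →
        (fun w => (k w).re) =O[𝓝 0] (fun w : ℂ => ‖w‖ ^ 3) := fun k hk =>
      IsBigO.trans (IsBigO.of_bound 1 (Eventually.of_forall fun w => by
        simpa using Complex.abs_re_le_norm (k w))) hk
    have hconj : ∀ k : ℂ → ℂ, ∀ G : ℂ → ℝ, k =O[𝓝 0] G →
        (fun w => starRingEnd ℂ (k w)) =O[𝓝 0] G := fun k G hk =>
      IsBigO.trans (IsBigO.of_bound 1 (Eventually.of_forall fun w => by simp)) hk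
    have h3 : (fun w : ℂ => F0 w * w ^ 3) =O[𝓝 0] (fun w : ℂ => ‖w‖ ^ 3) := by
      simpa using hFb.mul (hid.pow 3)
    have hcst : ∀ k : ℂ, (fun _ : ℂ => k) =O[𝓝 0] (fun _ : ℂ => (1 : ℝ)) := fun k =>
      isBigO_const_const k one_ne_zero _
    have hP : (fun w : ℂ => p + q * w + a2 * w ^ 2) =O[𝓝 0] (fun _ : ℂ => (1 : ℝ)) := by
      refine ((hcst p).add ?_).add ?_
      · simpa using (hcst q).mul hone
      · simpa using (hcst a2).mul (hone.pow 2)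
    have h31 : (fun w : ℂ => ‖w‖ ^ 3) =O[𝓝 0] (fun _ : ℂ => (1 : ℝ)) := by
      simpa using (hone.norm_left).pow 3
    have h1 : (fun w : ℂ => ‖w‖) =O[𝓝 0] (fun _ : ℂ => (1 : ℝ)) := hone.norm_left
    refine ((IsBigO.add ?_ ?_).add ?_).add ?_
    · refine hre _ ?_
      have := ((hcst 2).mul (hconj _ _ hP)).mul h3
      simpa using this
    · have := (h3.norm_left.pow 2).trans (((isBigO_refl _ _).mul h31).congr_left
        (fun w => by rw [← pow_two]) : (fun w : ℂ => (‖w‖ ^ 3) ^ 2) =O[𝓝 0] _)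
      simpa using this
    · have := (hre _ ((hconj _ _ ((hcst q).mul hid)).mul ((hcst a2).mul (hid.pow 2)) |>.congr_right
        (fun w => by ring))).const_mul_left 2
      exact this
    · have hh := (((hcst a2).mul (hid.pow 2)).norm_left.pow 2)
      have h4 : (fun w : ℂ => (1 * ‖w‖ ^ 2) ^ 2) =O[𝓝 0] (fun w : ℂ => ‖w‖ ^ 3) :=
        ((isBigO_refl (fun w : ℂ => ‖w‖ ^ 3) (𝓝 0)).mul h1).congr (fun w => by ring)
          (fun w => by ring)
      exact hh.trans h4
  refine hrem.congr' ?_ EventuallyEq.rfl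
  filter_upwards [hE'] with w hw
  rw [hw]
  simp only [← Complex.normSq_eq_norm_sq, Complex.normSq_apply]
  simp [pow_two, Complex.mul_re, Complex.mul_im]
  ring

lemma Jet.nonpos_of_isLocalMax {u : ℂ → ℝ} {z b : ℂ} {A : ℝ} (hu : Jet u z b A)
    (hm : IsLocalMax u z) : A ≤ 0 := by
  by_contra hA
  push Not at hA
  obtain ⟨c, hc⟩ := hu
  have hc1 := isLittleO_iff.1 hc (half_pos hA)
  have ht : Tendsto (fun w : ℂ => z + w) (𝓝 0) (𝓝 z) := by
    have : Continuous fun w : ℂ => z + w := by fun_prop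
    simpa using this.tendsto 0
  have hm1 : ∀ᶠ w in 𝓝 (0 : ℂ), u (z + w) ≤ u z := ht.eventually hm
  obtain ⟨δ, hδ, hb⟩ := Metric.eventually_nhds_iff_ball.1 (hc1.and hm1)
  have key : ∀ w : ℂ, ‖w‖ = δ / 2 → (b * w).re + (c * w ^ 2).re + A / 2 * (δ / 2) ^ 2 ≤ 0 := by
    intro w hw
    obtain ⟨h1, h2⟩ := hb w (by simp [hw]; linarith)
    rw [norm_pow, norm_norm, hw] at h1
    have := (abs_le.1 h1).1
    linarith
  set t : ℂ := ((δ / 2 : ℝ) : ℂ)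
  have hn : ‖t‖ = δ / 2 := by simp [t]; linarith
  have k1 := key t hn
  have k2 := key (-t) (by simpa using hn)
  have k3 := key (Complex.I * t) (by simpa using hn)
  have k4 := key (-(Complex.I * t)) (by simpa using hn)
  have e : (c * (Complex.I * t) ^ 2) = -(c * t ^ 2) := by rw [mul_pow, Complex.I_sq]; ring
  simp only [neg_sq, mul_neg, Complex.neg_re, e] at k1 k2 k3 k4
  have : 0 < A / 2 * (δ / 2) ^ 2 := by positivity
  linarith

end FlatFront

namespace FlatFront
open Filter Topology Asymptotics

lemma Jet.continuousAt {u : ℂ → ℝ} {z b : ℂ} {A : ℝ} (hu : Jet u z b A) : ContinuousAt u z := by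
  obtain ⟨c, hc⟩ := hu
  have h1 : (fun w => u (z + w) - u z) =O[𝓝 0] (fun w : ℂ => ‖w‖) := by
    have := ((hc.isBigO.add (re_mul_sq_isBigO c)).add
      ((isBigO_refl (fun w : ℂ => ‖w‖ ^ 2) (𝓝 0)).const_mul_left A)).trans sq_isBigO_one
    refine (this.add (re_mul_isBigO b)).congr_left fun w => ?_
    ring
  have h0 : Tendsto (fun w => u (z + w) - u z) (𝓝 0) (𝓝 0) :=
    h1.trans_tendsto (tendsto_norm_zero (E := ℂ))
  have h2 : Tendsto (fun w => u (z + w)) (𝓝 0) (𝓝 (u z)) := by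
    simpa using h0.add_const (u z)
  have ht : Tendsto (fun x : ℂ => x - z) (𝓝 z) (𝓝 0) := by
    have : Continuous fun x : ℂ => x - z := by fun_prop
    simpa using this.tendsto z
  have := h2.comp ht
  simpa [ContinuousAt, Function.comp_def] using this

end FlatFront

namespace FlatFront
open Filter Topology Asymptotics

lemma rpow_bound_on {κ X : ℝ} (hκ : 0 < κ) (e : ℝ) :
    ∃ B, 1 ≤ B ∧ ∀ x ∈ Set.Icc κ X, x ^ e ≤ B := by
  have hc : ContinuousOn (fun x : ℝ => x ^ e) (Set.Icc κ X) := fun x hx =>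
    (Real.continuousAt_rpow_const x e (Or.inl (hκ.trans_le hx.1).ne')).continuousWithinAt
  obtain ⟨B, hB⟩ := isCompact_Icc.exists_bound_of_continuousOn hc
  exact ⟨max B 1, le_max_right _ _, fun x hx =>
    ((le_abs_self _).trans (hB x hx)).trans (le_max_left _ _)⟩

/-- The pointwise inequality behind the curvature estimate. -/
lemma pointwise_ineq {ι : Type*} [Fintype ι] [Nonempty ι] (N e : ι → ℝ) (hN : ∀ j, 0 < N j)
    {κ η a : ℝ} (hκ : 0 < κ) (hη : 0 < η) (ha : 0 < a) (he : ∀ j, 0 ≤ 1 - e j - η) :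
    ∃ ε > 0, ∃ c > 0, ∀ x : ι → ℝ, (∀ j, 0 < x j) → (∀ j, x j ≤ N j) →
      (∀ i j, i ≠ j → κ ≤ max (x i) (x j)) →
      c * ((∏ j, x j ^ (-e j)) ^ 2 * (∏ j, (1 + x j ^ (2 * η)) ^ ε) ^ 2) ≤
        a / 2 + ε * ∑ j, ((x j ^ (2 * η) / (1 + x j ^ (2 * η))) * (-η) +
          (x j ^ (2 * η) / (1 + x j ^ (2 * η))) * (1 - (x j ^ (2 * η) / (1 + x j ^ (2 * η)))) *
            (η ^ 2 * (N j ^ 2 / x j ^ 2 - 1))) := by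
  classical
  set n : ℝ := (Fintype.card ι : ℝ) with hn
  have hn0 : 0 < n := by rw [hn]; exact_mod_cast Fintype.card_pos
  set X : ℝ := ∑ j, N j with hX
  have hNX : ∀ j, N j ≤ X := fun j => Finset.single_le_sum (fun i _ => (hN i).le) (Finset.mem_univ j)
  have hX0 : 0 < X := by
    obtain ⟨j⟩ := ‹Nonempty ι›
    exact (hN j).trans_le (hNX j)
  set ε : ℝ := a / (2 * (n * η + η ^ 2)) with hε
  have hε0 : 0 < ε := by positivity
  have hεa : a / 2 = ε * (n * η + η ^ 2) := by rw [hε]; field_simp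
  -- bounds
  choose B hB1 hB using fun j => rpow_bound_on (X := X) hκ (-e j)
  set M : ℝ := 1 + X ^ (2 * η) with hM
  have hM1 : 1 ≤ M := by rw [hM]; linarith [Real.rpow_nonneg hX0.le (2 * η)]
  have hM0 : 0 < M := by linarith
  set P : ℝ := ∏ j, B j with hP
  have hP1 : 1 ≤ P := by
    have := Finset.prod_le_prod (s := Finset.univ) (f := fun _ : ι => (1 : ℝ)) (g := B)
      (fun _ _ => zero_le_one) (fun j _ => hB1 j)
    simpa using this
  set Q : ℝ := ∏ _j : ι, M ^ ε with hQ
  have hQ0 : 0 < Q := Finset.prod_pos fun j _ => by positivity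
  set k : ι → ℝ := fun j => ε * (η ^ 2 * (N j ^ 2 / M ^ 2)) with hk
  have hk0 : ∀ j, 0 < k j := fun j => by have := hN j; simp only [hk]; positivity
  set K : ι → ℝ := fun j => P ^ 2 * X ^ (2 * (1 - e j - η)) * Q ^ 2 with hK
  have hK0 : ∀ j, 0 < K j := fun j => by simp only [hK]; positivity
  set c : ℝ := 1 / (1 + ∑ j, K j / k j) with hc
  have hS : 0 ≤ ∑ j, K j / k j := Finset.sum_nonneg fun j _ => (div_pos (hK0 j) (hk0 j)).le
  have hc0 : 0 < c := by rw [hc]; positivity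
  have hcK : ∀ j, c * K j ≤ k j := by
    intro j
    have h1 : K j / k j ≤ 1 + ∑ j, K j / k j := by
      have := Finset.single_le_sum (f := fun j => K j / k j)
        (fun i _ => (div_pos (hK0 i) (hk0 i)).le) (Finset.mem_univ j)
      linarith
    rw [div_le_iff₀ (hk0 j)] at h1
    rw [hc, one_div, inv_mul_le_iff₀ (by positivity)]
    exact h1
  refine ⟨ε, hε0, c, hc0, fun x hx0 hxN hxm => ?_⟩
  obtain ⟨i, -, hi⟩ := Finset.exists_min_image Finset.univ x Finset.univ_nonempty
  have hxX : ∀ j, x j ≤ X := fun j => (hxN j).trans (hNX j)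
  have hother : ∀ j, j ≠ i → κ ≤ x j := fun j hj => by
    have := hxm j i hj
    rwa [max_eq_left (hi j (Finset.mem_univ _))] at this
  -- product bound
  have hprod : ∏ j, x j ^ (-e j) ≤ x i ^ (-e i) * P := by
    rw [← Finset.mul_prod_erase _ _ (Finset.mem_univ i)]
    have hxi : 0 ≤ x i ^ (-e i) := Real.rpow_nonneg (hx0 i).le _
    refine mul_le_mul_of_nonneg_left ?_ hxi
    calc ∏ j ∈ Finset.univ.erase i, x j ^ (-e j) ≤ ∏ j ∈ Finset.univ.erase i, B j :=
          Finset.prod_le_prod (fun j _ => Real.rpow_nonneg (hx0 j).le _)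
            (fun j hj => hB j _ ⟨hother j (Finset.ne_of_mem_erase hj), hxX j⟩)
      _ ≤ P := by
        rw [hP, ← Finset.mul_prod_erase _ _ (Finset.mem_univ i)]
        refine le_mul_of_one_le_left (Finset.prod_nonneg fun j _ => ?_) (hB1 i)
        linarith [hB1 j]
  have hprod0 : 0 ≤ ∏ j, x j ^ (-e j) := Finset.prod_nonneg fun j _ => Real.rpow_nonneg (hx0 j).le _
  have hs0 : ∀ j, 0 < x j ^ (2 * η) := fun j => Real.rpow_pos_of_pos (hx0 j) _
  have hsX : ∀ j, 1 + x j ^ (2 * η) ≤ M := fun j => by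
    rw [hM]
    have := Real.rpow_le_rpow (hx0 j).le (hxX j) (by positivity : 0 ≤ 2 * η)
    linarith
  have hprod2 : ∏ j, (1 + x j ^ (2 * η)) ^ ε ≤ Q := by
    refine Finset.prod_le_prod (fun j _ => ?_) (fun j _ => ?_)
    · have := hs0 j; positivity
    · have := hs0 j
      exact Real.rpow_le_rpow (by positivity) (hsX j) hε0.le
  have hprod20 : 0 ≤ ∏ j, (1 + x j ^ (2 * η)) ^ ε := Finset.prod_nonneg fun j _ => by
    have := hs0 j; positivity
  set y : ℝ := x i ^ (2 * η) / x i ^ 2 with hy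
  have hy0 : 0 < y := div_pos (hs0 i) (pow_pos (hx0 i) 2)
  have hsq : (x i ^ (-e i)) ^ 2 ≤ y * X ^ (2 * (1 - e i - η)) := by
    have h1 : (x i ^ (-e i)) ^ 2 = y * x i ^ (2 * (1 - e i - η)) := by
      rw [hy, ← Real.rpow_natCast, ← Real.rpow_natCast, ← Real.rpow_mul (hx0 i).le,
        ← Real.rpow_sub (hx0 i), ← Real.rpow_add (hx0 i)]
      congr 1; push_cast; ring
    rw [h1]
    refine mul_le_mul_of_nonneg_left ?_ hy0.le
    exact Real.rpow_le_rpow (hx0 i).le (hxX i) (by have := he i; linarith)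
  have hL : c * ((∏ j, x j ^ (-e j)) ^ 2 * (∏ j, (1 + x j ^ (2 * η)) ^ ε) ^ 2) ≤ k i * y := by
    calc c * ((∏ j, x j ^ (-e j)) ^ 2 * (∏ j, (1 + x j ^ (2 * η)) ^ ε) ^ 2)
        ≤ c * ((x i ^ (-e i) * P) ^ 2 * Q ^ 2) := by gcongr
      _ = c * ((x i ^ (-e i)) ^ 2 * P ^ 2 * Q ^ 2) := by ring
      _ ≤ c * (y * X ^ (2 * (1 - e i - η)) * P ^ 2 * Q ^ 2) := by gcongr
      _ = (c * K i) * y := by simp only [hK]; ring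
      _ ≤ k i * y := by gcongr; exact hcK i
  refine hL.trans ?_
  set σ : ι → ℝ := fun j => x j ^ (2 * η) / (1 + x j ^ (2 * η)) with hσ
  have hσ0 : ∀ j, 0 ≤ σ j := fun j => by have := hs0 j; simp only [hσ]; positivity
  have hσ1 : ∀ j, σ j ≤ 1 := fun j => by
    have := hs0 j; simp only [hσ]; rw [div_le_one (by positivity)]; linarith
  have hNx : ∀ j, 0 ≤ N j ^ 2 / x j ^ 2 - 1 := fun j => by
    rw [sub_nonneg, one_le_div (pow_pos (hx0 j) 2)]
    exact pow_le_pow_left₀ (hx0 j).le (hxN j) 2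
  have hσσ : x i ^ (2 * η) / M ^ 2 ≤ σ i * (1 - σ i) := by
    have h1 := hs0 i
    have : σ i * (1 - σ i) = x i ^ (2 * η) / (1 + x i ^ (2 * η)) ^ 2 := by
      simp only [hσ]; field_simp; ring
    rw [this]
    have := hsX i
    gcongr
  have hterm : ∀ j, -η + (if j = i then η ^ 2 * (N i ^ 2 / M ^ 2 * y) - η ^ 2 else 0) ≤
      σ j * (-η) + σ j * (1 - σ j) * (η ^ 2 * (N j ^ 2 / x j ^ 2 - 1)) := by
    intro j
    have h1 : -η ≤ σ j * (-η) := by nlinarith [hσ1 j]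
    have h2 : 0 ≤ σ j * (1 - σ j) := mul_nonneg (hσ0 j) (by linarith [hσ1 j])
    have h3 : 0 ≤ σ j * (1 - σ j) * (η ^ 2 * (N j ^ 2 / x j ^ 2 - 1)) :=
      mul_nonneg h2 (mul_nonneg (by positivity) (hNx j))
    split_ifs with hji
    · subst hji
      have h4 : x j ^ (2 * η) / M ^ 2 * (N j ^ 2 / x j ^ 2) ≤
          σ j * (1 - σ j) * (N j ^ 2 / x j ^ 2) := by gcongr
      have h5 : σ j * (1 - σ j) ≤ 1 := by nlinarith [hσ0 j, hσ1 j]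
      have h6 : N j ^ 2 / M ^ 2 * y = x j ^ (2 * η) / M ^ 2 * (N j ^ 2 / x j ^ 2) := by
        rw [hy]; ring
      have h7 : N j ^ 2 / M ^ 2 * y - 1 ≤ σ j * (1 - σ j) * (N j ^ 2 / x j ^ 2 - 1) := by
        rw [h6]; linarith
      have h8 := mul_le_mul_of_nonneg_left h7 (sq_nonneg η)
      linarith
    · linarith
  have hsum := Finset.sum_le_sum fun j (_ : j ∈ Finset.univ) => hterm j
  simp only [Finset.sum_add_distrib, Finset.sum_ite_eq', Finset.mem_univ, if_true,
    Finset.sum_const, Finset.card_univ, nsmul_eq_mul] at hsum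
  rw [← hn] at hsum
  have := mul_le_mul_of_nonneg_left hsum hε0.le
  rw [hεa]
  simp only [Finset.sum_add_distrib]
  simp only [hk]
  have h9 : ε * (η ^ 2 * (N i ^ 2 / M ^ 2)) * y = ε * (η ^ 2 * (N i ^ 2 / M ^ 2 * y)) := by ring
  rw [h9]
  linarith

end FlatFront

namespace FlatFront
open Filter Topology Asymptotics

lemma sep_const {ι : Type*} [Fintype ι] (p q : ι → ℂ)
    (hdet : ∀ i j, i ≠ j → p i * q j - p j * q i ≠ 0) :
    ∃ κ > 0, ∀ h g : ℂ, 0 < ‖h‖ ^ 2 + ‖g‖ ^ 2 → ∀ i j, i ≠ j →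
      κ ≤ max (‖p i * g + q i * h‖ / √(‖h‖ ^ 2 + ‖g‖ ^ 2))
        (‖p j * g + q j * h‖ / √(‖h‖ ^ 2 + ‖g‖ ^ 2)) := by
  have hd : ∀ᶠ d : ℝ in 𝓝[>] 0, ∀ i j, i ≠ j → d ≤ ‖p i * q j - p j * q i‖ := by
    refine eventually_all.2 fun i => eventually_all.2 fun j => ?_
    by_cases hij : i = j
    · simp [hij]
    · have : 0 < ‖p i * q j - p j * q i‖ := norm_pos_iff.2 (hdet i j hij)
      filter_upwards [nhdsWithin_le_nhds (eventually_lt_nhds this)] with d hd _ using hd.le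
  obtain ⟨d, hd, hd0⟩ := (hd.and self_mem_nhdsWithin).exists
  replace hd0 : 0 < d := hd0
  set T : ℝ := 1 + ∑ j, (‖p j‖ + ‖q j‖) with hT
  have hTj : ∀ j, ‖p j‖ + ‖q j‖ ≤ T := fun j => by
    have := Finset.single_le_sum (f := fun j => ‖p j‖ + ‖q j‖) (fun i _ => by positivity)
      (Finset.mem_univ j)
    linarith
  have hT0 : 0 < T := by
    have : 0 ≤ ∑ j, (‖p j‖ + ‖q j‖) := Finset.sum_nonneg fun i _ => by positivity
    linarith
  refine ⟨d / (2 * T), by positivity, fun h g hY i j hij => ?_⟩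
  set Y := ‖h‖ ^ 2 + ‖g‖ ^ 2
  have hY0 : 0 < √Y := Real.sqrt_pos.2 hY
  rw [max_div_div_right hY0.le, div_le_div_iff₀ (by positivity) hY0]
  set Li := p i * g + q i * h with hLi
  set Lj := p j * g + q j * h with hLj
  have hYle : √Y ≤ ‖h‖ + ‖g‖ := by
    rw [Real.sqrt_le_left (by positivity)]
    nlinarith [norm_nonneg h, norm_nonneg g]
  have h1 : ‖p i * q j - p j * q i‖ * ‖h‖ ≤ ‖p i‖ * ‖Lj‖ + ‖p j‖ * ‖Li‖ := by
    rw [← norm_mul, ← norm_mul, ← norm_mul]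
    calc _ = ‖p i * Lj - p j * Li‖ := by congr 1; rw [hLi, hLj]; ring
      _ ≤ _ := norm_sub_le _ _
  have h2 : ‖p i * q j - p j * q i‖ * ‖g‖ ≤ ‖q j‖ * ‖Li‖ + ‖q i‖ * ‖Lj‖ := by
    rw [← norm_mul, ← norm_mul, ← norm_mul]
    calc _ = ‖q j * Li - q i * Lj‖ := by congr 1; rw [hLi, hLj]; ring
      _ ≤ _ := norm_sub_le _ _
  set m := max ‖Li‖ ‖Lj‖
  have hm0 : 0 ≤ m := (norm_nonneg _).trans (le_max_left _ _)
  calc d * √Y ≤ ‖p i * q j - p j * q i‖ * (‖h‖ + ‖g‖) := by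
        gcongr; exact hd i j hij
    _ ≤ (‖p j‖ + ‖q j‖) * ‖Li‖ + (‖p i‖ + ‖q i‖) * ‖Lj‖ := by linarith
    _ ≤ T * m + T * m := by
        gcongr
        · exact hTj j
        · exact le_max_left _ _
        · exact hTj i
        · exact le_max_right _ _
    _ = m * (2 * T) := by ring

lemma lagrange_form (p q h g : ℂ) :
    ‖p * (starRingEnd ℂ h) - q * (starRingEnd ℂ g)‖ ^ 2 + ‖p * g + q * h‖ ^ 2 =
      (‖p‖ ^ 2 + ‖q‖ ^ 2) * (‖h‖ ^ 2 + ‖g‖ ^ 2) := by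
  simp only [← Complex.normSq_eq_norm_sq, Complex.normSq_apply]
  simp
  ring

lemma lagrange_w (h g h' g' : ℂ) :
    (‖h'‖ ^ 2 + ‖g'‖ ^ 2) * (‖h‖ ^ 2 + ‖g‖ ^ 2) -
      ‖(starRingEnd ℂ h) * h' + (starRingEnd ℂ g) * g'‖ ^ 2 = ‖h * g' - g * h'‖ ^ 2 := by
  simp only [← Complex.normSq_eq_norm_sq, Complex.normSq_apply]
  simp
  ring

lemma gradient_identity {p q h g h' g' : ℂ} (hL : p * g + q * h ≠ 0) {Y N S : ℝ}
    (hY : Y = ‖h‖ ^ 2 + ‖g‖ ^ 2) (hY0 : 0 < Y) (hN : N ^ 2 = ‖p‖ ^ 2 + ‖q‖ ^ 2)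
    (hS : S = ‖h * g' - g * h'‖ ^ 2 / Y ^ 2) (η : ℝ) :
    ‖(η : ℂ) * ((1 / ‖p * g + q * h‖ ^ 2 : ℝ) * (2 * (starRingEnd ℂ (p * g + q * h)) *
        (p * g' + q * h')) + ((-1 : ℝ) : ℂ) * ((1 / Y : ℝ) *
          (2 * (starRingEnd ℂ h) * h' + 2 * (starRingEnd ℂ g) * g')))‖ ^ 2 / 4 =
      S * (η ^ 2 * (N ^ 2 / (‖p * g + q * h‖ / √Y) ^ 2 - 1)) := by
  set L := p * g + q * h with hLdef
  have hLn : 0 < ‖L‖ := norm_pos_iff.2 hL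
  have hYc : (Y : ℂ) = h * (starRingEnd ℂ h) + g * (starRingEnd ℂ g) := by
    rw [hY, Complex.mul_conj, Complex.mul_conj, Complex.normSq_eq_norm_sq,
      Complex.normSq_eq_norm_sq]; push_cast; rfl
  have hYne : (Y : ℂ) ≠ 0 := by exact_mod_cast hY0.ne'
  have hLc : ((‖L‖ ^ 2 : ℝ) : ℂ) = L * (starRingEnd ℂ L) := by
    rw [Complex.mul_conj, Complex.normSq_eq_norm_sq]
  have hcL : starRingEnd ℂ L ≠ 0 := (map_ne_zero _).2 hL
  have key : (η : ℂ) * ((1 / ‖L‖ ^ 2 : ℝ) * (2 * (starRingEnd ℂ L) *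
        (p * g' + q * h')) + ((-1 : ℝ) : ℂ) * ((1 / Y : ℝ) *
          (2 * (starRingEnd ℂ h) * h' + 2 * (starRingEnd ℂ g) * g'))) =
      2 * η * ((h * g' - g * h') * (p * (starRingEnd ℂ h) - q * (starRingEnd ℂ g))) / (L * Y) := by
    rw [Complex.ofReal_div, Complex.ofReal_div, hLc]
    have : (1 : ℂ) * ((p * g' + q * h') * Y - L * ((starRingEnd ℂ h) * h' + (starRingEnd ℂ g) * g'))
        = (h * g' - g * h') * (p * (starRingEnd ℂ h) - q * (starRingEnd ℂ g)) := by
      rw [hYc, hLdef]; ring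
    rw [← this]
    push_cast
    field_simp
    ring
  rw [key, norm_div, norm_mul, norm_mul, norm_mul, norm_mul]
  have hl := lagrange_form p q h g
  rw [← hLdef, ← hN, ← hY] at hl
  have e1 : ‖p * (starRingEnd ℂ h) - q * (starRingEnd ℂ g)‖ ^ 2 = N ^ 2 * Y - ‖L‖ ^ 2 := by
    linarith
  have e2 : ‖(η : ℂ)‖ ^ 2 = η ^ 2 := by simp
  have e3 : ‖(Y : ℂ)‖ = Y := by simp [abs_of_pos hY0]
  rw [e3, div_pow (‖L‖), Real.sq_sqrt hY0.le, hS]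
  have : ‖(2 : ℂ)‖ = 2 := by simp
  rw [this]
  calc _ = 4 * ‖(η : ℂ)‖ ^ 2 * (‖h * g' - g * h'‖ ^ 2 *
      ‖p * (starRingEnd ℂ h) - q * (starRingEnd ℂ g)‖ ^ 2) / (‖L‖ ^ 2 * Y ^ 2) / 4 := by
        rw [div_pow]; ring
    _ = _ := by
        rw [e1, e2]; field_simp

/-- the curvature inequality, in the form of the existence of a jet with large `∂∂̄`-part -/
lemma curvature {ι : Type*} [Fintype ι] [Nonempty ι] (p q : ι → ℂ)
    (hdet : ∀ i j, i ≠ j → p i * q j - p j * q i ≠ 0) (hpq : ∀ j, p j ≠ 0 ∨ q j ≠ 0)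
    (e : ι → ℝ) {η a : ℝ} (hη : 0 < η) (ha : 0 < a) (he : ∀ j, 0 ≤ 1 - e j - η)
    (hsum : ∑ j, e j = a + 2) :
    ∃ c > 0, ∃ Φ : ℂ → ℂ → ℝ, (∀ h g, (0 < ‖h‖ ^ 2 + ‖g‖ ^ 2) →
        √(‖h‖ ^ 2 + ‖g‖ ^ 2) ^ a ≤ Real.exp (Φ h g)) ∧
      ∀ (h g : ℂ → ℂ) (w : ℂ), AnalyticAt ℂ h w → AnalyticAt ℂ g w →
        (∀ j, p j * g w + q j * h w ≠ 0) →
        ‖h w * deriv g w - g w * deriv h w‖ = ∏ j, ‖p j * g w + q j * h w‖ ^ e j →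
        ∃ b A, Jet (fun z => Φ (h z) (g z)) w b A ∧ c * Real.exp (Φ (h w) (g w)) ^ 2 ≤ A := by
  obtain ⟨κ, hκ, hsep⟩ := sep_const p q hdet
  set N : ι → ℝ := fun j => √(‖p j‖ ^ 2 + ‖q j‖ ^ 2) with hN
  have hN0' : ∀ j, 0 < ‖p j‖ ^ 2 + ‖q j‖ ^ 2 := fun j => by
    rcases hpq j with h | h
    · have := norm_pos_iff.2 h; positivity
    · have := norm_pos_iff.2 h; positivity
  have hN0 : ∀ j, 0 < N j := fun j => Real.sqrt_pos.2 (hN0' j)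
  obtain ⟨ε, hε, c, hc, hpt⟩ := pointwise_ineq N e hN0 hκ hη ha he
  set v : ι → ℂ → ℂ → ℝ := fun j h g => η * (Real.log (‖p j * g + q j * h‖ ^ 2) +
    (-1) * Real.log (‖h‖ ^ 2 + ‖g‖ ^ 2)) with hv
  refine ⟨c, hc, fun h g => a / 2 * Real.log (‖h‖ ^ 2 + ‖g‖ ^ 2) +
    ε * ∑ j, Real.log (1 + Real.exp (v j h g)), ?_, ?_⟩
  · intro h g hY
    rw [Real.sqrt_eq_rpow, ← Real.rpow_mul hY.le, Real.rpow_def_of_pos hY]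
    refine Real.exp_le_exp.2 ?_
    have : 0 ≤ ∑ j, Real.log (1 + Real.exp (v j h g)) := Finset.sum_nonneg fun j _ =>
      Real.log_nonneg (by linarith [Real.exp_pos (v j h g)])
    have := mul_nonneg hε.le this
    linarith
  intro h g w hh hg hL hW
  obtain ⟨j0⟩ := ‹Nonempty ι›
  set Y := ‖h w‖ ^ 2 + ‖g w‖ ^ 2 with hYdef
  have hY : 0 < Y := by
    by_contra hcon
    have h1 : ‖h w‖ ^ 2 = 0 := by nlinarith [sq_nonneg ‖h w‖, sq_nonneg ‖g w‖]
    have h2 : ‖g w‖ ^ 2 = 0 := by nlinarith [sq_nonneg ‖h w‖, sq_nonneg ‖g w‖]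
    apply hL j0
    simp at h1 h2
    simp [h1, h2]
  have hsY : 0 < √Y := Real.sqrt_pos.2 hY
  set W := h w * deriv g w - g w * deriv h w with hWdef
  obtain ⟨S, hS⟩ : ∃ S, S = ‖W‖ ^ 2 / Y ^ 2 := ⟨_, rfl⟩
  have hS0 : 0 ≤ S := by rw [hS]; positivity
  have hLn : ∀ j, 0 < ‖p j * g w + q j * h w‖ := fun j => norm_pos_iff.2 (hL j)
  set x : ι → ℝ := fun j => ‖p j * g w + q j * h w‖ / √Y with hx
  have hx0 : ∀ j, 0 < x j := fun j => div_pos (hLn j) hsY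
  have hxN : ∀ j, x j ≤ N j := fun j => by
    simp only [hx, hN]
    rw [div_le_iff₀ hsY, ← Real.sqrt_mul (hN0' j).le]
    apply Real.le_sqrt_of_sq_le
    have := lagrange_form (p j) (q j) (h w) (g w)
    nlinarith [sq_nonneg ‖p j * (starRingEnd ℂ (h w)) - q j * (starRingEnd ℂ (g w))‖]
  have hexp : ∀ j, Real.exp (v j (h w) (g w)) = x j ^ (2 * η) := fun j => by
    rw [Real.rpow_def_of_pos (hx0 j)]
    congr 1
    simp only [hv, hx]
    rw [Real.log_div (hLn j).ne' hsY.ne', Real.log_sqrt hY.le, Real.log_pow]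
    push_cast; ring
  have hmain := hpt x hx0 hxN (fun i j hij => hsep (h w) (g w) hY i j hij)
  -- jets
  have jY := (Jet.normSq hh).add (Jet.normSq hg)
  have jlogY := jY.log hY
  have hAY : (‖deriv h w‖ ^ 2 + ‖deriv g w‖ ^ 2) / (‖h w‖ ^ 2 + ‖g w‖ ^ 2) -
      ‖2 * (starRingEnd ℂ) (h w) * deriv h w + 2 * (starRingEnd ℂ) (g w) * deriv g w‖ ^ 2 /
        (4 * (‖h w‖ ^ 2 + ‖g w‖ ^ 2) ^ 2) = S := by
    rw [hS, hWdef, ← lagrange_w, ← hYdef,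
      show 2 * (starRingEnd ℂ) (h w) * deriv h w + 2 * (starRingEnd ℂ) (g w) * deriv g w =
        2 * ((starRingEnd ℂ) (h w) * deriv h w + (starRingEnd ℂ) (g w) * deriv g w) by ring,
      norm_mul, mul_pow]
    have : ‖(2 : ℂ)‖ = 2 := by simp
    rw [this]
    field_simp
    ring
  rw [hAY] at jlogY
  have jL : ∀ j, Jet (fun z => Real.log (‖p j * g z + q j * h z‖ ^ 2)) w
      ((1 / ‖p j * g w + q j * h w‖ ^ 2 : ℝ) * (2 * (starRingEnd ℂ (p j * g w + q j * h w)) *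
        (p j * deriv g w + q j * deriv h w))) 0 := fun j => by
    have ha : AnalyticAt ℂ (fun z => p j * g z + q j * h z) w := by fun_prop
    have hd : deriv (fun z => p j * g z + q j * h z) w = p j * deriv g w + q j * deriv h w := by
      have := ((hg.differentiableAt.hasDerivAt).const_mul (p j)).add
        ((hh.differentiableAt.hasDerivAt).const_mul (q j))
      exact this.deriv
    have := (Jet.normSq ha).log (pow_pos (hLn j) 2)
    rw [hd] at this
    convert this using 1
    rw [norm_mul, norm_mul, Complex.norm_conj]
    have h2 : ‖(2 : ℂ)‖ = 2 := by simp
    rw [h2]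
    have := (hLn j).ne'
    field_simp
    ring
  have jv := fun j => ((jL j).add (jlogY.const_mul (-1))).const_mul η
  have jsp := fun j => (jv j).softplus (σ := x j ^ (2 * η) / (1 + x j ^ (2 * η)))
    (by rw [← hexp j])
  have ju := (jlogY.const_mul (a / 2)).add ((Jet.sum Finset.univ fun j _ => jsp j).const_mul ε)
  refine ⟨_, _, ju, ?_⟩
  have hgrad := fun j => gradient_identity (hL j) hYdef hY (Real.sq_sqrt (hN0' j).le) hS η
  have hexpu : Real.exp (a / 2 * Real.log Y + ε * ∑ j, Real.log (1 + Real.exp (v j (h w) (g w))))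
      ^ 2 = S * ((∏ j, x j ^ (-e j)) ^ 2 * (∏ j, (1 + x j ^ (2 * η)) ^ ε) ^ 2) := by
    have h1 : Real.exp (ε * ∑ j, Real.log (1 + Real.exp (v j (h w) (g w)))) =
        ∏ j, (1 + x j ^ (2 * η)) ^ ε := by
      rw [Finset.mul_sum, Real.exp_sum]
      refine Finset.prod_congr rfl fun j _ => ?_
      rw [← hexp j, Real.rpow_def_of_pos (by positivity), mul_comm]
    have h2 : Real.exp (a / 2 * Real.log Y) = √Y ^ a := by
      rw [Real.sqrt_eq_rpow, ← Real.rpow_mul hY.le, Real.rpow_def_of_pos hY]; congr 1; ring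
    have h3 : ∏ j, x j ^ (-e j) = √Y ^ (a + 2) / ‖W‖ := by
      rw [hW, ← hsum, Real.rpow_sum_of_pos hsY, ← Finset.prod_div_distrib]
      refine Finset.prod_congr rfl fun j _ => ?_
      simp only [hx]
      rw [Real.rpow_neg (hx0 j).le, Real.div_rpow (hLn j).le hsY.le, inv_div]
    have hWpos : 0 < ‖W‖ := by
      rw [hW]; exact Finset.prod_pos fun j _ => Real.rpow_pos_of_pos (hLn j) _
    rw [Real.exp_add, mul_pow, h1, h2, h3, hS, Real.rpow_add hsY]
    have h4 : Y = √Y ^ 2 := (Real.sq_sqrt hY.le).symm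
    have h5 : √Y ^ (2 : ℝ) = Y := by rw [Real.rpow_two]; exact h4.symm
    rw [h5]
    field_simp
  change c * Real.exp (a / 2 * Real.log Y +
    ε * ∑ j, Real.log (1 + Real.exp (v j (h w) (g w)))) ^ 2 ≤ _
  rw [hexpu]
  have := mul_le_mul_of_nonneg_left hmain hS0
  refine le_trans (le_of_eq (by ring)) (this.trans (le_of_eq ?_))
  rw [mul_add, mul_left_comm S ε, Finset.mul_sum]
  congr 1
  · ring
  · congr 1
    refine Finset.sum_congr rfl fun j _ => ?_
    rw [mul_div_assoc, hgrad j]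
    simp only [hx, hN]
    ring

end FlatFront

namespace FlatFront
open Filter Topology Asymptotics

/-- Ahlfors–Schwarz type estimate on a disc. -/
lemma ahlfors_disc {c : ℝ} (hc : 0 < c) {u : ℂ → ℝ} {R : ℝ}
    (hcont : ContinuousOn u (Metric.ball 0 R))
    (hu : ∀ w ∈ Metric.ball (0 : ℂ) R, ∃ b A, Jet u w b A ∧ c * Real.exp (u w) ^ 2 ≤ A) :
    ∀ w ∈ Metric.ball (0 : ℂ) R, Real.exp (u w) ≤ 1 / √c * (R / (R ^ 2 - ‖w‖ ^ 2)) := by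
  intro w hw
  have hwR : ‖w‖ < R := by simpa using hw
  have hR : 0 < R := (norm_nonneg _).trans_lt hwR
  have hsc : 0 < √c := Real.sqrt_pos.2 hc
  have key : ∀ r, ‖w‖ < r → r < R → Real.exp (u w) * (r ^ 2 - ‖w‖ ^ 2) ≤ 1 / √c * r := by
    intro r hwr hrR
    have hr0 : 0 < r := (norm_nonneg _).trans_lt hwr
    have hsub : Metric.closedBall (0 : ℂ) r ⊆ Metric.ball 0 R := Metric.closedBall_subset_ball hrR
    have hΨ : ContinuousOn (fun z : ℂ => Real.exp (u z) * (r ^ 2 - ‖z‖ ^ 2))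
        (Metric.closedBall 0 r) := by
      refine ((hcont.mono hsub).rexp).mul ?_
      fun_prop
    obtain ⟨z, hz, hmax⟩ := (isCompact_closedBall (0 : ℂ) r).exists_isMaxOn
      ⟨0, by simp [hr0.le]⟩ hΨ
    have hwm : Real.exp (u w) * (r ^ 2 - ‖w‖ ^ 2) ≤ Real.exp (u z) * (r ^ 2 - ‖z‖ ^ 2) :=
      hmax (by simpa using hwr.le : w ∈ Metric.closedBall (0 : ℂ) r)
    refine hwm.trans ?_
    have hzpos : 0 < Real.exp (u z) * (r ^ 2 - ‖z‖ ^ 2) := by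
      refine lt_of_lt_of_le ?_ hwm
      have : 0 < r ^ 2 - ‖w‖ ^ 2 := by nlinarith [norm_nonneg w]
      positivity
    have ht : 0 < r ^ 2 - ‖z‖ ^ 2 := by
      by_contra hcon
      push Not at hcon
      nlinarith [Real.exp_pos (u z)]
    have hzr : ‖z‖ < r := by nlinarith [norm_nonneg z]
    obtain ⟨b, A, hj, hA⟩ := hu z (hsub hz)
    have jt : Jet (fun x : ℂ => r ^ 2 + (-1) * ‖x‖ ^ 2) z _ _ :=
      (Jet.const (r ^ 2) z).add ((Jet.normSq (f := fun x => x) analyticAt_id).const_mul (-1))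
    have jlt := jt.log (by linarith)
    have jtot := hj.add jlt
    have hlm : IsLocalMax (fun x => u x + Real.log (r ^ 2 + (-1) * ‖x‖ ^ 2)) z := by
      have hball : Metric.ball (0 : ℂ) r ∈ 𝓝 z := Metric.isOpen_ball.mem_nhds (by simpa using hzr)
      filter_upwards [hball] with x hx
      have hxr : ‖x‖ < r := by simpa using hx
      have hx' : 0 < r ^ 2 - ‖x‖ ^ 2 := by nlinarith [norm_nonneg x]
      have := hmax (Metric.ball_subset_closedBall hx)
      simp only [Set.mem_ofPred_eq] at this
      have h2 := Real.log_le_log (by positivity) this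
      rw [Real.log_mul (Real.exp_pos _).ne' hx'.ne', Real.log_mul (Real.exp_pos _).ne' ht.ne',
        Real.log_exp, Real.log_exp] at h2
      have e1 : ∀ y : ℂ, r ^ 2 + (-1) * ‖y‖ ^ 2 = r ^ 2 - ‖y‖ ^ 2 := fun y => by ring
      simp only [e1]
      exact h2
    have hle := jtot.nonpos_of_isLocalMax hlm
    have hd : deriv (fun x : ℂ => x) z = 1 := by simp
    rw [hd] at hle
    have hle' : A ≤ r ^ 2 / (r ^ 2 - ‖z‖ ^ 2) ^ 2 := by
      have e : (0 + -1 * ‖(1 : ℂ)‖ ^ 2) / (r ^ 2 + -1 * ‖z‖ ^ 2) -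
          ‖(0 : ℂ) + ((-1 : ℝ) : ℂ) * (2 * (starRingEnd ℂ) z * 1)‖ ^ 2 /
            (4 * (r ^ 2 + -1 * ‖z‖ ^ 2) ^ 2) = - (r ^ 2 / (r ^ 2 - ‖z‖ ^ 2) ^ 2) := by
        have : r ^ 2 + -1 * ‖z‖ ^ 2 = r ^ 2 - ‖z‖ ^ 2 := by ring
        rw [this]
        simp only [zero_add, norm_mul, Complex.norm_conj, Complex.norm_real]
        have h2 : ‖(2 : ℂ)‖ = 2 := by simp
        rw [h2]
        simp
        field_simp
        ring
      rw [e] at hle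
      linarith
    have h1 := hA.trans hle'
    rw [le_div_iff₀ (by positivity)] at h1
    have h2 : (√c * (Real.exp (u z) * (r ^ 2 - ‖z‖ ^ 2))) ^ 2 ≤ r ^ 2 := by
      rw [mul_pow, Real.sq_sqrt hc.le, mul_pow]; linarith
    have h3 := (pow_le_pow_iff_left₀ (by positivity) hr0.le two_ne_zero).1 h2
    rw [one_div, le_inv_mul_iff₀ hsc]
    exact h3
  have hlim : Real.exp (u w) * (R ^ 2 - ‖w‖ ^ 2) ≤ 1 / √c * R := by
    have hev : ∀ᶠ r in 𝓝[<] R, Real.exp (u w) * (r ^ 2 - ‖w‖ ^ 2) ≤ 1 / √c * r := by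
      filter_upwards [nhdsWithin_le_nhds (eventually_gt_nhds hwR), self_mem_nhdsWithin] with r h1 h2
      exact key r h1 h2
    have c1 : Tendsto (fun r : ℝ => Real.exp (u w) * (r ^ 2 - ‖w‖ ^ 2)) (𝓝[<] R)
        (𝓝 (Real.exp (u w) * (R ^ 2 - ‖w‖ ^ 2))) :=
      ((by fun_prop : Continuous fun r : ℝ => Real.exp (u w) * (r ^ 2 - ‖w‖ ^ 2)).tendsto R).mono_left
        nhdsWithin_le_nhds
    have c2 : Tendsto (fun r : ℝ => 1 / √c * r) (𝓝[<] R) (𝓝 (1 / √c * R)) :=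
      ((by fun_prop : Continuous fun r : ℝ => 1 / √c * r).tendsto R).mono_left nhdsWithin_le_nhds
    exact le_of_tendsto_of_tendsto c1 c2 hev
  have : 0 < R ^ 2 - ‖w‖ ^ 2 := by nlinarith [norm_nonneg w]
  rw [← mul_div_assoc, le_div_iff₀ this]
  exact hlim

lemma disc_estimate {ι : Type*} [Fintype ι] [Nonempty ι] (p q : ι → ℂ)
    (hdet : ∀ i j, i ≠ j → p i * q j - p j * q i ≠ 0) (hpq : ∀ j, p j ≠ 0 ∨ q j ≠ 0)
    (e : ι → ℝ) {η a : ℝ} (hη : 0 < η) (ha : 0 < a) (he : ∀ j, 0 ≤ 1 - e j - η)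
    (hsum : ∑ j, e j = a + 2) :
    ∃ C > 0, ∀ (R : ℝ) (h g : ℂ → ℂ), DifferentiableOn ℂ h (Metric.ball 0 R) →
      DifferentiableOn ℂ g (Metric.ball 0 R) →
      (∀ w ∈ Metric.ball (0 : ℂ) R, ∀ j, p j * g w + q j * h w ≠ 0) →
      (∀ w ∈ Metric.ball (0 : ℂ) R, ‖h w * deriv g w - g w * deriv h w‖ =
        ∏ j, ‖p j * g w + q j * h w‖ ^ e j) →
      ∀ w ∈ Metric.ball (0 : ℂ) R,
        √(‖h w‖ ^ 2 + ‖g w‖ ^ 2) ^ a ≤ C * (R / (R ^ 2 - ‖w‖ ^ 2)) := by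
  obtain ⟨c, hc, Φ, hΦ, hcurv⟩ := curvature p q hdet hpq e hη ha he hsum
  have hsc : 0 < √c := Real.sqrt_pos.2 hc
  refine ⟨1 / √c, by positivity, fun R h g hh hg hL hW w hw => ?_⟩
  have hjet : ∀ w ∈ Metric.ball (0 : ℂ) R, ∃ b A, Jet (fun z => Φ (h z) (g z)) w b A ∧
      c * Real.exp (Φ (h w) (g w)) ^ 2 ≤ A := fun w hw =>
    hcurv h g w (hh.analyticAt (Metric.isOpen_ball.mem_nhds hw))
      (hg.analyticAt (Metric.isOpen_ball.mem_nhds hw)) (hL w hw) (hW w hw)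
  have hY : 0 < ‖h w‖ ^ 2 + ‖g w‖ ^ 2 := by
    obtain ⟨j0⟩ := ‹Nonempty ι›
    by_contra hcon
    have h1 : ‖h w‖ ^ 2 = 0 := by nlinarith [sq_nonneg ‖h w‖, sq_nonneg ‖g w‖]
    have h2 : ‖g w‖ ^ 2 = 0 := by nlinarith [sq_nonneg ‖h w‖, sq_nonneg ‖g w‖]
    apply hL w hw j0
    simp at h1 h2
    simp [h1, h2]
  refine (hΦ _ _ hY).trans ?_
  refine ahlfors_disc hc (u := fun z => Φ (h z) (g z)) ?_ hjet w hw
  intro z hz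
  obtain ⟨b, A, hj, -⟩ := hjet z hz
  exact hj.continuousAt.continuousWithinAt

end FlatFront

namespace FlatFront
open Filter Topology Asymptotics

/-- `f` is a holomorphic local isometry from (an open subset of) the plane to `O` with metric `τ|dz|`. -/
def US (O : Set ℂ) (τ : ℂ → ℝ) (U : Set ℂ) (f : ℂ → ℂ) : Prop :=
  IsOpen U ∧ DifferentiableOn ℂ f U ∧ ∀ w ∈ U, f w ∈ O ∧ ‖deriv f w‖ * τ (f w) = 1

/-- There is a local isometry on the disc of radius `r` starting at `p`. -/
def HasDisc (O : Set ℂ) (τ : ℂ → ℝ) (p : ℂ) (r : ℝ) : Prop :=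
  ∃ G : ℂ → ℂ, US O τ (Metric.ball 0 r) G ∧ G 0 = p

/-- `τ` is locally the modulus of a nonvanishing holomorphic function. -/
def LocMod (O : Set ℂ) (τ : ℂ → ℝ) : Prop :=
  ∀ p ∈ O, ∃ (φ : ℂ → ℂ) (ρ : ℝ), 0 < ρ ∧ Metric.ball p ρ ⊆ O ∧
    DifferentiableOn ℂ φ (Metric.ball p ρ) ∧ ∀ z ∈ Metric.ball p ρ, ‖φ z‖ = τ z ∧ φ z ≠ 0

lemma US.mono {O : Set ℂ} {τ : ℂ → ℝ} {U V : Set ℂ} {f : ℂ → ℂ} (h : US O τ U f) (hV : IsOpen V)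
    (hVU : V ⊆ U) : US O τ V f :=
  ⟨hV, h.2.1.mono hVU, fun w hw => h.2.2 w (hVU hw)⟩

lemma HasDisc.mono {O : Set ℂ} {τ : ℂ → ℝ} {p : ℂ} {r s : ℝ} (h : HasDisc O τ p r) (hs : s ≤ r) :
    HasDisc O τ p s := by
  obtain ⟨G, hG, h0⟩ := h
  exact ⟨G, hG.mono Metric.isOpen_ball (Metric.ball_subset_ball hs), h0⟩

lemma US.differentiableAt {O : Set ℂ} {τ : ℂ → ℝ} {U : Set ℂ} {f : ℂ → ℂ} (h : US O τ U f)
    {w : ℂ} (hw : w ∈ U) : DifferentiableAt ℂ f w :=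
  (h.2.1 w hw).differentiableAt (h.1.mem_nhds hw)

lemma US.analyticOnNhd {O : Set ℂ} {τ : ℂ → ℝ} {U : Set ℂ} {f : ℂ → ℂ} (h : US O τ U f) :
    AnalyticOnNhd ℂ f U := h.2.1.analyticOnNhd h.1

lemma US.congr_local {O : Set ℂ} {τ : ℂ → ℝ} {V : Set ℂ} {f : ℂ → ℂ} (hV : IsOpen V)
    (h : ∀ w ∈ V, ∃ (U : Set ℂ) (k : ℂ → ℂ), w ∈ U ∧ US O τ U k ∧ f =ᶠ[𝓝 w] k) :
    US O τ V f := by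
  refine ⟨hV, fun w hw => ?_, fun w hw => ?_⟩
  · obtain ⟨U, k, hwU, hk, he⟩ := h w hw
    exact ((hk.differentiableAt hwU).congr_of_eventuallyEq he).differentiableWithinAt
  · obtain ⟨U, k, hwU, hk, he⟩ := h w hw
    rw [he.deriv_eq, he.eq_of_nhds]
    exact hk.2.2 w hwU

lemma chart {O : Set ℂ} {τ : ℂ → ℝ} (hτ : LocMod O τ) {p : ℂ} (hp : p ∈ O) :
    ∃ e : OpenPartialHomeomorph ℂ ℂ, p ∈ e.source ∧ e.source ⊆ O ∧
      ∀ z ∈ e.source, ∃ d, HasDerivAt e d z ∧ ‖d‖ = τ z ∧ d ≠ 0 := by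
  obtain ⟨φ, ρ, hρ, hsub, hd, hφ⟩ := hτ p hp
  obtain ⟨Φ, hΦ⟩ := hd.isExactOn_ball
  have hpb : p ∈ Metric.ball p ρ := Metric.mem_ball_self hρ
  have han : AnalyticAt ℂ Φ p :=
    DifferentiableOn.analyticAt (s := Metric.ball p ρ)
      (fun z hz => (hΦ z hz).differentiableAt.differentiableWithinAt)
      (Metric.isOpen_ball.mem_nhds hpb)
  have hne : deriv Φ p ≠ 0 := by rw [(hΦ p hpb).deriv]; exact (hφ p hpb).2
  let i : ℂ ≃L[ℂ] ℂ := .unitsEquivAut ℂ (.mk0 _ hne)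
  have hfd : HasStrictFDerivAt Φ i.toContinuousLinearMap p := han.hasStrictDerivAt
  let R : OpenPartialHomeomorph ℂ ℂ := hfd.toOpenPartialHomeomorph _
  have hx : p ∈ R.source := HasStrictFDerivAt.mem_toOpenPartialHomeomorph_source _
  refine ⟨R.restrOpen (Metric.ball p ρ) Metric.isOpen_ball, ⟨hx, hpb⟩, fun z hz => hsub hz.2, ?_⟩
  intro z hz
  exact ⟨φ z, hΦ z hz.2, hφ z hz.2⟩

lemma hasDisc_near {O : Set ℂ} {τ : ℂ → ℝ} (hτ : LocMod O τ) {p : ℂ} (hp : p ∈ O) :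
    ∃ r > 0, ∀ᶠ x in 𝓝 p, HasDisc O τ x r := by
  obtain ⟨e, hpe, hsub, hd⟩ := chart hτ hp
  obtain ⟨r, hr, hball⟩ := Metric.isOpen_iff.1 e.open_target (e p) (e.map_source hpe)
  refine ⟨r / 2, by positivity, ?_⟩
  have h1 : ∀ᶠ x in 𝓝 p, e x ∈ Metric.ball (e p) (r / 2) :=
    (e.continuousAt hpe) (Metric.ball_mem_nhds _ (by positivity))
  filter_upwards [h1, e.open_source.mem_nhds hpe] with x hx hxs
  have hmem : ∀ w ∈ Metric.ball (0 : ℂ) (r / 2), e x + w ∈ e.target := by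
    intro w hw
    apply hball
    rw [Metric.mem_ball, dist_eq_norm] at hx ⊢
    have hw' : ‖w‖ < r / 2 := by simpa using hw
    calc ‖e x + w - e p‖ = ‖(e x - e p) + w‖ := by ring_nf
      _ ≤ ‖e x - e p‖ + ‖w‖ := norm_add_le _ _
      _ < r := by linarith
  have hder : ∀ w ∈ Metric.ball (0 : ℂ) (r / 2), ∃ d, ‖d‖ = τ (e.symm (e x + w)) ∧ d ≠ 0 ∧
      HasDerivAt (fun w => e.symm (e x + w)) d⁻¹ w := by
    intro w hw
    have ht := hmem w hw
    obtain ⟨d, hd1, hd2, hd3⟩ := hd _ (e.map_target ht)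
    refine ⟨d, hd2, hd3, ?_⟩
    have := e.hasDerivAt_symm ht hd3 hd1
    exact HasDerivAt.comp_const_add (e x) w this
  refine ⟨fun w => e.symm (e x + w), ⟨Metric.isOpen_ball, ?_, ?_⟩, ?_⟩
  · intro w hw
    obtain ⟨d, _, _, h3⟩ := hder w hw
    exact h3.differentiableAt.differentiableWithinAt
  · intro w hw
    obtain ⟨d, h1, h2, h3⟩ := hder w hw
    refine ⟨hsub (e.map_target (hmem w hw)), ?_⟩
    rw [h3.deriv, ← h1, ← norm_mul, inv_mul_cancel₀ h2, norm_one]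
  · simp [e.left_inv hxs]

lemma US.affine {O : Set ℂ} {τ : ℂ → ℝ} {U : Set ℂ} {f : ℂ → ℂ} (hf : US O τ U f)
    {w : ℂ} (hw : w ∈ U) (e : OpenPartialHomeomorph ℂ ℂ)
    (he : ∀ z ∈ e.source, ∃ d, HasDerivAt e d z ∧ ‖d‖ = τ z ∧ d ≠ 0) (hfw : f w ∈ e.source) :
    ∃ a : ℂ, ‖a‖ = 1 ∧ ∀ᶠ x in 𝓝 w, f x ∈ e.source ∧ e (f x) = e (f w) + a * (x - w) := by
  have hc : ContinuousAt f w := (hf.differentiableAt hw).continuousAt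
  have h1 : ∀ᶠ x in 𝓝 w, x ∈ U ∧ f x ∈ e.source :=
    Filter.Eventually.and (hf.1.mem_nhds hw) (hc (e.open_source.mem_nhds hfw))
  obtain ⟨r, hr, hball⟩ := Metric.eventually_nhds_iff_ball.1 h1
  have hd : ∀ x ∈ Metric.ball w r, DifferentiableAt ℂ (fun x => e (f x)) x ∧
      ‖deriv (fun x => e (f x)) x‖ = 1 := by
    intro x hx
    obtain ⟨hxU, hxs⟩ := hball x hx
    obtain ⟨d, hd1, hd2, hd3⟩ := he _ hxs
    have := hd1.comp x (hf.differentiableAt hxU).hasDerivAt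
    refine ⟨this.differentiableAt, ?_⟩
    have h3 : deriv (fun x => e (f x)) x = d * deriv f x := this.deriv
    rw [h3, norm_mul, hd2, mul_comm]
    exact (hf.2.2 x hxU).2
  have hwb : w ∈ Metric.ball w r := Metric.mem_ball_self hr
  have hdd : DifferentiableOn ℂ (deriv (fun x => e (f x))) (Metric.ball w r) :=
    DifferentiableOn.deriv (fun x hx => (hd x hx).1.differentiableWithinAt) Metric.isOpen_ball
  have hconst := Complex.eventually_eq_of_isLocalMax_norm
    (f := deriv (fun x => e (f x))) (c := w)
    (by filter_upwards [Metric.ball_mem_nhds w hr] with x hx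
        exact (hdd x hx).differentiableAt (Metric.isOpen_ball.mem_nhds hx))
    (by filter_upwards [Metric.ball_mem_nhds w hr] with x hx
        simp [(hd x hx).2, (hd w hwb).2])
  set a := deriv (fun x => e (f x)) w with ha
  obtain ⟨s, hs, hsball⟩ := Metric.eventually_nhds_iff_ball.1
    (hconst.and (Metric.ball_mem_nhds w hr))
  refine ⟨a, (hd w hwb).2, ?_⟩
  filter_upwards [Metric.ball_mem_nhds w hs, h1] with x hx hx1
  refine ⟨hx1.2, ?_⟩
  have hz : ∀ y ∈ Metric.ball w s, HasDerivAt (fun x => e (f x) - a * (x - w)) 0 y := by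
    intro y hy
    obtain ⟨h2, h3⟩ := hsball y hy
    have h4 := (hd y h3).1.hasDerivAt
    rw [h2] at h4
    have h5 : HasDerivAt (fun x : ℂ => a * (x - w)) (a * 1) y :=
      ((hasDerivAt_id y).sub_const w).const_mul a
    have h6 := h4.sub h5
    rw [mul_one, sub_self] at h6
    exact h6
  have := Metric.isOpen_ball.is_const_of_deriv_eq_zero
    (convex_ball w s).isPreconnected
    (fun y hy => (hz y hy).differentiableAt.differentiableWithinAt)
    (fun y hy => (hz y hy).deriv) hx (Metric.mem_ball_self hs)
  simp only [sub_self, mul_zero, sub_zero] at this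
  linear_combination this

lemma US.extend {O : Set ℂ} {τ : ℂ → ℝ} (hτ : LocMod O τ) {U : Set ℂ} {E : ℂ → ℂ}
    (hE : US O τ U E) {w : ℂ} (hw : w ∈ U) {r : ℝ} (hr : 0 < r) (hh : HasDisc O τ (E w) r) :
    ∃ G, US O τ (Metric.ball w r) G ∧ G =ᶠ[𝓝 w] E := by
  obtain ⟨G, hG, h0⟩ := hh
  obtain ⟨e, hpe, hsub, hd⟩ := chart hτ (hE.2.2 w hw).1
  obtain ⟨a, ha, hEa⟩ := hE.affine hw e hd hpe
  obtain ⟨b, hb, hGb⟩ := hG.affine (Metric.mem_ball_self hr) e hd (by rw [h0]; exact hpe)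
  have hb0 : b ≠ 0 := by rintro rfl; simp at hb
  have hc : ‖a / b‖ = 1 := by rw [norm_div, ha, hb, div_one]
  have hmem : ∀ x ∈ Metric.ball w r, (a / b) * (x - w) ∈ Metric.ball (0 : ℂ) r := by
    intro x hx
    rw [mem_ball_zero_iff, norm_mul, hc, one_mul, ← dist_eq_norm]
    exact hx
  have hder : ∀ x ∈ Metric.ball w r, HasDerivAt (fun x => G ((a / b) * (x - w)))
      (deriv G ((a / b) * (x - w)) * (a / b)) x := by
    intro x hx
    have h1 : HasDerivAt (fun x : ℂ => (a / b) * (x - w)) (a / b) x := by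
      simpa using ((hasDerivAt_id x).sub_const w).const_mul (a / b)
    exact (hG.differentiableAt (hmem x hx)).hasDerivAt.comp x h1
  refine ⟨fun x => G ((a / b) * (x - w)), ⟨Metric.isOpen_ball, fun x hx =>
    (hder x hx).differentiableAt.differentiableWithinAt, fun x hx => ?_⟩, ?_⟩
  · obtain ⟨h1, h2⟩ := hG.2.2 _ (hmem x hx)
    refine ⟨h1, ?_⟩
    rw [(hder x hx).deriv, norm_mul, hc, mul_one]
    exact h2
  · have ht : Tendsto (fun x : ℂ => (a / b) * (x - w)) (𝓝 w) (𝓝 0) := by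
      have : ContinuousAt (fun x : ℂ => (a / b) * (x - w)) w := by fun_prop
      simpa [ContinuousAt] using this
    filter_upwards [hEa, ht.eventually hGb] with x hx1 hx2
    apply e.injOn hx2.1 hx1.1
    rw [hx2.2, hx1.2, h0]
    field_simp
    ring

lemma US.eqOn {O : Set ℂ} {τ : ℂ → ℝ} {U V : Set ℂ} {f k : ℂ → ℂ} (hf : US O τ U f)
    (hk : US O τ V k) {S : Set ℂ} (hSU : S ⊆ U) (hSV : S ⊆ V) (hS : Convex ℝ S) {z : ℂ}
    (hz : z ∈ S) (h : f =ᶠ[𝓝 z] k) : Set.EqOn f k S :=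
  AnalyticOnNhd.eqOn_of_preconnected_of_eventuallyEq (hf.analyticOnNhd.mono hSU)
    (hk.analyticOnNhd.mono hSV) hS.isPreconnected hz h

end FlatFront

namespace FlatFront
open Filter Topology Asymptotics

lemma US.hasDisc_of_ball {O : Set ℂ} {τ : ℂ → ℝ} {w : ℂ} {r : ℝ} {G : ℂ → ℂ}
    (hG : US O τ (Metric.ball w r) G) : HasDisc O τ (G w) r := by
  have hmem : ∀ x ∈ Metric.ball (0 : ℂ) r, w + x ∈ Metric.ball w r := by
    intro x hx
    simpa [Metric.mem_ball, dist_eq_norm] using hx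
  have hder : ∀ x ∈ Metric.ball (0 : ℂ) r, HasDerivAt (fun x => G (w + x)) (deriv G (w + x)) x :=
    fun x hx => HasDerivAt.comp_const_add w x (hG.differentiableAt (hmem x hx)).hasDerivAt
  refine ⟨fun x => G (w + x), ⟨Metric.isOpen_ball, fun x hx =>
    (hder x hx).differentiableAt.differentiableWithinAt, fun x hx => ?_⟩, by simp⟩
  rw [(hder x hx).deriv]
  exact hG.2.2 _ (hmem x hx)

lemma glue_one {O : Set ℂ} {τ : ℂ → ℝ} (hτ : LocMod O τ) {p : ℂ} {r0 R : ℝ} (hr0 : 0 < r0)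
    (h0 : HasDisc O τ p r0) (hR : 0 < R) (h : ∀ r < R, HasDisc O τ p r) :
    ∃ E, US O τ (Metric.ball 0 R) E ∧ E 0 = p := by
  obtain ⟨E0, hE0, hE0p⟩ := h0
  have hG : ∀ r : ℝ, ∃ G, 0 < r → r < R → US O τ (Metric.ball 0 r) G ∧ G =ᶠ[𝓝 0] E0 := by
    intro r
    by_cases hr : 0 < r ∧ r < R
    · obtain ⟨G, hG⟩ := hE0.extend hτ (Metric.mem_ball_self hr0) hr.1 (by rw [hE0p]; exact h r hr.2)
      exact ⟨G, fun _ _ => hG⟩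
    · exact ⟨E0, fun h1 h2 => absurd ⟨h1, h2⟩ hr⟩
  choose G hG using hG
  have key : ∀ s, 0 < s → s < R → ∀ x ∈ Metric.ball (0 : ℂ) s, G ((‖x‖ + R) / 2) x = G s x := by
    intro s hs hsR x hx
    have hxs : ‖x‖ < s := by simpa using hx
    have hx0 := norm_nonneg x
    obtain ⟨h1, h2⟩ := hG ((‖x‖ + R) / 2) (by linarith) (by linarith)
    obtain ⟨h3, h4⟩ := hG s hs hsR
    exact h1.eqOn h3 (S := Metric.ball 0 (min ((‖x‖ + R) / 2) s))
      (Metric.ball_subset_ball (min_le_left _ _)) (Metric.ball_subset_ball (min_le_right _ _))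
      (convex_ball _ _) (z := 0) (Metric.mem_ball_self (lt_min (by linarith) hs))
      (h2.trans h4.symm) (by rw [mem_ball_zero_iff]; exact lt_min (by linarith) hxs)
  refine ⟨fun x => G ((‖x‖ + R) / 2) x, US.congr_local Metric.isOpen_ball fun w hw => ?_, ?_⟩
  · have hwR : ‖w‖ < R := by simpa using hw
    have hw0 := norm_nonneg w
    have hws : w ∈ Metric.ball (0 : ℂ) ((‖w‖ + R) / 2) := by
      rw [mem_ball_zero_iff]; linarith
    refine ⟨_, _, hws, (hG ((‖w‖ + R) / 2) (by linarith) (by linarith)).1, ?_⟩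
    filter_upwards [Metric.isOpen_ball.mem_nhds hws] with x hx
    exact key _ (by linarith) (by linarith) x hx
  · simp only [norm_zero, zero_add]
    rw [(hG (R / 2) (by linarith) (by linarith)).2.eq_of_nhds, hE0p]

lemma glue_two {O : Set ℂ} {τ : ℂ → ℝ} (hτ : LocMod O τ) {R r0 : ℝ} (hR : 0 < R) (hr0 : 0 < r0)
    {E : ℂ → ℂ} (hE : US O τ (Metric.ball 0 R) E)
    (h : ∀ w ∈ Metric.ball (0 : ℂ) R, HasDisc O τ (E w) r0) :
    HasDisc O τ (E 0) (R + r0 / 2) := by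
  have hH : ∀ w : ℂ, ∃ H, w ∈ Metric.ball (0 : ℂ) R →
      US O τ (Metric.ball w r0) H ∧ H =ᶠ[𝓝 w] E := by
    intro w
    by_cases hw : w ∈ Metric.ball (0 : ℂ) R
    · obtain ⟨G, hG⟩ := hE.extend hτ hw hr0 (h w hw)
      exact ⟨G, fun _ => hG⟩
    · exact ⟨E, fun h1 => absurd h1 hw⟩
  choose H hH using hH
  have hHE : ∀ w ∈ Metric.ball (0 : ℂ) R, Set.EqOn (H w) E (Metric.ball w r0 ∩ Metric.ball 0 R) := by
    intro w hw
    exact (hH w hw).1.eqOn hE Set.inter_subset_left Set.inter_subset_right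
      ((convex_ball _ _).inter (convex_ball _ _)) ⟨Metric.mem_ball_self hr0, hw⟩ (hH w hw).2
  set k : ℝ := R / (R + r0 / 2) with hk
  have hk0 : 0 < k := by positivity
  have hkR : k * (R + r0 / 2) = R := by rw [hk]; field_simp
  have hk1 : k < 1 := by rw [hk, div_lt_one (by positivity)]; linarith
  have hc1 : ∀ x ∈ Metric.ball (0 : ℂ) (R + r0 / 2), (k : ℂ) * x ∈ Metric.ball (0 : ℂ) R := by
    intro x hx
    rw [mem_ball_zero_iff] at hx ⊢
    rw [norm_mul, Complex.norm_real, Real.norm_of_nonneg hk0.le]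
    nlinarith
  have hc2 : ∀ x ∈ Metric.ball (0 : ℂ) (R + r0 / 2), x ∈ Metric.ball ((k : ℂ) * x) r0 := by
    intro x hx
    rw [mem_ball_zero_iff] at hx
    rw [Metric.mem_ball, dist_eq_norm]
    have : x - k * x = ((1 - k : ℝ) : ℂ) * x := by push_cast; ring
    rw [this, norm_mul, Complex.norm_real, Real.norm_of_nonneg (by linarith)]
    nlinarith
  refine ⟨fun x => H ((k : ℂ) * x) x, US.congr_local Metric.isOpen_ball fun w hw => ?_, ?_⟩
  · have hcw := hc1 w hw
    refine ⟨_, _, hc2 w hw, (hH _ hcw).1, ?_⟩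
    have e1 : ∀ᶠ x in 𝓝 w, (k : ℂ) * x ∈ Metric.ball ((k : ℂ) * w) r0 := by
      have : ContinuousAt (fun x : ℂ => (k : ℂ) * x) w := by fun_prop
      exact this (Metric.ball_mem_nhds _ hr0)
    filter_upwards [Metric.isOpen_ball.mem_nhds hw, Metric.isOpen_ball.mem_nhds (hc2 w hw), e1]
      with x hx1 hx2 hx3
    have hcx := hc1 x hx1
    refine (hH _ hcx).1.eqOn (hH _ hcw).1
      (S := Metric.ball ((k : ℂ) * x) r0 ∩ Metric.ball ((k : ℂ) * w) r0)
      Set.inter_subset_left Set.inter_subset_right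
      ((convex_ball _ _).inter (convex_ball _ _)) (z := (k : ℂ) * x)
      ⟨Metric.mem_ball_self hr0, hx3⟩ ?_ ⟨hc2 x hx1, hx2⟩
    refine (hH _ hcx).2.trans ?_
    filter_upwards [(Metric.isOpen_ball.inter Metric.isOpen_ball).mem_nhds ⟨hx3, hcx⟩] with y hy
    exact (hHE _ hcw hy).symm
  · simp only [mul_zero]
    exact (hH 0 (Metric.mem_ball_self hR)).2.eq_of_nhds

theorem ray {O : Set ℂ} {τ : ℂ → ℝ} (hτ : LocMod O τ) {p : ℂ} (hp : p ∈ O) {B : ℝ}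
    (hB : ∀ r, HasDisc O τ p r → r ≤ B) :
    ∃ (R : ℝ) (E : ℂ → ℂ) (w0 : ℂ), 0 < R ∧ US O τ (Metric.ball 0 R) E ∧ E 0 = p ∧ ‖w0‖ = R ∧
      ∀ q ∈ O, ¬ MapClusterPt q (𝓝[<] (1 : ℝ)) (fun t : ℝ => E (t * w0)) := by
  obtain ⟨r0, hr0, hnear⟩ := hasDisc_near hτ hp
  have h0 := hnear.self_of_nhds
  set R := sSup {r | HasDisc O τ p r} with hRdef
  have hbdd : BddAbove {r | HasDisc O τ p r} := ⟨B, fun r hr => hB r hr⟩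
  have hR : 0 < R := hr0.trans_le (le_csSup hbdd h0)
  have hlt : ∀ r < R, HasDisc O τ p r := by
    intro r hr
    obtain ⟨s, hs, hrs⟩ := exists_lt_of_lt_csSup ⟨r0, h0⟩ hr
    exact HasDisc.mono hs hrs.le
  obtain ⟨E, hE, hEp⟩ := glue_one hτ hr0 h0 hR hlt
  have hw : ∃ w0 ∈ Metric.closedBall (0 : ℂ) R, ∀ t ∈ 𝓝[Metric.closedBall (0 : ℂ) R] w0,
      ¬ ∃ r > 0, ∀ w ∈ t ∩ Metric.ball (0 : ℂ) R, HasDisc O τ (E w) r := by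
    by_contra hcon
    push Not at hcon
    have : ∃ r > 0, ∀ w ∈ Metric.closedBall (0 : ℂ) R ∩ Metric.ball (0 : ℂ) R,
        HasDisc O τ (E w) r := (isCompact_closedBall (0 : ℂ) R).induction_on
      ⟨1, one_pos, by simp⟩
      (fun s t hst ⟨r, hr, h⟩ => ⟨r, hr, fun w hw => h w ⟨hst hw.1, hw.2⟩⟩)
      (fun s t ⟨r, hr, h⟩ ⟨r', hr', h'⟩ => ⟨min r r', lt_min hr hr', fun w hw => by
        rcases hw.1 with hw1 | hw1
        · exact (h w ⟨hw1, hw.2⟩).mono (min_le_left _ _)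
        · exact (h' w ⟨hw1, hw.2⟩).mono (min_le_right _ _)⟩)
      hcon
    obtain ⟨r, hr, h⟩ := this
    have h2 := glue_two hτ hR hr hE
      (fun w hw => h w ⟨Metric.ball_subset_closedBall hw, hw⟩)
    rw [hEp] at h2
    have := le_csSup hbdd h2
    linarith
  obtain ⟨w0, hw0, hbad⟩ := hw
  have hw0R : ‖w0‖ = R := by
    by_contra hne
    have hlt' : ‖w0‖ < R := lt_of_le_of_ne (by simpa using hw0) hne
    have hw0b : w0 ∈ Metric.ball (0 : ℂ) R := by simpa using hlt'
    obtain ⟨r, hr, hev⟩ := hasDisc_near hτ (hE.2.2 w0 hw0b).1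
    have := (hE.differentiableAt hw0b).continuousAt.eventually hev
    exact hbad _ (mem_nhdsWithin_of_mem_nhds this) ⟨r, hr, fun w hw => hw.1⟩
  refine ⟨R, E, w0, hR, hE, hEp, hw0R, fun q hq hcl => ?_⟩
  obtain ⟨r, hr, hev⟩ := hasDisc_near hτ hq
  have hfr := hcl.frequently hev
  have hcl1 : ∀ᶠ t : ℝ in 𝓝[<] 1, (t : ℂ) * w0 ∈ Metric.ball w0 (r / 3) := by
    have : ContinuousAt (fun t : ℝ => (t : ℂ) * w0) 1 := by fun_prop
    have h1 : Tendsto (fun t : ℝ => (t : ℂ) * w0) (𝓝 1) (𝓝 w0) := by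
      simpa [ContinuousAt] using this
    exact (h1.mono_left nhdsWithin_le_nhds) (Metric.ball_mem_nhds _ (by positivity))
  have hcl2 : ∀ᶠ t : ℝ in 𝓝[<] 1, 0 < t ∧ t < 1 :=
    Ioo_mem_nhdsLT (by norm_num)
  obtain ⟨t, ht1, ht2, ht3, ht4⟩ := (hfr.and_eventually (hcl1.and hcl2)).exists
  have htb : (t : ℂ) * w0 ∈ Metric.ball (0 : ℂ) R := by
    rw [mem_ball_zero_iff, norm_mul, Complex.norm_real, Real.norm_of_nonneg ht3.le, hw0R]
    nlinarith
  obtain ⟨G, hG, hGE⟩ := hE.extend hτ htb hr ht1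
  refine hbad _ (mem_nhdsWithin_of_mem_nhds (Metric.ball_mem_nhds w0 (by positivity : 0 < r / 3)))
    ⟨r / 4, by positivity, fun w hw => ?_⟩
  have hd : dist w (t * w0) < 2 * r / 3 := by
    calc dist w (t * w0) ≤ dist w w0 + dist w0 (t * w0) := dist_triangle _ _ _
      _ < r / 3 + r / 3 := add_lt_add hw.1 (by rw [dist_comm]; exact ht2)
      _ = 2 * r / 3 := by ring
  have hGw : G w = E w := hG.eqOn hE (S := Metric.ball (t * w0) r ∩ Metric.ball 0 R)
    Set.inter_subset_left Set.inter_subset_right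
    ((convex_ball _ _).inter (convex_ball _ _)) ⟨Metric.mem_ball_self hr, htb⟩ hGE
    ⟨by rw [Metric.mem_ball]; linarith, hw.2⟩
  rw [← hGw]
  refine US.hasDisc_of_ball (hG.mono Metric.isOpen_ball (Metric.ball_subset_ball' ?_))
  linarith

end FlatFront

namespace FlatFront
open Filter Topology Asymptotics

lemma LocMod.rpow {O : Set ℂ} (hO : IsOpen O) {f : ℂ → ℂ} (hf : DifferentiableOn ℂ f O)
    (h0 : ∀ z ∈ O, f z ≠ 0) (s : ℝ) : LocMod O (fun z => ‖f z‖ ^ s) := by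
  intro p hp
  have hfp := h0 p hp
  have hc : ContinuousAt (fun z => f z / f p) p :=
    ((hf.continuousOn.continuousAt (hO.mem_nhds hp))).div_const _
  have h1 : ∀ᶠ z in 𝓝 p, f z / f p ∈ Complex.slitPlane ∧ z ∈ O := by
    refine Filter.Eventually.and ?_ (hO.mem_nhds hp)
    refine hc.eventually (Complex.isOpen_slitPlane.mem_nhds ?_)
    simp only [div_self hfp]; exact Complex.one_mem_slitPlane
  obtain ⟨ρ, hρ, hball⟩ := Metric.eventually_nhds_iff_ball.1 h1
  refine ⟨fun z => ((‖f p‖ ^ s : ℝ) : ℂ) * Complex.exp (s * Complex.log (f z / f p)), ρ, hρ,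
    fun z hz => (hball z hz).2, ?_, ?_⟩
  · intro z hz
    have hd : DifferentiableAt ℂ f z := (hf z (hball z hz).2).differentiableAt
      (hO.mem_nhds (hball z hz).2)
    have h2 : DifferentiableAt ℂ (fun z => Complex.log (f z / f p)) z :=
      (hd.div_const _).clog (hball z hz).1
    exact (((h2.const_mul (s : ℂ)).cexp).const_mul _).differentiableWithinAt
  · intro z hz
    have hfz := h0 z (hball z hz).2
    have hpp : 0 < ‖f p‖ := norm_pos_iff.2 hfp
    have hzz : 0 < ‖f z‖ := norm_pos_iff.2 hfz
    constructor
    · rw [norm_mul, Complex.norm_real, Real.norm_of_nonneg (by positivity), Complex.norm_exp,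
        Complex.re_ofReal_mul, Complex.log_re, norm_div, mul_comm s,
        ← Real.rpow_def_of_pos (by positivity), ← Real.mul_rpow (by positivity) (by positivity)]
      congr 1
      field_simp
    · refine mul_ne_zero ?_ (Complex.exp_ne_zero _)
      have : 0 < ‖f p‖ ^ s := by positivity
      exact_mod_cast this.ne'

lemma LocMod.mul {O : Set ℂ} {σ τ : ℂ → ℝ} (hσ : LocMod O σ) (hτ : LocMod O τ) :
    LocMod O (fun z => σ z * τ z) := by
  intro p hp
  obtain ⟨φ, ρ, hρ, h1, h2, h3⟩ := hσ p hp
  obtain ⟨φ', ρ', hρ', h1', h2', h3'⟩ := hτ p hp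
  have e1 : Metric.ball p (min ρ ρ') ⊆ Metric.ball p ρ := Metric.ball_subset_ball (min_le_left _ _)
  have e2 : Metric.ball p (min ρ ρ') ⊆ Metric.ball p ρ' :=
    Metric.ball_subset_ball (min_le_right _ _)
  refine ⟨fun z => φ z * φ' z, min ρ ρ', lt_min hρ hρ', e1.trans h1, (h2.mono e1).mul (h2'.mono e2),
    fun z hz => ⟨?_, mul_ne_zero (h3 z (e1 hz)).2 (h3' z (e2 hz)).2⟩⟩
  rw [norm_mul, (h3 z (e1 hz)).1, (h3' z (e2 hz)).1]

lemma LocMod.prod {O : Set ℂ} (hO : IsOpen O) {ι : Type*} (s : Finset ι) {σ : ι → ℂ → ℝ}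
    (hσ : ∀ i, LocMod O (σ i)) : LocMod O (fun z => ∏ i ∈ s, σ i z) := by
  classical
  induction s using Finset.induction_on with
  | empty =>
    have := LocMod.rpow hO (f := fun _ => (1 : ℂ)) (differentiableOn_const _) (by simp) 1
    simpa using this
  | insert a s ha ih =>
    simp only [Finset.prod_insert ha]
    exact (hσ a).mul ih

/-- A path whose speed is bounded by the distance to `q` cannot cluster at `q` in finite time. -/
lemma no_cluster {γ γ' : ℝ → ℂ} {q : ℂ} {ρ K : ℝ} (hρ : 0 < ρ) (hK : 0 ≤ K)
    (hγ : ∀ t ∈ Set.Ico (0 : ℝ) 1, HasDerivAt γ (γ' t) t)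
    (hne : ∀ t ∈ Set.Ico (0 : ℝ) 1, γ t ≠ q)
    (hb : ∀ t ∈ Set.Ico (0 : ℝ) 1, ‖γ t - q‖ < ρ → ‖γ' t‖ ≤ K * ‖γ t - q‖) :
    ¬ MapClusterPt q (𝓝[<] (1 : ℝ)) γ := by
  intro hcl
  obtain ⟨t1, ht1, h01, h11⟩ := ((hcl.frequently (Metric.ball_mem_nhds q hρ)).and_eventually
    (Ioo_mem_nhdsLT (by norm_num : (0 : ℝ) < 1))).exists
  have hs1 : 0 < ‖γ t1 - q‖ := norm_pos_iff.2 (sub_ne_zero.2 (hne t1 ⟨h01.le, h11⟩))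
  have hs1ρ : ‖γ t1 - q‖ < ρ := by rw [← dist_eq_norm]; exact ht1
  set s1 := ‖γ t1 - q‖ with hs1d
  obtain ⟨t2, ht2, h12, h21⟩ := ((hcl.frequently (Metric.ball_mem_nhds q
    (by positivity : 0 < s1 * Real.exp (-K)))).and_eventually (Ioo_mem_nhdsLT h11)).exists
  have hs2 : ‖γ t2 - q‖ < s1 * Real.exp (-K) := by rw [← dist_eq_norm]; exact ht2
  have hcont : ContinuousOn γ (Set.Icc t1 t2) := fun t ht =>
    (hγ t ⟨h01.le.trans ht.1, ht.2.trans_lt h21⟩).continuousAt.continuousWithinAt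
  have hcomp : IsCompact (Set.Icc t1 t2 ∩ (fun t => ‖γ t - q‖) ⁻¹' Set.Ici s1) := by
    refine isCompact_Icc.of_isClosed_subset ?_ Set.inter_subset_left
    exact (hcont.sub continuousOn_const).norm.preimage_isClosed_of_isClosed isClosed_Icc isClosed_Ici
  obtain ⟨t, ⟨⟨hta, htb⟩, hts⟩, hmax⟩ := hcomp.exists_isGreatest
    ⟨t1, ⟨le_refl _, h12.le⟩, le_refl s1⟩
  have hts' : s1 ≤ ‖γ t - q‖ := hts
  have hin : ∀ u ∈ Set.Ico 0 (t2 - t), ‖γ (t2 - u) - q‖ < s1 := by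
    intro u hu
    by_contra hcon
    push Not at hcon
    have := hmax ⟨⟨by linarith [hu.2], by linarith [hu.1]⟩, hcon⟩
    linarith [hu.2]
  have hder : ∀ u ∈ Set.Icc 0 (t2 - t), HasDerivAt (fun u => γ (t2 - u) - q) (-γ' (t2 - u)) u := by
    intro u hu
    have h1 := hγ (t2 - u) ⟨by linarith [hu.2], by linarith [hu.1]⟩
    exact (HasDerivAt.comp_const_sub t2 u h1).sub_const q
  have hg := norm_le_gronwallBound_of_norm_deriv_right_le (f := fun u => γ (t2 - u) - q)
    (f' := fun u => -γ' (t2 - u)) (δ := ‖γ t2 - q‖) (K := K) (ε := 0) (a := 0) (b := t2 - t)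
    (fun u hu => (hder u hu).continuousAt.continuousWithinAt)
    (fun u hu => (hder u ⟨hu.1, hu.2.le⟩).hasDerivWithinAt) (by simp)
    (fun u hu => by
      rw [norm_neg, add_zero]
      exact hb _ ⟨by linarith [hu.2], by linarith [hu.1]⟩ ((hin u hu).trans hs1ρ))
    (t2 - t) ⟨by linarith, le_refl _⟩
  rw [gronwallBound_ε0] at hg
  simp only [sub_sub_cancel, sub_zero] at hg
  have h3 : Real.exp (K * (t2 - t)) ≤ Real.exp K := Real.exp_le_exp.2 (by nlinarith)
  have h4 : ‖γ t2 - q‖ * Real.exp (K * (t2 - t)) ≤ ‖γ t2 - q‖ * Real.exp K := by gcongr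
  have h5 : ‖γ t2 - q‖ * Real.exp K < s1 * Real.exp (-K) * Real.exp K := by gcongr
  rw [mul_assoc, ← Real.exp_add] at h5
  simp at h5
  linarith

lemma exists_cluster {Ω : Set ℂ} {γ : ℝ → ℂ} (h : ¬ ∀ K : Set ℂ, K ⊆ Ω → IsCompact K →
    ∃ t₀ ∈ Set.Ico (0 : ℝ) 1, ∀ t, t₀ < t → t < 1 → γ t ∉ K) :
    ∃ q ∈ Ω, MapClusterPt q (𝓝[<] (1 : ℝ)) γ := by
  push Not at h
  obtain ⟨K, hK, hc, hf⟩ := h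
  have : ∃ᶠ t in 𝓝[<] (1 : ℝ), γ t ∈ K := by
    intro hev
    obtain ⟨l, hl, hl'⟩ := (mem_nhdsLT_iff_exists_Ioo_subset' (by norm_num : (0 : ℝ) < 1)).1 hev
    obtain ⟨t, h1, h2, h3⟩ := hf (max l 0) ⟨le_max_right _ _, max_lt hl (by norm_num)⟩
    exact hl' ⟨(le_max_left _ _).trans_lt h1, h2⟩ h3
  obtain ⟨q, hq, h2⟩ := hc.exists_mapClusterPt_of_frequently this
  exact ⟨q, hK hq, h2⟩

lemma lintegral_lt_top_of_rpow {f : ℝ → ℝ} {M b : ℝ} (hb : b < 1)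
    (hf : ∀ t ∈ Set.Ico (0 : ℝ) 1, f t ≤ M * (1 - t) ^ (-b)) :
    ∫⁻ t in Set.Ico (0 : ℝ) 1, ENNReal.ofReal (f t) ≠ ⊤ := by
  have h1 : IntervalIntegrable (fun x : ℝ => x ^ (-b)) MeasureTheory.volume 0 1 :=
    intervalIntegral.intervalIntegrable_rpow' (by linarith)
  have h2 := (h1.comp_sub_left 1).symm
  simp only [sub_self, sub_zero] at h2
  have h3 := (h2.const_mul M)
  rw [intervalIntegrable_iff_integrableOn_Ico_of_le (by norm_num)] at h3
  have h4 := h3.lintegral_lt_top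
  refine (lt_of_le_of_lt ?_ h4).ne
  refine MeasureTheory.setLIntegral_mono' measurableSet_Ico fun t ht => ?_
  exact ENNReal.ofReal_le_ofReal (hf t ht)

end FlatFront

namespace FlatFront
open Filter Topology Asymptotics

/-- The density used for the flat metric. -/
noncomputable def dens {ι : Type*} [Fintype ι] (p q : ι → ℂ) (e : ι → ℝ) (η : ℝ) (h g : ℂ → ℂ)
    (z : ℂ) : ℝ :=
  (∏ j, ‖p j * g z + q j * h z‖ ^ (e j / η)) * ‖h z * deriv g z - g z * deriv h z‖ ^ (-1 / η)

/-- The regular set. -/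
def reg {ι : Type*} (p q : ι → ℂ) (h g : ℂ → ℂ) (Ω : Set ℂ) : Set ℂ :=
  {z | z ∈ Ω ∧ h z * deriv g z - g z * deriv h z ≠ 0 ∧ ∀ j, p j * g z + q j * h z ≠ 0}

lemma isOpen_reg {ι : Type*} [Fintype ι] (p q : ι → ℂ) {h g : ℂ → ℂ} {Ω : Set ℂ} (hop : IsOpen Ω)
    (hh : DifferentiableOn ℂ h Ω) (hg : DifferentiableOn ℂ g Ω) : IsOpen (reg p q h g Ω) := by
  rw [isOpen_iff_mem_nhds]
  rintro z ⟨hz, hW, hL⟩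
  have n := hop.mem_nhds hz
  have c1 := hh.continuousOn.continuousAt n
  have c2 := hg.continuousOn.continuousAt n
  have c3 := (hh.deriv hop).continuousOn.continuousAt n
  have c4 := (hg.deriv hop).continuousOn.continuousAt n
  have e1 := ((c1.mul c4).sub (c2.mul c3)).eventually_ne hW
  have e2 : ∀ᶠ x in 𝓝 z, ∀ j, p j * g x + q j * h x ≠ 0 := by
    rw [eventually_all]
    intro j
    exact ((c2.const_mul (p j)).add (c1.const_mul (q j))).eventually_ne (hL j)
  filter_upwards [n, e1, e2] with x h1 h2 h3
  exact ⟨h1, h2, h3⟩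

lemma locMod_dens {ι : Type*} [Fintype ι] (p q : ι → ℂ) (e : ι → ℝ) (η : ℝ) {h g : ℂ → ℂ}
    {Ω : Set ℂ} (hop : IsOpen Ω) (hh : DifferentiableOn ℂ h Ω) (hg : DifferentiableOn ℂ g Ω) :
    LocMod (reg p q h g Ω) (dens p q e η h g) := by
  have ho := isOpen_reg p q hop hh hg
  have hsub : reg p q h g Ω ⊆ Ω := fun z hz => hz.1
  refine LocMod.mul (LocMod.prod ho _ fun j => LocMod.rpow ho ?_ (fun z hz => hz.2.2 j) _)
    (LocMod.rpow ho ?_ (fun z hz => hz.2.1) _)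
  · exact ((hg.const_mul _).add (hh.const_mul _)).mono hsub
  · exact ((hh.mul (hg.deriv hop)).sub (hg.mul (hh.deriv hop))).mono hsub

lemma dens_pos {ι : Type*} [Fintype ι] {p q : ι → ℂ} (e : ι → ℝ) (η : ℝ) {h g : ℂ → ℂ}
    {Ω : Set ℂ} {z : ℂ} (hz : z ∈ reg p q h g Ω) : 0 < dens p q e η h g z := by
  refine mul_pos (Finset.prod_pos fun j _ => Real.rpow_pos_of_pos (norm_pos_iff.2 (hz.2.2 j)) _)
    (Real.rpow_pos_of_pos (norm_pos_iff.2 hz.2.1) _)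

/-- pulling back by a local isometry, the hypotheses of the disc estimate hold -/
lemma pullback {ι : Type*} [Fintype ι] {p q : ι → ℂ} {e : ι → ℝ} {η a : ℝ} (hη : 0 < η)
    (haη : a = 1 + η) (hsum : ∑ j, e j = a + 2) {h g : ℂ → ℂ}
    {Ω : Set ℂ} (hop : IsOpen Ω) (hh : DifferentiableOn ℂ h Ω) (hg : DifferentiableOn ℂ g Ω)
    {R : ℝ} {E : ℂ → ℂ} (hE : US (reg p q h g Ω) (dens p q e η h g) (Metric.ball 0 R) E) :
    DifferentiableOn ℂ (fun w => h (E w) * deriv E w) (Metric.ball 0 R) ∧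
    DifferentiableOn ℂ (fun w => g (E w) * deriv E w) (Metric.ball 0 R) ∧
    (∀ w ∈ Metric.ball (0 : ℂ) R, ∀ j,
      p j * (g (E w) * deriv E w) + q j * (h (E w) * deriv E w) ≠ 0) ∧
    (∀ w ∈ Metric.ball (0 : ℂ) R,
      ‖(h (E w) * deriv E w) * deriv (fun w => g (E w) * deriv E w) w
        - (g (E w) * deriv E w) * deriv (fun w => h (E w) * deriv E w) w‖
      = ∏ j, ‖p j * (g (E w) * deriv E w) + q j * (h (E w) * deriv E w)‖ ^ e j) := by
  have hE1 : ∀ w ∈ Metric.ball (0 : ℂ) R, HasDerivAt E (deriv E w) w := fun w hw =>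
    (hE.differentiableAt hw).hasDerivAt
  have hE2 : ∀ w ∈ Metric.ball (0 : ℂ) R, HasDerivAt (deriv E) (deriv (deriv E) w) w := fun w hw =>
    (((hE.2.1.deriv Metric.isOpen_ball) w hw).differentiableAt
      (Metric.isOpen_ball.mem_nhds hw)).hasDerivAt
  have hcomp : ∀ f : ℂ → ℂ, DifferentiableOn ℂ f Ω → ∀ w ∈ Metric.ball (0 : ℂ) R,
      HasDerivAt (fun w => f (E w) * deriv E w)
        (deriv f (E w) * deriv E w * deriv E w + f (E w) * deriv (deriv E) w) w := by
    intro f hf w hw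
    have hEw := (hE.2.2 w hw).1.1
    have h1 := ((hf _ hEw).differentiableAt (hop.mem_nhds hEw)).hasDerivAt
    exact (h1.comp w (hE1 w hw)).mul (hE2 w hw)
  have hne : ∀ w ∈ Metric.ball (0 : ℂ) R, deriv E w ≠ 0 := by
    intro w hw h0
    have := (hE.2.2 w hw).2
    simp [h0] at this
  refine ⟨fun w hw => (hcomp h hh w hw).differentiableAt.differentiableWithinAt,
    fun w hw => (hcomp g hg w hw).differentiableAt.differentiableWithinAt, ?_, ?_⟩
  · intro w hw j
    have := mul_ne_zero ((hE.2.2 w hw).1.2.2 j) (hne w hw)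
    convert this using 1
    ring
  · intro w hw
    rw [(hcomp h hh w hw).deriv, (hcomp g hg w hw).deriv]
    obtain ⟨hreg, hτ⟩ := hE.2.2 w hw
    set z := E w with hz
    set d := deriv E w with hd
    have hd0 : 0 < ‖d‖ := norm_pos_iff.2 (hne w hw)
    have hL0 : ∀ j, 0 < ‖p j * g z + q j * h z‖ := fun j => norm_pos_iff.2 (hreg.2.2 j)
    have hW0 : 0 < ‖h z * deriv g z - g z * deriv h z‖ := norm_pos_iff.2 hreg.2.1
    have e1 : h z * d * (deriv g z * d * d + g z * deriv (deriv E) w)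
        - g z * d * (deriv h z * d * d + h z * deriv (deriv E) w)
        = (h z * deriv g z - g z * deriv h z) * d ^ 3 := by ring
    have e2 : ∀ j, p j * (g z * d) + q j * (h z * d) = (p j * g z + q j * h z) * d :=
      fun j => by ring
    simp only [e1, e2, norm_mul, norm_pow]
    have e3 : ∏ j, (‖p j * g z + q j * h z‖ * ‖d‖) ^ e j
        = (∏ j, ‖p j * g z + q j * h z‖ ^ e j) * ‖d‖ ^ (3 + η) := by
      have : (3 + η) = ∑ j, e j := by rw [hsum, haη]; ring
      rw [this, Real.rpow_sum_of_pos hd0, ← Finset.prod_mul_distrib]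
      exact Finset.prod_congr rfl fun j _ => Real.mul_rpow (hL0 j).le hd0.le
    rw [e3, Real.rpow_add hd0]
    have e4 : ‖d‖ ^ (3 : ℝ) = ‖d‖ ^ 3 := by norm_cast
    rw [e4]
    have e5 : (‖d‖ * dens p q e η h g z) ^ η = 1 := by rw [hτ, Real.one_rpow]
    have e6 : dens p q e η h g z ^ η = (∏ j, ‖p j * g z + q j * h z‖ ^ e j)
        * ‖h z * deriv g z - g z * deriv h z‖⁻¹ := by
      unfold dens
      rw [Real.mul_rpow (Finset.prod_nonneg fun j _ => (Real.rpow_pos_of_pos (hL0 j) _).le)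
        (Real.rpow_pos_of_pos hW0 _).le, ← Real.rpow_mul hW0.le,
        ← Real.finsetProd_rpow _ _ (fun j _ => (Real.rpow_pos_of_pos (hL0 j) _).le)]
      congr 1
      · refine Finset.prod_congr rfl fun j _ => ?_
        rw [← Real.rpow_mul (hL0 j).le, div_mul_cancel₀ _ hη.ne']
      · rw [div_mul_cancel₀ _ hη.ne', Real.rpow_neg_one]
    rw [Real.mul_rpow hd0.le (dens_pos e η hreg).le, e6] at e5
    have e7 : (∏ j, ‖p j * g z + q j * h z‖ ^ e j) * ‖d‖ ^ η
        = ‖h z * deriv g z - g z * deriv h z‖ := by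
      field_simp at e5
      linarith
    rw [← e7]
    ring

end FlatFront

namespace FlatFront
open Filter Topology Asymptotics

lemma lower_rpow {f : ℂ → ℂ} {z : ℂ} (hf : ContinuousAt f z) (h0 : f z ≠ 0) (x : ℝ) :
    ∃ c > 0, ∀ᶠ y in 𝓝 z, c ≤ ‖f y‖ ^ x := by
  have hp : 0 < ‖f z‖ := norm_pos_iff.2 h0
  have hp' : 0 < ‖f z‖ ^ x := by positivity
  have hc : ContinuousAt (fun y => ‖f y‖ ^ x) z := hf.norm.rpow_const (Or.inl hp.ne')
  refine ⟨‖f z‖ ^ x / 2, by positivity, ?_⟩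
  filter_upwards [hc.eventually (lt_mem_nhds (show ‖f z‖ ^ x / 2 < ‖f z‖ ^ x by linarith))]
    with y hy using hy.le

lemma lower_factor {f u : ℂ → ℂ} {z : ℂ} {k : ℕ} (hu : ContinuousAt u z) (h0 : u z ≠ 0)
    (hf : ∀ᶠ y in 𝓝 z, f y = (y - z) ^ k * u y) (x : ℝ) :
    ∃ c > 0, ∀ᶠ y in 𝓝 z, c * ‖y - z‖ ^ (k * x) ≤ ‖f y‖ ^ x := by
  obtain ⟨c, hc, hev⟩ := lower_rpow hu h0 x
  refine ⟨c, hc, ?_⟩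
  filter_upwards [hf, hev] with y h1 h2
  rw [h1, norm_mul, norm_pow, Real.mul_rpow (by positivity) (by positivity),
    ← Real.rpow_natCast, ← Real.rpow_mul (norm_nonneg _), mul_comm]
  gcongr

/-- bound on the Wronskian near a zero of order `k` of a linear combination -/
lemma wronskian_bound {h g u : ℂ → ℂ} {z p q : ℂ} {k : ℕ} (hk : 1 ≤ k) (hpq : p ≠ 0 ∨ q ≠ 0)
    (hh : AnalyticAt ℂ h z) (hg : AnalyticAt ℂ g z) (hu : AnalyticAt ℂ u z)
    (hL : ∀ᶠ y in 𝓝 z, p * g y + q * h y = (y - z) ^ k * u y) :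
    ∃ B > 0, ∀ᶠ y in 𝓝 z, ‖h y * deriv g y - g y * deriv h y‖ ≤ B * ‖y - z‖ ^ ((k : ℝ) - 1) := by
  obtain ⟨b, v, hb, hv, hW⟩ : ∃ (b : ℂ) (v : ℂ → ℂ), b ≠ 0 ∧ ContinuousAt v z ∧
      ∀ᶠ y in 𝓝 z, b * (h y * deriv g y - g y * deriv h y) = (y - z) ^ (k - 1) * v y := by
    have hev : ∀ᶠ y in 𝓝 z, p * g y + q * h y = (y - z) ^ k * u y ∧
        p * deriv g y + q * deriv h y = (y - z) ^ (k - 1) * (k * u y + (y - z) * deriv u y) := by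
      filter_upwards [hL.eventually_nhds, hh.eventually_analyticAt, hg.eventually_analyticAt,
        hu.eventually_analyticAt] with y h1 h2 h3 h4
      refine ⟨h1.self_of_nhds, ?_⟩
      have d1 : HasDerivAt (fun y => p * g y + q * h y) (p * deriv g y + q * deriv h y) y :=
        (h3.differentiableAt.hasDerivAt.const_mul p).add (h2.differentiableAt.hasDerivAt.const_mul q)
      have d2 : HasDerivAt (fun y => (y - z) ^ k * u y)
          ((k * (y - z) ^ (k - 1) * 1) * u y + (y - z) ^ k * deriv u y) y :=
        (((hasDerivAt_id y).sub_const z).pow k).mul h4.differentiableAt.hasDerivAt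
      rw [d1.unique (d2.congr_of_eventuallyEq h1)]
      obtain ⟨k', rfl⟩ : ∃ k', k = k' + 1 := ⟨k - 1, by omega⟩
      simp only [Nat.add_sub_cancel]
      ring
    have c1 := hh.continuousAt
    have c2 := hg.continuousAt
    have c3 := hu.continuousAt
    have c4 := hh.deriv.continuousAt
    have c5 := hg.deriv.continuousAt
    have c6 := hu.deriv.continuousAt
    rcases hpq with hp | hq
    · refine ⟨p, fun y => h y * (k * u y + (y - z) * deriv u y) - (y - z) * u y * deriv h y, hp,
        by fun_prop, ?_⟩
      filter_upwards [hev] with y ⟨h1, h2⟩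
      obtain ⟨k', rfl⟩ : ∃ k', k = k' + 1 := ⟨k - 1, by omega⟩
      simp only [Nat.add_sub_cancel] at h2 ⊢
      linear_combination h y * h2 - deriv h y * h1
    · refine ⟨q, fun y => (y - z) * u y * deriv g y - g y * (k * u y + (y - z) * deriv u y), hq,
        by fun_prop, ?_⟩
      filter_upwards [hev] with y ⟨h1, h2⟩
      obtain ⟨k', rfl⟩ : ∃ k', k = k' + 1 := ⟨k - 1, by omega⟩
      simp only [Nat.add_sub_cancel] at h2 ⊢
      linear_combination deriv g y * h1 - g y * h2
  have hb' : 0 < ‖b‖ := norm_pos_iff.2 hb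
  refine ⟨(‖v z‖ + 1) / ‖b‖, by positivity, ?_⟩
  filter_upwards [hW, hv.norm.eventually (gt_mem_nhds (lt_add_one ‖v z‖))] with y h1 h2
  have h3 := congrArg norm h1
  rw [norm_mul, norm_mul, norm_pow] at h3
  have h4 : ‖y - z‖ ^ ((k : ℝ) - 1) = ‖y - z‖ ^ (k - 1) := by
    rw [← Real.rpow_natCast, Nat.cast_sub hk, Nat.cast_one]
  rw [h4, div_mul_eq_mul_div, le_div_iff₀ hb', mul_comm, h3, mul_comm]
  gcongr

lemma dens_lower {ι : Type*} [Fintype ι] {p q : ι → ℂ} {e : ι → ℝ} {η : ℝ} (hη : 0 < η)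
    (hη1 : η ≤ 1) (m : ι → ℕ) (hm : ∀ j, 0 < m j) (he : ∀ j, e j = 1 - 1 / (m j : ℝ) - η)
    (hdet : ∀ i j, i ≠ j → p i * q j - p j * q i ≠ 0) (hpq : ∀ j, p j ≠ 0 ∨ q j ≠ 0)
    {h g : ℂ → ℂ} {Ω : Set ℂ} {z : ℂ} (hz : z ∉ reg p q h g Ω) (hzΩ : z ∈ Ω)
    (hnocz : h z ≠ 0 ∨ g z ≠ 0)
    (hh : AnalyticAt ℂ h z) (hg : AnalyticAt ℂ g z)
    (hfin : ∀ j, analyticOrderAt (fun y => p j * g y + q j * h y) z ≠ ⊤)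
    (hord : ∀ j, p j * g z + q j * h z = 0 →
      (m j : ℕ∞) ≤ analyticOrderAt (fun y => p j * g y + q j * h y) z) :
    ∃ c > 0, ∀ᶠ y in 𝓝 z, y ∈ reg p q h g Ω → c / ‖y - z‖ ≤ dens p q e η h g y := by
  have hLan : ∀ j, AnalyticAt ℂ (fun y => p j * g y + q j * h y) z := fun j => by fun_prop
  have h1 : ∀ j, ∃ (k : ℕ) (u : ℂ → ℂ), analyticOrderAt (fun y => p j * g y + q j * h y) z = k ∧
      AnalyticAt ℂ u z ∧ u z ≠ 0 ∧
      ∀ᶠ y in 𝓝 z, p j * g y + q j * h y = (y - z) ^ k * u y := by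
    intro j
    obtain ⟨k, hk⟩ := ENat.ne_top_iff_exists.1 (hfin j)
    obtain ⟨u, hu, hu0, hev⟩ := ((hLan j).analyticOrderAt_eq_natCast).1 hk.symm
    exact ⟨k, u, hk.symm, hu, hu0, hev⟩
  choose k u hk hu hu0 hLu using h1
  have h2 := fun j => lower_factor (hu j).continuousAt (hu0 j) (hLu j) (e j / η)
  choose c hc hLc using h2
  have hall : ∀ᶠ y in 𝓝 z, ∀ j, c j * ‖y - z‖ ^ (k j * (e j / η)) ≤
      ‖p j * g y + q j * h y‖ ^ (e j / η) := by
    rw [eventually_all]; exact hLc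
  have hkz : ∀ j, p j * g z + q j * h z ≠ 0 → k j = 0 := by
    intro j hj
    by_contra hk0
    have := (hLu j).self_of_nhds
    rw [sub_self, zero_pow hk0, zero_mul] at this
    exact hj this
  -- the Wronskian estimate
  obtain ⟨ν, B, hB, hWB, hexp⟩ : ∃ (ν B : ℝ), 0 < B ∧
      (∀ᶠ y in 𝓝 z, ‖h y * deriv g y - g y * deriv h y‖ ≤ B * ‖y - z‖ ^ ν) ∧
      ∑ j, k j * (e j / η) - ν / η ≤ -1 := by
    by_cases hcase : ∃ j, p j * g z + q j * h z = 0
    · obtain ⟨j, hj⟩ := hcase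
      have hmk : m j ≤ k j := by
        have := hord j hj
        rw [hk j] at this
        exact_mod_cast this
      have hk1 : 1 ≤ k j := (hm j).trans_le hmk
      obtain ⟨B, hB, hWB⟩ := wronskian_bound hk1 (hpq j) hh hg (hu j) (hLu j)
      refine ⟨(k j : ℝ) - 1, B, hB, hWB, ?_⟩
      have hsingle : ∑ i, (k i : ℝ) * (e i / η) = k j * (e j / η) := by
        refine Finset.sum_eq_single j (fun i _ hij => ?_) (by simp)
        have : p i * g z + q i * h z ≠ 0 := by
          intro hi
          have a1 : (p i * q j - p j * q i) * h z = 0 := by linear_combination p i * hj - p j * hi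
          have a2 : (p i * q j - p j * q i) * g z = 0 := by linear_combination q j * hi - q i * hj
          have hd := hdet i j hij
          rcases hnocz with h0 | h0
          · exact (mul_ne_zero hd h0) a1
          · exact (mul_ne_zero hd h0) a2
        rw [hkz i this]
        simp
      rw [hsingle, he j]
      have hmpos : (0 : ℝ) < m j := by exact_mod_cast hm j
      have hmk' : (m j : ℝ) ≤ k j := by exact_mod_cast hmk
      have hk1' : (1 : ℝ) ≤ k j := by exact_mod_cast hk1
      have h3 : (1 : ℝ) ≤ k j * (1 / (m j : ℝ)) := by
        rw [mul_one_div, le_div_iff₀ hmpos]; linarith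
      have h4 : (k j : ℝ) * ((1 - 1 / (m j : ℝ) - η) / η) - ((k j : ℝ) - 1) / η
          = (1 - k j * (1 / (m j : ℝ)) - k j * η) / η := by ring
      rw [h4, div_le_iff₀ hη]
      nlinarith
    · push Not at hcase
      have hW0 : h z * deriv g z - g z * deriv h z = 0 := by
        by_contra hW
        exact hz ⟨hzΩ, hW, hcase⟩
      have hWan : AnalyticAt ℂ (fun y => h y * deriv g y - g y * deriv h y) z :=
        (hh.mul hg.deriv).sub (hg.mul hh.deriv)
      obtain ⟨B, hB, hWB⟩ := hWan.differentiableAt.isBigO_sub.exists_pos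
      refine ⟨1, B, hB, ?_, ?_⟩
      · filter_upwards [hWB.bound] with y hy
        rw [hW0, sub_zero] at hy
        simpa using hy
      · have : ∑ j, (k j : ℝ) * (e j / η) = 0 :=
          Finset.sum_eq_zero fun j _ => by rw [hkz j (hcase j)]; simp
        rw [this, zero_sub, neg_le_neg_iff, le_div_iff₀ hη]
        linarith
  have hC : 0 < ∏ j, c j := Finset.prod_pos fun j _ => hc j
  refine ⟨(∏ j, c j) * B ^ (-1 / η), by positivity, ?_⟩
  filter_upwards [hall, hWB, Metric.ball_mem_nhds z one_pos] with y hy1 hy2 hy3 hreg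
  have hyz : y ≠ z := by rintro rfl; exact hz hreg
  have hr : 0 < ‖y - z‖ := norm_pos_iff.2 (sub_ne_zero.2 hyz)
  have hr1 : ‖y - z‖ ≤ 1 := by rw [← dist_eq_norm]; exact (Metric.mem_ball.1 hy3).le
  have hW : 0 < ‖h y * deriv g y - g y * deriv h y‖ := norm_pos_iff.2 hreg.2.1
  have f1 : (∏ j, c j) * ‖y - z‖ ^ (∑ j, k j * (e j / η)) ≤
      ∏ j, ‖p j * g y + q j * h y‖ ^ (e j / η) := by
    rw [Real.rpow_sum_of_pos hr, ← Finset.prod_mul_distrib]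
    exact Finset.prod_le_prod (fun j _ => mul_nonneg (hc j).le (by positivity)) fun j _ => hy1 j
  have f2 : B ^ (-1 / η) * ‖y - z‖ ^ (-(ν / η)) ≤
      ‖h y * deriv g y - g y * deriv h y‖ ^ (-1 / η) := by
    have hneg : -1 / η ≤ 0 := div_nonpos_of_nonpos_of_nonneg (by norm_num) hη.le
    have := Real.rpow_le_rpow_of_nonpos hW hy2 hneg
    rw [Real.mul_rpow hB.le (by positivity), ← Real.rpow_mul hr.le] at this
    convert this using 3
    ring
  have f3 : ‖y - z‖ ^ (-1 : ℝ) ≤ ‖y - z‖ ^ (∑ j, k j * (e j / η) - ν / η) :=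
    Real.rpow_le_rpow_of_exponent_ge hr hr1 hexp
  calc (∏ j, c j) * B ^ (-1 / η) / ‖y - z‖
      = (∏ j, c j) * B ^ (-1 / η) * ‖y - z‖ ^ (-1 : ℝ) := by rw [Real.rpow_neg_one]; rfl
    _ ≤ (∏ j, c j) * B ^ (-1 / η) * ‖y - z‖ ^ (∑ j, k j * (e j / η) - ν / η) := by gcongr
    _ = ((∏ j, c j) * ‖y - z‖ ^ (∑ j, k j * (e j / η))) *
        (B ^ (-1 / η) * ‖y - z‖ ^ (-(ν / η))) := by
        rw [sub_eq_add_neg (∑ j, (k j : ℝ) * (e j / η)) (ν / η), Real.rpow_add hr]; ring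
    _ ≤ _ := by
        unfold dens
        exact mul_le_mul f1 f2 (by positivity)
          (Finset.prod_nonneg fun j _ => Real.rpow_nonneg (norm_nonneg _) _)

end FlatFront

namespace FlatFront
open Filter Topology Asymptotics

theorem core {ι : Type*} [Fintype ι] [Nonempty ι] {p q : ι → ℂ} {e : ι → ℝ} {η : ℝ} (hη : 0 < η)
    (hη1 : η ≤ 1) (m : ι → ℕ) (hm : ∀ j, 0 < m j) (he : ∀ j, e j = 1 - 1 / (m j : ℝ) - η)
    (hsum : ∑ j, e j = (1 + η) + 2)
    (hdet : ∀ i j, i ≠ j → p i * q j - p j * q i ≠ 0) (hpq : ∀ j, p j ≠ 0 ∨ q j ≠ 0)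
    {h g : ℂ → ℂ} {Ω : Set ℂ} (hop : IsOpen Ω) (hh : DifferentiableOn ℂ h Ω)
    (hg : DifferentiableOn ℂ g Ω) (hnocz : ∀ z ∈ Ω, h z ≠ 0 ∨ g z ≠ 0)
    (hfin : ∀ j, ∀ z ∈ Ω, analyticOrderAt (fun y => p j * g y + q j * h y) z ≠ ⊤)
    (hord : ∀ j, ∀ z ∈ Ω, p j * g z + q j * h z = 0 →
      (m j : ℕ∞) ≤ analyticOrderAt (fun y => p j * g y + q j * h y) z)
    (hne : (reg p q h g Ω).Nonempty)
    (hcomplete : MetricComplete Ω (fun z => Real.sqrt (‖h z‖ ^ 2 + ‖g z‖ ^ 2))) : False := by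
  obtain ⟨x0, hx0⟩ := hne
  set τ := dens p q e η h g with hτdef
  set O := reg p q h g Ω with hOdef
  have hloc : LocMod O τ := locMod_dens p q e η hop hh hg
  have ha : (0 : ℝ) < 1 + η := by linarith
  obtain ⟨C, hC, hdisc⟩ := disc_estimate p q hdet hpq e hη ha
    (fun j => by rw [he j]; have : 0 ≤ 1 / (m j : ℝ) := by positivity
                 linarith) hsum
  -- the estimate for local isometries
  have hest : ∀ (R : ℝ) (E : ℂ → ℂ), US O τ (Metric.ball 0 R) E → ∀ w ∈ Metric.ball (0 : ℂ) R,
      (√(‖h (E w)‖ ^ 2 + ‖g (E w)‖ ^ 2) * ‖deriv E w‖) ^ (1 + η) ≤ C * (R / (R ^ 2 - ‖w‖ ^ 2)) := by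
    intro R E hE w hw
    obtain ⟨h1, h2, h3, h4⟩ := pullback hη rfl hsum hop hh hg hE
    have h5 := hdisc R _ _ h1 h2 h3 h4 w hw
    have h6 : √(‖h (E w) * deriv E w‖ ^ 2 + ‖g (E w) * deriv E w‖ ^ 2)
        = √(‖h (E w)‖ ^ 2 + ‖g (E w)‖ ^ 2) * ‖deriv E w‖ := by
      rw [norm_mul, norm_mul, mul_pow, mul_pow, ← add_mul, Real.sqrt_mul (by positivity),
        Real.sqrt_sq (norm_nonneg _)]
    rw [h6] at h5
    exact h5
  have hFpos : ∀ z ∈ Ω, 0 < √(‖h z‖ ^ 2 + ‖g z‖ ^ 2) := by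
    intro z hz
    refine Real.sqrt_pos.2 ?_
    rcases hnocz z hz with h0 | h0
    · have := norm_pos_iff.2 h0; positivity
    · have := norm_pos_iff.2 h0; positivity
  -- bound for the radius
  set D := (√(‖h x0‖ ^ 2 + ‖g x0‖ ^ 2) * (τ x0)⁻¹) ^ (1 + η) with hD
  have hτ0 : 0 < τ x0 := dens_pos e η hx0
  have hDpos : 0 < D := by
    have := hFpos x0 hx0.1
    positivity
  have hB : ∀ r, HasDisc O τ x0 r → r ≤ C / D := by
    rintro r ⟨G, hG, hG0⟩
    rcases le_or_gt r 0 with hr | hr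
    · exact hr.trans (by positivity)
    have h0 : (0 : ℂ) ∈ Metric.ball (0 : ℂ) r := Metric.mem_ball_self hr
    have h1 := hest r G hG 0 h0
    have h2 := (hG.2.2 0 h0).2
    rw [hG0] at h1 h2
    have h3 : ‖deriv G 0‖ = (τ x0)⁻¹ := eq_inv_of_mul_eq_one_left h2
    rw [h3, ← hD, norm_zero] at h1
    rw [le_div_iff₀ hDpos]
    have h4 : C * (r / (r ^ 2 - 0 ^ 2)) * r = C := by field_simp; simp
    calc r * D = D * r := mul_comm _ _
      _ ≤ C * (r / (r ^ 2 - 0 ^ 2)) * r := by gcongr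
      _ = C := h4
  obtain ⟨R, E, w0, hR, hE, hE0, hw0, hnocl⟩ := ray hloc hx0 hB
  have hmem : ∀ t ∈ Set.Ico (0 : ℝ) 1, (t : ℂ) * w0 ∈ Metric.ball (0 : ℂ) R := by
    intro t ht
    rw [mem_ball_zero_iff, norm_mul, Complex.norm_real, Real.norm_of_nonneg ht.1, hw0]
    nlinarith [ht.2]
  set γ : ℝ → ℂ := fun t => E (t * w0) with hγ
  set γ' : ℝ → ℂ := fun t => deriv E (t * w0) * w0 with hγ'
  have hder : ∀ t ∈ Set.Ico (0 : ℝ) 1, HasDerivAt γ (γ' t) t := by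
    intro t ht
    have h1 : HasDerivAt (fun s : ℝ => (s : ℂ) * w0) (1 * w0) t :=
      (Complex.ofRealCLM.hasDerivAt (x := t)).mul_const w0
    rw [one_mul] at h1
    exact (hE.differentiableAt (hmem t ht)).hasDerivAt.comp t h1
  have hγO : ∀ t ∈ Set.Ico (0 : ℝ) 1, γ t ∈ O := fun t ht => (hE.2.2 _ (hmem t ht)).1
  have hspeed : ∀ t ∈ Set.Ico (0 : ℝ) 1, ‖γ' t‖ * τ (γ t) = R := by
    intro t ht
    have := (hE.2.2 _ (hmem t ht)).2
    rw [hγ', norm_mul, hw0, mul_right_comm, this, one_mul]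
  have hC1 : PiecewiseC1 γ γ' := by
    refine ⟨fun t ht => (hder t ht).continuousAt.continuousWithinAt, ∅, by simp,
      fun t ht => hder t ht.1, ?_⟩
    rw [Set.sdiff_empty]
    refine ContinuousOn.mul ?_ continuousOn_const
    exact (hE.2.1.deriv Metric.isOpen_ball).continuousOn.comp
      (by fun_prop : Continuous (fun t : ℝ => (t : ℂ) * w0)).continuousOn hmem
  have hdiv : DivergentPath Ω γ := by
    by_contra hcon
    obtain ⟨z, hz, hcl⟩ := exists_cluster hcon
    by_cases hzO : z ∈ O
    · exact hnocl z hzO hcl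
    have hn := hop.mem_nhds hz
    obtain ⟨c, hc, hev⟩ := dens_lower hη hη1 m hm he hdet hpq hzO hz (hnocz z hz)
      (hh.analyticAt hn) (hg.analyticAt hn) (fun j => hfin j z hz) (fun j => hord j z hz)
    obtain ⟨ρ, hρ, hball⟩ := Metric.eventually_nhds_iff_ball.1 hev
    refine no_cluster (γ := γ) (γ' := γ') (q := z) (K := R / c) hρ (by positivity) hder
      (fun t ht h0 => hzO (h0 ▸ hγO t ht)) (fun t ht hlt => ?_) hcl
    have h1 := hball (γ t) (by rw [Metric.mem_ball, dist_eq_norm]; exact hlt) (hγO t ht)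
    have hs : 0 < ‖γ t - z‖ :=
      norm_pos_iff.2 (sub_ne_zero.2 (fun h0 => hzO (h0 ▸ hγO t ht)))
    have h2 := hspeed t ht
    have h3 : ‖γ' t‖ * (c / ‖γ t - z‖) ≤ R := by
      rw [← h2]; gcongr
    rw [div_mul_eq_mul_div, le_div_iff₀ hc]
    rw [mul_div_assoc', div_le_iff₀ hs] at h3
    exact h3
  have htop := hcomplete γ γ' (fun t ht => (hγO t ht).1) hC1 hdiv
  refine lintegral_lt_top_of_rpow (b := 1 / (1 + η)) (M := R * (C / R) ^ (1 / (1 + η))) ?_ ?_ htop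
  · rw [div_lt_one ha]; linarith
  · intro t ht
    have h1 := hest R E hE _ (hmem t ht)
    have hnorm : ‖(t : ℂ) * w0‖ = t * R := by
      rw [norm_mul, Complex.norm_real, Real.norm_of_nonneg ht.1, hw0]
    rw [hnorm] at h1
    have ht1 : 0 < 1 - t := by linarith [ht.2]
    have h2 : C * (R / (R ^ 2 - (t * R) ^ 2)) ≤ (C / R) * (1 - t)⁻¹ := by
      have e1 : R ^ 2 - (t * R) ^ 2 = R ^ 2 * ((1 - t) * (1 + t)) := by ring
      have e2 : R / (R ^ 2 * ((1 - t) * (1 + t))) = (1 / R) * ((1 - t)⁻¹ * (1 + t)⁻¹) := by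
        have : 0 < 1 + t := by linarith [ht.1]
        field_simp
      have e3 : (1 + t)⁻¹ ≤ 1 := inv_le_one_of_one_le₀ (by linarith [ht.1])
      rw [e1, e2]
      calc C * (1 / R * ((1 - t)⁻¹ * (1 + t)⁻¹)) = (C / R * (1 - t)⁻¹) * (1 + t)⁻¹ := by ring
        _ ≤ (C / R * (1 - t)⁻¹) * 1 := by gcongr
        _ = _ := mul_one _
    have h3 := h1.trans h2
    set X := √(‖h (E (t * w0))‖ ^ 2 + ‖g (E (t * w0))‖ ^ 2) * ‖deriv E (t * w0)‖ with hX
    have hX0 : 0 ≤ X := by positivity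
    have h4 : X ≤ (C / R) ^ (1 / (1 + η)) * (1 - t) ^ (-(1 / (1 + η))) := by
      have := Real.rpow_le_rpow (by positivity) h3 (by positivity : 0 ≤ 1 / (1 + η))
      rw [← Real.rpow_mul hX0, mul_one_div_cancel ha.ne', Real.rpow_one,
        Real.mul_rpow (by positivity) (by positivity), Real.inv_rpow ht1.le,
        ← Real.rpow_neg ht1.le] at this
      exact this
    calc √(‖h (γ t)‖ ^ 2 + ‖g (γ t)‖ ^ 2) * ‖γ' t‖ = R * X := by
          rw [hγ', norm_mul, hw0, hX]; ring
      _ ≤ R * ((C / R) ^ (1 / (1 + η)) * (1 - t) ^ (-(1 / (1 + η)))) := by gcongr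
      _ = _ := by ring

end FlatFront

namespace FlatFront
open Filter Topology Asymptotics

lemma eventually_ne_of_not_zero {Ω : Set ℂ} (hop : IsOpen Ω) (hc : IsPreconnected Ω) {f : ℂ → ℂ}
    (hf : DifferentiableOn ℂ f Ω) (h0 : ¬ ∀ z ∈ Ω, f z = 0) {z : ℂ} (hz : z ∈ Ω) :
    ¬ (∀ᶠ y in 𝓝 z, f y = 0) := by
  intro hev
  exact h0 fun y hy => (hf.analyticOnNhd hop).eqOn_zero_of_preconnected_of_eventuallyEq_zero
    hc hz hev hy

lemma wronskian_ne {Ω : Set ℂ} (hop : IsOpen Ω) (hc : IsPreconnected Ω) {h g : ℂ → ℂ}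
    (hh : DifferentiableOn ℂ h Ω) (hg : DifferentiableOn ℂ g Ω)
    (hcon : ∀ a b : ℂ, ¬(a = 0 ∧ b = 0) → ¬ ∀ z ∈ Ω, a * g z + b * h z = 0) :
    ¬ ∀ z ∈ Ω, h z * deriv g z - g z * deriv h z = 0 := by
  intro hW
  have h1 := hcon 0 1 (by simp)
  push Not at h1
  obtain ⟨z, hz, hz0⟩ := h1
  have hz0' : h z ≠ 0 := by simpa using hz0
  have hev : ∀ᶠ y in 𝓝 z, y ∈ Ω ∧ h y ≠ 0 :=
    Filter.Eventually.and (hop.mem_nhds hz)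
      ((hh.continuousOn.continuousAt (hop.mem_nhds hz)).eventually_ne hz0')
  obtain ⟨r, hr, hball⟩ := Metric.eventually_nhds_iff_ball.1 hev
  have hd : ∀ y ∈ Metric.ball z r, HasDerivAt (fun y => g y / h y) 0 y := by
    intro y hy
    obtain ⟨hyΩ, hy0⟩ := hball y hy
    have d1 := ((hh y hyΩ).differentiableAt (hop.mem_nhds hyΩ)).hasDerivAt
    have d2 := ((hg y hyΩ).differentiableAt (hop.mem_nhds hyΩ)).hasDerivAt
    have d3 := d2.div d1 hy0
    have : deriv g y * h y - g y * deriv h y = 0 := by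
      rw [← hW y hyΩ]; ring
    rw [this, zero_div] at d3
    exact d3
  have hne := hcon 1 (-(g z / h z)) (by simp)
  refine eventually_ne_of_not_zero hop hc ((hg.const_mul _).add (hh.const_mul _)) hne hz ?_
  filter_upwards [Metric.ball_mem_nhds z hr] with y hy
  have := Metric.isOpen_ball.is_const_of_deriv_eq_zero
    (convex_ball z r).isPreconnected
    (fun y hy => (hd y hy).differentiableAt.differentiableWithinAt)
    (fun y hy => (hd y hy).deriv) hy (Metric.mem_ball_self hr)
  have hy0 := (hball y hy).2
  change 1 * g y + -(g z / h z) * h y = 0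
  rw [← this]
  field_simp
  ring

lemma order_le {Ω : Set ℂ} (hop : IsOpen Ω) {f : ℂ → ℂ} (hf : DifferentiableOn ℂ f Ω) {z : ℂ}
    (hz : z ∈ Ω) {m : ℕ} (h : ∀ k < m, iteratedDerivWithin k f Ω z = 0) :
    (m : ℕ∞) ≤ analyticOrderAt f z := by
  rw [natCast_le_analyticOrderAt_iff_iteratedDeriv_eq_zero (hf.analyticAt (hop.mem_nhds hz))]
  intro k hk
  rw [← iteratedDerivWithin_of_isOpen hop hz]
  exact h k hk

end FlatFront

open FlatFront Filter Topology

/-- **Ramification theorem for the ratio of canonical forms of a weakly complete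
flat front** (analytic form).  Here the front's canonical forms on the simply
connected `Ω` are `ω = h dz`, `θ = g dz`, the ratio is `ρ = g / h`, and weak
completeness is completeness of the metric `(|h|² + |g|²)|dz|²`.  If
`∑ (1 - 1/m_j) > 3` and all `α_j`-points of `ρ` have multiplicity at least
`m_j` (with `α_q = ∞`, i.e. zeros of `h`, of multiplicity at least `m_q`),
then `ρ` is constant.  (Here the number of values is `q = n + 1`.) -/
theorem ramification_ratio_of_canonical_forms
    (Ω : Set ℂ) (hne : Ω.Nonempty) (hop : IsOpen Ω) (hsc : SimplyConnectedSpace ↥Ω)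
    (h g : ℂ → ℂ) (hh : DifferentiableOn ℂ h Ω) (hg : DifferentiableOn ℂ g Ω)
    (hnocz : ∀ z ∈ Ω, h z ≠ 0 ∨ g z ≠ 0)
    (hcomplete : MetricComplete Ω (fun z => Real.sqrt (‖h z‖ ^ 2 + ‖g z‖ ^ 2)))
    (n : ℕ) (α : Fin n → ℂ) (hα : Function.Injective α)
    (m : Fin n → ℕ) (mq : ℕ) (hm : ∀ j, 0 < m j) (hmq : 0 < mq)
    (hsum : 3 < (∑ j, (1 - 1 / (m j : ℝ))) + (1 - 1 / (mq : ℝ)))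
    (hram : ∀ j, ∀ z ∈ Ω, g z - α j * h z = 0 →
      ∀ k < m j, iteratedDerivWithin k (fun w => g w - α j * h w) Ω z = 0)
    (hramq : ∀ z ∈ Ω, h z = 0 → ∀ k < mq, iteratedDerivWithin k h Ω z = 0) :
    ∃ a b : ℂ, ¬(a = 0 ∧ b = 0) ∧ ∀ z ∈ Ω, a * g z + b * h z = 0 := by
  by_contra hcon0
  have hcon : ∀ a b : ℂ, ¬(a = 0 ∧ b = 0) → ¬ ∀ z ∈ Ω, a * g z + b * h z = 0 :=
    fun a b hab hz => hcon0 ⟨a, b, hab, hz⟩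
  have hc : IsPreconnected Ω := isPreconnected_iff_preconnectedSpace.2 inferInstance
  let p : Option (Fin n) → ℂ := fun o => o.elim 0 (fun _ => 1)
  let q : Option (Fin n) → ℂ := fun o => o.elim 1 (fun j => -α j)
  let M : Option (Fin n) → ℕ := fun o => o.elim mq m
  have hM : ∀ j, 0 < M j := by
    rintro (_ | j)
    · exact hmq
    · exact hm j
  set A : ℝ := (∑ j, (1 - 1 / (m j : ℝ))) + (1 - 1 / (mq : ℝ)) - 3 with hA
  have hA0 : 0 < A := by rw [hA]; linarith
  have hAn : A ≤ n := by
    have h1 : ∑ j, (1 - 1 / (m j : ℝ)) ≤ ∑ j : Fin n, (1 : ℝ) :=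
      Finset.sum_le_sum fun j _ => by
        have : (0 : ℝ) ≤ 1 / (m j : ℝ) := by positivity
        linarith
    have h2 : (0 : ℝ) ≤ 1 / (mq : ℝ) := by positivity
    rw [Finset.sum_const, Finset.card_univ, Fintype.card_fin, nsmul_eq_mul, mul_one] at h1
    rw [hA]
    linarith
  set η : ℝ := A / (n + 2) with hη
  have hη0 : 0 < η := by positivity
  have hη1 : η ≤ 1 := by rw [hη, div_le_one (by positivity)]; linarith
  let e : Option (Fin n) → ℝ := fun j => 1 - 1 / (M j : ℝ) - η
  have hesum : ∑ j, e j = (1 + η) + 2 := by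
    rw [Fintype.sum_option]
    have : ∀ j, e (some j) = (1 - 1 / (m j : ℝ)) - η := fun j => rfl
    simp only [this]
    rw [Finset.sum_sub_distrib]
    have h3 : e none = 1 - 1 / (mq : ℝ) - η := rfl
    rw [h3]
    have h4 : η * (n + 2) = A := by rw [hη]; field_simp
    rw [hA] at h4
    simp only [Finset.sum_const, Finset.card_univ, Fintype.card_fin, nsmul_eq_mul]
    linarith
  have hpq : ∀ j, p j ≠ 0 ∨ q j ≠ 0 := by
    rintro (_ | j)
    · right; simp [q]
    · left; simp [p]
  have hdet : ∀ i j, i ≠ j → p i * q j - p j * q i ≠ 0 := by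
    rintro (_ | i) (_ | j) hij
    · exact absurd rfl hij
    · simp [p, q]
    · simp [p, q]
    · have : α i ≠ α j := fun hh => hij (by rw [hα hh])
      simp only [p, q, Option.elim]
      intro h0
      exact this (by linear_combination h0)
  have hLd : ∀ j, DifferentiableOn ℂ (fun y => p j * g y + q j * h y) Ω := fun j =>
    (hg.const_mul _).add (hh.const_mul _)
  have hLne : ∀ j, ¬ ∀ z ∈ Ω, p j * g z + q j * h z = 0 := fun j =>
    hcon _ _ (by rcases hpq j with h1 | h1 <;> simp [h1])
  have hfin : ∀ j, ∀ z ∈ Ω, analyticOrderAt (fun y => p j * g y + q j * h y) z ≠ ⊤ := by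
    intro j z hz htop
    exact eventually_ne_of_not_zero hop hc (hLd j) (hLne j) hz (analyticOrderAt_eq_top.1 htop)
  have hord : ∀ j, ∀ z ∈ Ω, p j * g z + q j * h z = 0 →
      (M j : ℕ∞) ≤ analyticOrderAt (fun y => p j * g y + q j * h y) z := by
    rintro (_ | j) z hz h0
    · have e1 : (fun y => p none * g y + q none * h y) = h := by
        funext y; simp [p, q]
      rw [e1]
      exact order_le hop hh hz (hramq z hz (by simpa [p, q] using h0))
    · have e1 : (fun y => p (some j) * g y + q (some j) * h y) = fun w => g w - α j * h w := by
        funext y; simp [p, q]; ring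
      have e2 := congrFun e1 z
      rw [e2] at h0
      rw [e1]
      exact order_le hop (e1 ▸ hLd (some j)) hz (hram j z hz h0)
  have hWd : DifferentiableOn ℂ (fun z => h z * deriv g z - g z * deriv h z) Ω :=
    (hh.mul (hg.deriv hop)).sub (hg.mul (hh.deriv hop))
  have hreg : (reg p q h g Ω).Nonempty := by
    obtain ⟨z, hz⟩ := hne
    have hn := hop.mem_nhds hz
    have e1 : ∀ᶠ y in 𝓝[≠] z, h y * deriv g y - g y * deriv h y ≠ 0 :=
      ((hWd.analyticAt hn).eventually_eq_zero_or_eventually_ne_zero).resolve_left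
        (eventually_ne_of_not_zero hop hc hWd (wronskian_ne hop hc hh hg hcon) hz)
    have e2 : ∀ᶠ y in 𝓝[≠] z, ∀ j, p j * g y + q j * h y ≠ 0 := by
      rw [eventually_all]
      intro j
      exact (((hLd j).analyticAt hn).eventually_eq_zero_or_eventually_ne_zero).resolve_left
        (eventually_ne_of_not_zero hop hc (hLd j) (hLne j) hz)
    have e3 : ∀ᶠ y in 𝓝[≠] z, y ∈ Ω := nhdsWithin_le_nhds hn
    obtain ⟨y, h1, h2, h3⟩ := (e3.and (e1.and e2)).exists
    exact ⟨y, h1, h2, h3⟩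
  exact core hη0 hη1 M hM (fun j => rfl) hesum hdet hpq hop hh hg hnocz hfin hord hreg hcomplete
end

section
/- Let ρ be a meromorphic function on the whole complex plane ℂ. Let q be a positive integer, let α₁, …, α_{q−1} ∈ ℂ be distinct, and let m₁, …, m_q be positive integers with ∑_{j=1}^{q} (1 − 1/m_j) > 2. If every zero of ρ − α_j has multiplicity at least m_j for each j ∈ {1, …, q−1}, and every pole of ρ has multiplicity at least m_q, then ρ is constant. -/
open Filter Topology

def J1 (f : ℝ → ℝ) (b c : ℝ) : Prop :=
  ∃ f' : ℝ → ℝ, (∀ᶠ t in 𝓝 (0:ℝ), HasDerivAt f (f' t) t) ∧ f' 0 = b ∧ HasDerivAt f' c 0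

lemma J1.congr {f g : ℝ → ℝ} {b c : ℝ} (h : J1 f b c) (hfg : f =ᶠ[𝓝 0] g) : J1 g b c := by
  obtain ⟨f', h1, h2, h3⟩ := h
  refine ⟨f', ?_, h2, h3⟩
  filter_upwards [h1, hfg.eventually_nhds] with t ht hfg'
  exact ht.congr_of_eventuallyEq (hfg'.mono fun x hx => hx.symm)

lemma J1.add {f g : ℝ → ℝ} {b c b' c' : ℝ} (hf : J1 f b c) (hg : J1 g b' c') :
    J1 (fun t => f t + g t) (b + b') (c + c') := by
  obtain ⟨f', h1, h2, h3⟩ := hf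
  obtain ⟨g', k1, k2, k3⟩ := hg
  refine ⟨fun t => f' t + g' t, ?_, by simp [h2, k2], h3.add k3⟩
  filter_upwards [h1, k1] with t ht kt
  exact ht.add kt

lemma J1.comp {f : ℝ → ℝ} {b c : ℝ} (hf : J1 f b c) (φ φ' : ℝ → ℝ) (d : ℝ)
    (hφ : ∀ᶠ x in 𝓝 (f 0), HasDerivAt φ (φ' x) x) (hφ' : HasDerivAt φ' d (f 0)) :
    J1 (fun t => φ (f t)) (φ' (f 0) * b) (d * b ^ 2 + φ' (f 0) * c) := by
  obtain ⟨f', h1, h2, h3⟩ := hf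
  have h10 := h1.self_of_nhds
  refine ⟨fun t => φ' (f t) * f' t, ?_, by simp [h2], ?_⟩
  · filter_upwards [h1, h10.continuousAt.eventually hφ] with t ht kt
    exact kt.comp t ht
  · have := (hφ'.comp (0:ℝ) h10).mul h3
    refine HasDerivAt.congr_deriv this ?_
    simp only [h2, Function.comp]; ring

lemma J1.nonpos_of_isLocalMax {f : ℝ → ℝ} {b c : ℝ} (hf : J1 f b c) (hm : IsLocalMax f 0) :
    c ≤ 0 := by
  obtain ⟨f', h1, h2, h3⟩ := hf
  by_contra! hc
  have hd : deriv f =ᶠ[𝓝 0] f' := h1.mono fun t ht => ht.deriv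
  have hd2 : deriv (deriv f) 0 = c := by
    rw [hd.deriv_eq]; exact h3.deriv
  have h0 : deriv f 0 = 0 := hm.deriv_eq_zero
  have hmin := isLocalMin_of_deriv_deriv_pos (by rw [hd2]; exact hc) h0
    h1.self_of_nhds.continuousAt
  have hconst : f =ᶠ[𝓝 0] fun _ => f 0 := by
    filter_upwards [hm, hmin] with t ht kt
    exact le_antisymm ht kt
  have hz : deriv f =ᶠ[𝓝 0] fun _ => 0 := by
    filter_upwards [hconst.eventually_nhds] with t ht
    rw [Filter.EventuallyEq.deriv_eq ht]; simp
  have : deriv (deriv f) 0 = 0 := by rw [hz.deriv_eq]; simp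
  linarith

/-- second order jet of a real function on the plane: `p = ∂u/∂z`, `L = ∂∂̄u`. -/
def HJ (u : ℂ → ℝ) (z p : ℂ) (L : ℝ) : Prop :=
  ∃ k : ℂ, ∀ e : ℂ, J1 (fun t : ℝ => u (z + t * e)) (2 * (e * p).re)
    (2 * (e ^ 2 * k).re + 2 * L * Complex.normSq e)

lemma tendsto_line (z e : ℂ) : Tendsto (fun t : ℝ => z + t * e) (𝓝 0) (𝓝 z) := by
  have : ContinuousAt (fun t : ℝ => z + t * e) 0 := by fun_prop
  simpa [ContinuousAt] using this

lemma HJ.congr {u v : ℂ → ℝ} {z p : ℂ} {L : ℝ} (h : HJ u z p L) (huv : u =ᶠ[𝓝 z] v) :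
    HJ v z p L := by
  obtain ⟨k, hk⟩ := h
  exact ⟨k, fun e => (hk e).congr ((tendsto_line z e).eventually huv)⟩

lemma HJ.add {u v : ℂ → ℝ} {z p p' : ℂ} {L L' : ℝ} (h : HJ u z p L) (h' : HJ v z p' L') :
    HJ (fun w => u w + v w) z (p + p') (L + L') := by
  obtain ⟨k, hk⟩ := h
  obtain ⟨k', hk'⟩ := h'
  refine ⟨k + k', fun e => ?_⟩
  convert (hk e).add (hk' e) using 1
  · simp; ring
  · simp only [mul_add, Complex.add_re]; ring

lemma HJ.comp {u : ℂ → ℝ} {z p : ℂ} {L : ℝ} (h : HJ u z p L) (φ φ' : ℝ → ℝ) (d : ℝ)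
    (hφ : ∀ᶠ x in 𝓝 (u z), HasDerivAt φ (φ' x) x) (hφ' : HasDerivAt φ' d (u z)) :
    HJ (fun w => φ (u w)) z (φ' (u z) * p) (d * Complex.normSq p + φ' (u z) * L) := by
  obtain ⟨k, hk⟩ := h
  refine ⟨d * p ^ 2 + φ' (u z) * k, fun e => ?_⟩
  have := (hk e).comp φ φ' d (by simpa using hφ) (by simpa using hφ')
  convert this using 1
  · simp; ring
  · simp [Complex.normSq_apply, pow_two]; ring

lemma HJ.const (a : ℝ) (z : ℂ) : HJ (fun _ => a) z 0 0 := by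
  refine ⟨0, fun e => ⟨fun _ => 0, ?_, by simp, ?_⟩⟩
  · exact Eventually.of_forall fun t => hasDerivAt_const _ _
  · simpa using hasDerivAt_const _ _

lemma HJ.const_mul {u : ℂ → ℝ} {z p : ℂ} {L : ℝ} (h : HJ u z p L) (a : ℝ) :
    HJ (fun w => a * u w) z (a * p) (a * L) := by
  have := h.comp (fun x => a * x) (fun _ => a) 0
    (Eventually.of_forall fun x => by simpa using (hasDerivAt_id x).const_mul a)
    (hasDerivAt_const _ _)
  simpa using this

lemma HJ.sum {ι : Type*} (s : Finset ι) {u : ι → ℂ → ℝ} {z : ℂ} {p : ι → ℂ} {L : ι → ℝ}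
    (h : ∀ i, HJ (u i) z (p i) (L i)) :
    HJ (fun w => ∑ i ∈ s, u i w) z (∑ i ∈ s, p i) (∑ i ∈ s, L i) := by
  classical
  induction s using Finset.induction_on with
  | empty => simpa using HJ.const 0 z
  | insert a s ha ih => simpa [Finset.sum_insert ha] using (h a).add ih

lemma HJ.log {u : ℂ → ℝ} {z p : ℂ} {L : ℝ} (h : HJ u z p L) (hu : u z ≠ 0) :
    HJ (fun w => Real.log (u w)) z ((u z : ℂ)⁻¹ * p)
      (L / u z - Complex.normSq p / (u z) ^ 2) := by
  have := h.comp Real.log (fun x => x⁻¹) (-((u z) ^ 2)⁻¹)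
    (by filter_upwards [isOpen_ne.mem_nhds hu] with x hx; exact Real.hasDerivAt_log hx)
    (hasDerivAt_inv hu)
  convert this using 1
  · push_cast; rfl
  · field_simp; ring

lemma HJ.exp_mul {u : ℂ → ℝ} {z p : ℂ} {L : ℝ} (h : HJ u z p L) (b : ℝ) :
    HJ (fun w => Real.exp (b * u w)) z ((b * Real.exp (b * u z) : ℝ) * p)
      (b ^ 2 * Real.exp (b * u z) * Complex.normSq p + b * Real.exp (b * u z) * L) := by
  have h0 : ∀ x, HasDerivAt (fun x => Real.exp (b * x)) (b * Real.exp (b * x)) x := fun x => by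
    have := ((hasDerivAt_id x).const_mul b).exp
    simpa [mul_comm] using this
  have := h.comp (fun x => Real.exp (b * x)) (fun x => b * Real.exp (b * x))
    (b * (b * Real.exp (b * u z)))
    (Eventually.of_forall h0) ((h0 _).const_mul b)
  convert this using 1
  ring

lemma HJ.normSq {g : ℂ → ℂ} (hg : Differentiable ℂ g) (z : ℂ) :
    HJ (fun w => Complex.normSq (g w)) z (star (g z) * deriv g z)
      (Complex.normSq (deriv g z)) := by
  refine ⟨star (g z) * deriv (deriv g) z, fun e => ?_⟩
  have hline : ∀ t : ℝ, HasDerivAt (fun t : ℝ => z + t * e) e t := fun t => by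
    have := ((hasDerivAt_id t).ofReal_comp.mul_const e).const_add z
    simpa using this
  have key : ∀ {f : ℂ → ℂ}, Differentiable ℂ f → ∀ t : ℝ,
      HasDerivAt (fun t : ℝ => f (z + t * e)) (deriv f (z + t * e) * e) t := fun {f} hf t =>
    (hf (z + t * e)).hasDerivAt.comp t (hline t)
  have hre : ∀ {f : ℝ → ℂ} {d : ℂ} {t : ℝ}, HasDerivAt f d t →
      HasDerivAt (fun t => (f t).re) d.re t := fun {f d t} hf =>
    (Complex.reCLM.hasFDerivAt.comp_hasDerivAt t hf)
  have him : ∀ {f : ℝ → ℂ} {d : ℂ} {t : ℝ}, HasDerivAt f d t →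
      HasDerivAt (fun t => (f t).im) d.im t := fun {f d t} hf =>
    (Complex.imCLM.hasFDerivAt.comp_hasDerivAt t hf)
  have hdg : Differentiable ℂ (deriv g) := fun x =>
    (hg.analyticAt x).deriv.differentiableAt
  have hr := fun t => hre (key hg t)
  have hi := fun t => him (key hg t)
  have hr' := hre ((key hdg 0).mul_const e)
  have hi' := him ((key hdg 0).mul_const e)
  refine ⟨fun t => 2 * ((g (z + t * e)).re * (deriv g (z + t * e) * e).re
     + (g (z + t * e)).im * (deriv g (z + t * e) * e).im), Eventually.of_forall fun t => ?_, ?_, ?_⟩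
  · simp only [Complex.normSq_apply]
    refine HasDerivAt.congr_deriv (((hr t).mul (hr t)).add ((hi t).mul (hi t))) ?_
    ring
  · simp; ring
  · refine HasDerivAt.congr_deriv ((((hr 0).mul hr').add ((hi 0).mul hi')).const_mul 2) ?_
    simp [Complex.normSq_apply, pow_two]; ring

lemma HJ.nonpos_of_isLocalMax {u : ℂ → ℝ} {z p : ℂ} {L : ℝ} (h : HJ u z p L)
    (hm : IsLocalMax u z) : L ≤ 0 := by
  obtain ⟨k, hk⟩ := h
  have : ∀ e : ℂ, IsLocalMax (fun t : ℝ => u (z + t * e)) 0 := fun e => by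
    have := (tendsto_line z e).eventually hm
    simpa [IsLocalMax, IsMaxFilter] using this
  have h1 := (hk 1).nonpos_of_isLocalMax (this 1)
  have h2 := (hk Complex.I).nonpos_of_isLocalMax (this Complex.I)
  simp at h1 h2
  linarith

/-- Ahlfors lemma for the plane. -/
theorem ahlfors {v : ℂ → ℝ} (hv : Continuous v) (hv0 : ∀ z, 0 ≤ v z) {c : ℝ} (hc : 0 < c)
    (hcurv : ∀ z, 0 < v z → ∃ p L, HJ (fun w => Real.log (v w)) z p L ∧ c * v z ≤ L) :
    ∀ z, v z = 0 := by
  have main : ∀ z : ℂ, ∀ R : ℝ, ‖z‖ < R →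
      v z * (R ^ 2 - Complex.normSq z) ^ 2 ≤ 2 * R ^ 2 / c := by
    intro z R hR
    have hRpos : 0 < R := lt_of_le_of_lt (norm_nonneg _) hR
    set F : ℂ → ℝ := fun w => v w * (R ^ 2 - Complex.normSq w) ^ 2 with hF
    have hFc : Continuous F := by
      have := Complex.continuous_normSq
      fun_prop
    obtain ⟨z0, hz0, hmax⟩ := (isCompact_closedBall (0:ℂ) R).exists_isMaxOn
      ⟨z, by simpa using hR.le⟩ hFc.continuousOn
    have hzz0 : F z ≤ F z0 := hmax (by simpa using hR.le)
    refine hzz0.trans ?_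
    have hnn : 0 ≤ 2 * R ^ 2 / c := by positivity
    have hF0 : 0 ≤ F z0 := mul_nonneg (hv0 _) (sq_nonneg _)
    rcases hF0.eq_or_lt with h0 | h0
    · rw [← h0]; exact hnn
    have hvz : 0 < v z0 := lt_of_le_of_ne (hv0 _) (fun h => by simp [hF, ← h] at h0)
    have hD0 : R ^ 2 - Complex.normSq z0 ≠ 0 := fun h => by simp [hF, h] at h0
    have hle : Complex.normSq z0 ≤ R ^ 2 := by
      rw [Complex.normSq_eq_norm_sq]
      have : ‖z0‖ ≤ R := by simpa using hz0
      gcongr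
    have hD : 0 < R ^ 2 - Complex.normSq z0 := lt_of_le_of_ne (by linarith) hD0.symm
    have hlt : ‖z0‖ < R := by
      rw [Complex.normSq_eq_norm_sq] at hD
      exact lt_of_pow_lt_pow_left₀ 2 hRpos.le (by linarith)
    have hloc : IsLocalMax F z0 :=
      hmax.isLocalMax (Metric.closedBall_mem_nhds_of_mem (by simpa using hlt))
    obtain ⟨p, L, hJ, hL⟩ := hcurv z0 hvz
    have hJ2 := (((HJ.normSq differentiable_id z0).const_mul (-1)).add (HJ.const (R ^ 2) z0)).log
      (by simp only [id]; intro h; apply hD0; linarith)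
    have hJ3 := hJ.add (hJ2.const_mul 2)
    have hpos : ∀ᶠ w in 𝓝 z0, 0 < v w ∧ 0 < R ^ 2 - Complex.normSq w := by
      refine (hv.continuousAt.eventually (lt_mem_nhds hvz)).and ?_
      have : Continuous fun w : ℂ => R ^ 2 - Complex.normSq w := by
        have := Complex.continuous_normSq
        fun_prop
      exact this.continuousAt.eventually (lt_mem_nhds hD)
    have hJ4 : HJ (fun w => Real.log (F w)) z0 _ _ := hJ3.congr (by
      filter_upwards [hpos] with w hw
      rw [hF]
      simp only [id]
      rw [Real.log_mul hw.1.ne' (by have := hw.2; positivity), Real.log_pow]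
      push_cast
      congr 3; ring)
    have hmx : IsLocalMax (fun w => Real.log (F w)) z0 := by
      filter_upwards [hloc, hpos] with w hw hw2
      exact Real.log_le_log (mul_pos hw2.1 (by have := hw2.2; positivity)) hw
    have hfin := hJ4.nonpos_of_isLocalMax hmx
    simp only [deriv_id', id, map_one, mul_one] at hfin
    have e1 : (-1 * Complex.normSq z0 + R ^ 2) = R ^ 2 - Complex.normSq z0 := by ring
    rw [e1] at hfin
    simp only [add_zero, RCLike.star_def, Complex.ofReal_neg, Complex.ofReal_one, Complex.normSq_neg,
      Complex.normSq_conj, one_mul, neg_mul] at hfin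
    generalize hx : Complex.normSq z0 = x at *
    have e2 : 2 * (-1 / (R ^ 2 - x) - x / (R ^ 2 - x) ^ 2) = - (2 * R ^ 2 / (R ^ 2 - x) ^ 2) := by
      field_simp; ring
    rw [e2] at hfin
    have h5 : c * v z0 ≤ 2 * R ^ 2 / (R ^ 2 - x) ^ 2 := by linarith
    rw [le_div_iff₀ (by positivity)] at h5
    rw [le_div_iff₀ hc]
    have hFx : F z0 = v z0 * (R ^ 2 - x) ^ 2 := by rw [← hx]
    rw [hFx]; linarith
  intro z
  by_contra hne
  have hvz : 0 < v z := lt_of_le_of_ne (hv0 z) (Ne.symm hne)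
  have : Tendsto (fun R : ℝ => v z * (R - Complex.normSq z / R) ^ 2) atTop atTop := by
    refine Tendsto.const_mul_atTop hvz ?_
    refine (tendsto_pow_atTop (by norm_num)).comp ?_
    have h1 : Tendsto (fun R : ℝ => Complex.normSq z / R) atTop (𝓝 0) :=
      tendsto_const_nhds.div_atTop tendsto_id
    simpa [sub_eq_add_neg] using tendsto_id.atTop_add h1.neg
  obtain ⟨R, h1, h2, h3⟩ := ((this.eventually_gt_atTop (2 / c)).and
    ((eventually_gt_atTop ‖z‖).and (eventually_gt_atTop 0))).exists
  have h4 := main z R h2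
  have e : v z * (R ^ 2 - Complex.normSq z) ^ 2 =
      (v z * (R - Complex.normSq z / R) ^ 2) * R ^ 2 := by field_simp
  rw [e, show 2 * R ^ 2 / c = (2 / c) * R ^ 2 by ring] at h4
  exact absurd (le_of_mul_le_mul_right h4 (by positivity)) (not_le.mpr h1)

lemma HJ.log_normSq {g : ℂ → ℂ} (hg : Differentiable ℂ g) {z : ℂ} (hz : g z ≠ 0) :
    HJ (fun w => Real.log (Complex.normSq (g w))) z (deriv g z / g z) 0 := by
  have h0 : Complex.normSq (g z) ≠ 0 := by simpa using hz
  have := (HJ.normSq hg z).log h0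
  convert this using 1
  · rw [Complex.normSq_eq_conj_mul_self]
    have : star (g z) ≠ 0 := by simpa using hz
    simp only [RCLike.star_def] at *
    field_simp
  · simp only [map_mul, RCLike.star_def, Complex.normSq_conj]
    field_simp; ring

noncomputable def NN (g h : ℂ → ℂ) (z : ℂ) : ℝ := Complex.normSq (g z) + Complex.normSq (h z)
noncomputable def WW (g h : ℂ → ℂ) (z : ℂ) : ℂ := deriv g z * h z - g z * deriv h z
noncomputable def LL (g h : ℂ → ℂ) (A B : ℂ) (z : ℂ) : ℂ := A * g z + B * h z
noncomputable def SS (g h : ℂ → ℂ) (A B : ℂ) (z : ℂ) : ℝ := Complex.normSq (LL g h A B z) / NN g h z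
noncomputable def OO (g h : ℂ → ℂ) (z : ℂ) : ℝ := Complex.normSq (WW g h z) / NN g h z ^ 2

section
variable {g h : ℂ → ℂ}

lemma NN_pos (hnocz : ∀ z, h z ≠ 0 ∨ g z ≠ 0) (z : ℂ) : 0 < NN g h z := by
  unfold NN
  rcases hnocz z with hz | hz
  · exact add_pos_of_nonneg_of_pos (Complex.normSq_nonneg _) (Complex.normSq_pos.mpr hz)
  · exact add_pos_of_pos_of_nonneg (Complex.normSq_pos.mpr hz) (Complex.normSq_nonneg _)

lemma differentiable_deriv' (hg : Differentiable ℂ g) : Differentiable ℂ (deriv g) := fun x =>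
  (hg.analyticAt x).deriv.differentiableAt

lemma WW_diff (hg : Differentiable ℂ g) (hh : Differentiable ℂ h) :
    Differentiable ℂ (WW g h) :=
  ((differentiable_deriv' hg).mul hh).sub (hg.mul (differentiable_deriv' hh))

lemma LL_diff (hg : Differentiable ℂ g) (hh : Differentiable ℂ h) (A B : ℂ) :
    Differentiable ℂ (LL g h A B) :=
  (hg.const_mul A).add (hh.const_mul B)

lemma LL_deriv (hg : Differentiable ℂ g) (hh : Differentiable ℂ h) (A B z : ℂ) :
    deriv (LL g h A B) z = A * deriv g z + B * deriv h z :=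
  (((hg z).hasDerivAt.const_mul A).add ((hh z).hasDerivAt.const_mul B)).deriv

lemma NN_cont (hg : Differentiable ℂ g) (hh : Differentiable ℂ h) : Continuous (NN g h) :=
  (Complex.continuous_normSq.comp hg.continuous).add (Complex.continuous_normSq.comp hh.continuous)

lemma SS_cont (hg : Differentiable ℂ g) (hh : Differentiable ℂ h)
    (hnocz : ∀ z, h z ≠ 0 ∨ g z ≠ 0) (A B : ℂ) : Continuous (SS g h A B) :=
  (Complex.continuous_normSq.comp (LL_diff hg hh A B).continuous).div (NN_cont hg hh)
    fun z => (NN_pos hnocz z).ne'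

lemma OO_cont (hg : Differentiable ℂ g) (hh : Differentiable ℂ h)
    (hnocz : ∀ z, h z ≠ 0 ∨ g z ≠ 0) : Continuous (OO g h) :=
  (Complex.continuous_normSq.comp (WW_diff hg hh).continuous).div ((NN_cont hg hh).pow 2)
    fun z => (pow_pos (NN_pos hnocz z) 2).ne'

lemma SS_nonneg (hnocz : ∀ z, h z ≠ 0 ∨ g z ≠ 0) (A B z : ℂ) : 0 ≤ SS g h A B z :=
  div_nonneg (Complex.normSq_nonneg _) (NN_pos hnocz z).le

lemma SS_pos (hnocz : ∀ z, h z ≠ 0 ∨ g z ≠ 0) {A B z : ℂ} (hz : LL g h A B z ≠ 0) :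
    0 < SS g h A B z :=
  div_pos (Complex.normSq_pos.mpr hz) (NN_pos hnocz z)

lemma lagr {A B : ℂ} (hAB : Complex.normSq A + Complex.normSq B = 1) (a b : ℂ) :
    Complex.normSq (A * a + B * b) + Complex.normSq (A * star b - B * star a) =
      Complex.normSq a + Complex.normSq b := by
  have : Complex.normSq (A * a + B * b) + Complex.normSq (A * star b - B * star a) =
      (Complex.normSq A + Complex.normSq B) * (Complex.normSq a + Complex.normSq b) := by
    simp [Complex.normSq_apply]; ring
  rw [this, hAB, one_mul]

lemma SS_le_one (hnocz : ∀ z, h z ≠ 0 ∨ g z ≠ 0) {A B : ℂ}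
    (hAB : Complex.normSq A + Complex.normSq B = 1) (z : ℂ) : SS g h A B z ≤ 1 := by
  rw [SS, div_le_one (NN_pos hnocz z), LL, NN, ← lagr hAB (g z) (h z)]
  linarith [Complex.normSq_nonneg (A * star (h z) - B * star (g z))]

lemma HJ_logNN (hg : Differentiable ℂ g) (hh : Differentiable ℂ h)
    (hnocz : ∀ z, h z ≠ 0 ∨ g z ≠ 0) (z : ℂ) :
    HJ (fun w => Real.log (NN g h w)) z
      ((NN g h z : ℂ)⁻¹ * (star (g z) * deriv g z + star (h z) * deriv h z)) (OO g h z) := by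
  have h0 := (NN_pos hnocz z).ne'
  have := ((HJ.normSq hg z).add (HJ.normSq hh z)).log h0
  change HJ (fun w => Real.log (NN g h w)) z ((NN g h z : ℂ)⁻¹ * _) (_ / NN g h z - _ / NN g h z ^ 2) at this
  convert this using 1
  have e : Complex.normSq (g z) + Complex.normSq (h z) = NN g h z := rfl
  rw [OO]
  field_simp
  rw [NN, WW]
  simp [Complex.normSq_apply]; ring

lemma HJ_logSS (hg : Differentiable ℂ g) (hh : Differentiable ℂ h)
    (hnocz : ∀ z, h z ≠ 0 ∨ g z ≠ 0) {A B : ℂ}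
    (hAB : Complex.normSq A + Complex.normSq B = 1) {z : ℂ} (hz : LL g h A B z ≠ 0) :
    ∃ p, HJ (fun w => Real.log (SS g h A B w)) z p (- OO g h z) ∧
      Complex.normSq p = OO g h z * (1 / SS g h A B z - 1) := by
  have h0 := NN_pos hnocz z
  have h0' : (NN g h z : ℂ) ≠ 0 := by exact_mod_cast h0.ne'
  have h1 := (HJ.log_normSq (LL_diff hg hh A B) hz).add ((HJ_logNN hg hh hnocz z).const_mul (-1))
  have hp := SS_pos hnocz hz
  have h2 := h1.congr (v := fun w => Real.log (SS g h A B w)) (by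
      filter_upwards [(LL_diff hg hh A B).continuous.continuousAt.eventually_ne hz] with w hw
      rw [SS, Real.log_div (by simpa using hw) (NN_pos hnocz w).ne']
      ring)
  rw [show 0 + -1 * OO g h z = - OO g h z by ring] at h2
  refine ⟨_, h2, ?_⟩
  have e : deriv (LL g h A B) z / LL g h A B z + ((-1 : ℝ) : ℂ) * ((NN g h z : ℂ)⁻¹ *
      (star (g z) * deriv g z + star (h z) * deriv h z)) =
      WW g h z * (A * star (h z) - B * star (g z)) / (LL g h A B z * NN g h z) := by
    rw [LL_deriv hg hh]
    field_simp
    have : (NN g h z : ℂ) = star (g z) * g z + star (h z) * h z := by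
      rw [NN]; push_cast
      rw [Complex.normSq_eq_conj_mul_self, Complex.normSq_eq_conj_mul_self]; rfl
    rw [this, LL, WW]
    push_cast
    ring
  rw [e]
  have l := lagr hAB (g z) (h z)
  have hl : Complex.normSq (A * g z + B * h z) ≠ 0 := by
    rw [Complex.normSq_eq_zero.ne]; exact hz
  simp only [map_mul, map_div₀, Complex.normSq_ofReal, OO, SS, LL]
  rw [show Complex.normSq (A * star (h z) - B * star (g z)) =
    NN g h z - Complex.normSq (A * g z + B * h z) by rw [NN, ← l]; ring]
  field_simp

end

section
variable {g h : ℂ → ℂ}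

lemma WW_eq (hg : Differentiable ℂ g) (hh : Differentiable ℂ h) {A B : ℂ}
    (hAB : Complex.normSq A + Complex.normSq B = 1) (z : ℂ) :
    WW g h z = deriv (LL g h A B) z * (- star B * g z + star A * h z) -
      LL g h A B z * (- star B * deriv g z + star A * deriv h z) := by
  rw [LL_deriv hg hh, LL]
  have e : star A * A + star B * B = 1 := by
    have := congrArg (fun x : ℝ => (x : ℂ)) hAB
    simp only [Complex.ofReal_add, Complex.normSq_eq_conj_mul_self, Complex.ofReal_one] at this
    exact this
  have : WW g h z = (star A * A + star B * B) * WW g h z := by rw [e, one_mul]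
  rw [this, WW]
  ring

lemma cont_bad (hg : Differentiable ℂ g) (hh : Differentiable ℂ h)
    (hnocz : ∀ z, h z ≠ 0 ∨ g z ≠ 0) {A B : ℂ}
    (hAB : Complex.normSq A + Complex.normSq B = 1) {z0 : ℂ} (hz0 : LL g h A B z0 = 0)
    {k : ℕ} (hk : analyticOrderAt (LL g h A B) z0 = k) {β : ℝ} (hβ : 1 < k * β) :
    ContinuousAt (fun z => OO g h z * SS g h A B z ^ (β - 1)) z0 ∧
      OO g h z0 * SS g h A B z0 ^ (β - 1) = 0 := by
  have hL := (LL_diff hg hh A B).analyticAt z0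
  obtain ⟨G, hG, hG0, hGe⟩ := hL.analyticOrderAt_eq_natCast.mp hk
  obtain ⟨l, rfl⟩ : ∃ l, k = l + 1 := by
    refine Nat.exists_eq_succ_of_ne_zero ?_
    rintro rfl
    norm_num at hβ
  set M : ℂ → ℂ := fun z => - star B * g z + star A * h z with hM
  set M' : ℂ → ℂ := fun z => - star B * deriv g z + star A * deriv h z with hM'
  set Q : ℂ → ℂ := fun z => (((l + 1 : ℕ) : ℂ) * G z + (z - z0) * deriv G z) * M z
    - (z - z0) * G z * M' z with hQ
  have hgc := hg.continuous
  have hhc := hh.continuous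
  have hgc' := (differentiable_deriv' hg).continuous
  have hhc' := (differentiable_deriv' hh).continuous
  have hGc := hG.continuousAt
  have hGc' := hG.deriv.continuousAt
  have hMc : ContinuousAt M z0 := by fun_prop
  have hMc' : ContinuousAt M' z0 := by fun_prop
  have hQc : ContinuousAt Q z0 := by fun_prop
  have hder : ∀ᶠ z in 𝓝 z0, deriv (LL g h A B) z =
      ((l + 1 : ℕ) : ℂ) * (z - z0) ^ l * G z + (z - z0) ^ (l + 1) * deriv G z := by
    filter_upwards [hGe.eventually_nhds, hG.eventually_analyticAt] with z hz hGz
    rw [Filter.EventuallyEq.deriv_eq hz]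
    have h1 : HasDerivAt (fun z : ℂ => (z - z0) ^ (l + 1)) (((l + 1 : ℕ) : ℂ) * (z - z0) ^ l) z := by
      refine HasDerivAt.congr_deriv (((hasDerivAt_id z).sub_const z0).pow (l + 1)) ?_
      simp
    exact (h1.mul hGz.differentiableAt.hasDerivAt).deriv
  have hW : ∀ᶠ z in 𝓝 z0, WW g h z = (z - z0) ^ l * Q z := by
    filter_upwards [hder, hGe] with z h1 h2
    rw [WW_eq hg hh hAB, h1, h2, hQ, hM, hM']
    simp only [smul_eq_mul]
    ring
  set F : ℂ → ℝ := fun z => Complex.normSq (WW g h z) * Complex.normSq (LL g h A B z) ^ (β - 1)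
    with hF
  set R : ℂ → ℝ := fun z => Complex.normSq (z - z0) ^ (((l + 1 : ℕ) : ℝ) * β - 1) *
    Complex.normSq (Q z) * Complex.normSq (G z) ^ (β - 1) with hR
  have hnc := Complex.continuous_normSq
  have hRc : ContinuousAt R z0 := by
    refine ContinuousAt.mul (ContinuousAt.mul ?_ ?_) ?_
    · refine ContinuousAt.rpow_const ?_ (Or.inr (by linarith))
      fun_prop
    · exact hnc.continuousAt.comp hQc
    · exact (hnc.continuousAt.comp hGc).rpow_const (Or.inl (by simpa using hG0))
  have hR0 : R z0 = 0 := by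
    simp only [hR, sub_self, map_zero]
    rw [Real.zero_rpow (by linarith)]; ring
  have hF0 : F z0 = 0 := by
    simp only [hF, hz0, map_zero]
    by_cases hb : β = 1
    · have hl : l ≠ 0 := by
        rintro rfl
        rw [hb] at hβ; norm_num at hβ
      rw [hW.self_of_nhds]; simp [hl]
    · rw [Real.zero_rpow (sub_ne_zero.mpr hb)]; ring
  have hFR : F =ᶠ[𝓝 z0] R := by
    refine eventuallyEq_nhds_of_eventuallyEq_nhdsNE ?_ (hF0.trans hR0.symm)
    filter_upwards [hW.filter_mono nhdsWithin_le_nhds, hGe.filter_mono nhdsWithin_le_nhds,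
      self_mem_nhdsWithin] with z h1 h2 h3
    have hx : 0 < Complex.normSq (z - z0) := Complex.normSq_pos.mpr (sub_ne_zero.mpr h3)
    simp only [hF, hR, h1, h2, smul_eq_mul, map_mul, map_pow]
    rw [Real.mul_rpow (by positivity) (Complex.normSq_nonneg _)]
    generalize Complex.normSq (z - z0) = x at *
    have : x ^ (((l + 1 : ℕ) : ℝ) * β - 1) = x ^ l * (x ^ (l + 1)) ^ (β - 1) := by
      rw [← Real.rpow_natCast, ← Real.rpow_natCast, ← Real.rpow_mul hx.le, ← Real.rpow_add hx]
      congr 1; push_cast; ring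
    rw [this]; ring
  have hFc : ContinuousAt F z0 := hRc.congr hFR.symm
  have hN := NN_pos hnocz z0
  have hNc := (NN_cont hg hh).continuousAt (x := z0)
  have : (fun z => OO g h z * SS g h A B z ^ (β - 1)) =
      fun z => F z / (NN g h z ^ 2 * NN g h z ^ (β - 1)) := by
    funext z
    rw [OO, SS, Real.div_rpow (Complex.normSq_nonneg _) (NN_pos hnocz z).le, div_mul_div_comm]
  refine ⟨?_, by rw [congrFun this z0, hF0, zero_div]⟩
  rw [this]
  refine hFc.div ((hNc.pow 2).mul (hNc.rpow_const (Or.inl hN.ne'))) ?_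
  positivity

lemma pair_bound (hnocz : ∀ z, h z ≠ 0 ∨ g z ≠ 0) {A B A' B' : ℂ}
    (hAB : Complex.normSq A + Complex.normSq B = 1)
    (hAB' : Complex.normSq A' + Complex.normSq B' = 1) (z : ℂ) :
    Complex.normSq (A * B' - A' * B) / 2 ≤ SS g h A B z + SS g h A' B' z := by
  rw [SS, SS, ← add_div, le_div_iff₀ (NN_pos hnocz z)]
  have cs : ∀ a b x y : ℂ, Complex.normSq (a * x - b * y) ≤
      (Complex.normSq a + Complex.normSq b) * (Complex.normSq x + Complex.normSq y) := by
    intro a b x y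
    have : (Complex.normSq a + Complex.normSq b) * (Complex.normSq x + Complex.normSq y) =
      Complex.normSq (a * x - b * y) + Complex.normSq (star b * x + star a * y) := by
      simp [Complex.normSq_apply]; ring
    rw [this]; linarith [Complex.normSq_nonneg (star b * x + star a * y)]
  have h1 := cs B' B (LL g h A B z) (LL g h A' B' z)
  have h2 := cs A' A (LL g h A B z) (LL g h A' B' z)
  have e1 : B' * LL g h A B z - B * LL g h A' B' z = (A * B' - A' * B) * g z := by
    rw [LL, LL]; ring
  have e2 : A' * LL g h A B z - A * LL g h A' B' z = -(A * B' - A' * B) * h z := by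
    rw [LL, LL]; ring
  rw [e1, map_mul] at h1
  rw [e2, map_mul, Complex.normSq_neg] at h2
  rw [NN]
  rw [show Complex.normSq B' = 1 - Complex.normSq A' by linarith,
    show Complex.normSq B = 1 - Complex.normSq A by linarith] at h1
  linarith

lemma exists_sep {ι : Type*} [Finite ι] {A B : ι → ℂ}
    (hAB : ∀ i, Complex.normSq (A i) + Complex.normSq (B i) = 1)
    (hdet : ∀ i j, i ≠ j → A i * B j - A j * B i ≠ 0) (hnocz : ∀ z, h z ≠ 0 ∨ g z ≠ 0) :
    ∃ r : ℝ, 0 < r ∧ r ≤ 1 ∧ ∀ z i j, i ≠ j →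
      r ≤ SS g h (A i) (B i) z ∨ r ≤ SS g h (A j) (B j) z := by
  have h1 : ∀ᶠ r : ℝ in 𝓝[>] 0, ∀ i j, i ≠ j →
      r < Complex.normSq (A i * B j - A j * B i) / 4 := by
    rw [eventually_all]; intro i
    rw [eventually_all]; intro j
    by_cases hij : i = j
    · exact Eventually.of_forall fun r hr => absurd hij hr
    have : 0 < Complex.normSq (A i * B j - A j * B i) / 4 := by
      have := Complex.normSq_pos.mpr (hdet i j hij)
      positivity
    filter_upwards [(eventually_lt_nhds this).filter_mono nhdsWithin_le_nhds] with r hr _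
    exact hr
  obtain ⟨r, hr, hr0, hr1⟩ := (h1.and ((eventually_mem_nhdsWithin).and
    ((eventually_lt_nhds (zero_lt_one (α := ℝ))).filter_mono nhdsWithin_le_nhds))).exists
  refine ⟨r, hr0, hr1.le, fun z i j hij => ?_⟩
  have := pair_bound hnocz (hAB i) (hAB j) z
  have := hr i j hij
  by_contra! hc
  linarith [hc.1, hc.2]

lemma prod_bound {ι : Type*} [Fintype ι] {s β : ι → ℝ} (hs : ∀ i, 0 < s i) (hs1 : ∀ i, s i ≤ 1)
    (hβ : ∀ i, 0 < β i) {r : ℝ} (hr : 0 < r) (hr1 : r ≤ 1)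
    (hsep : ∀ i j, i ≠ j → r ≤ s i ∨ r ≤ s j) :
    ∏ i, s i ^ (β i - 1) ≤ (1 / r) ^ Fintype.card ι * (1 + ∑ i, s i ^ (β i - 1)) := by
  classical
  have hp : ∀ i, 0 < s i ^ (β i - 1) := fun i => Real.rpow_pos_of_pos (hs i) _
  have h1r : 1 ≤ 1 / r := by rw [le_div_iff₀ hr]; linarith
  have hb : ∀ i, r ≤ s i → s i ^ (β i - 1) ≤ 1 / r := by
    intro i hi
    calc s i ^ (β i - 1) ≤ s i ^ (-1 : ℝ) :=
          Real.rpow_le_rpow_of_exponent_ge (hs i) (hs1 i) (by linarith [hβ i])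
      _ = 1 / s i := by rw [Real.rpow_neg_one, one_div]
      _ ≤ 1 / r := one_div_le_one_div_of_le hr hi
  have hS : 0 ≤ ∑ i, s i ^ (β i - 1) := Finset.sum_nonneg fun i _ => (hp i).le
  by_cases hall : ∀ i, r ≤ s i
  · calc ∏ i, s i ^ (β i - 1) ≤ ∏ _i : ι, (1 / r) :=
          Finset.prod_le_prod (fun i _ => (hp i).le) fun i _ => hb i (hall i)
      _ = (1 / r) ^ Fintype.card ι * 1 := by simp
      _ ≤ _ := by gcongr; linarith
  · push Not at hall
    obtain ⟨j, hj⟩ := hall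
    rw [← Finset.mul_prod_erase Finset.univ _ (Finset.mem_univ j)]
    have h1 : ∏ i ∈ Finset.univ.erase j, s i ^ (β i - 1) ≤ (1 / r) ^ Fintype.card ι := by
      calc _ ≤ ∏ i ∈ Finset.univ.erase j, (1 / r) :=
            Finset.prod_le_prod (fun i _ => (hp i).le) fun i hi => hb i (by
              rcases hsep i j (Finset.ne_of_mem_erase hi) with h | h
              · exact h
              · linarith)
        _ = (1 / r) ^ (Finset.univ.erase j).card := by simp
        _ ≤ _ := pow_le_pow_right₀ h1r (Finset.card_le_univ _)
    have h2 : s j ^ (β j - 1) ≤ 1 + ∑ i, s i ^ (β i - 1) := by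
      have := Finset.single_le_sum (f := fun i => s i ^ (β i - 1)) (fun i _ => (hp i).le)
        (Finset.mem_univ j)
      linarith
    rw [mul_comm]
    gcongr
    exact (hp j).le
end

section
variable {g h : ℂ → ℂ} {ι : Type*} [Fintype ι]

noncomputable def VV (g h : ℂ → ℂ) (A B : ι → ℂ) (β : ι → ℝ) (δ : ℝ) (z : ℂ) : ℝ :=
  OO g h z * (∏ i, SS g h (A i) (B i) z ^ (β i - 1)) *
    Real.exp (δ * ∑ i, SS g h (A i) (B i) z ^ (β i))

lemma OO_nonneg (z : ℂ) : 0 ≤ OO g h z := div_nonneg (Complex.normSq_nonneg _) (sq_nonneg _)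

lemma VV_cont (hg : Differentiable ℂ g) (hh : Differentiable ℂ h)
    (hnocz : ∀ z, h z ≠ 0 ∨ g z ≠ 0) {A B : ι → ℂ} {β : ι → ℝ}
    (hAB : ∀ i, Complex.normSq (A i) + Complex.normSq (B i) = 1) (hβ : ∀ i, 0 < β i) {r : ℝ}
    (hr : 0 < r)
    (hsep : ∀ z i j, i ≠ j → r ≤ SS g h (A i) (B i) z ∨ r ≤ SS g h (A j) (B j) z)
    (hram : ∀ i z, LL g h (A i) (B i) z = 0 →
      ∃ k : ℕ, analyticOrderAt (LL g h (A i) (B i)) z = k ∧ 1 < k * β i) (δ : ℝ) :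
    Continuous (VV g h A B β δ) := by
  classical
  rw [continuous_iff_continuousAt]
  intro z0
  have hO := (OO_cont hg hh hnocz).continuousAt (x := z0)
  have hS := fun i => (SS_cont hg hh hnocz (A i) (B i)).continuousAt (x := z0)
  refine ContinuousAt.mul ?_ ?_
  swap
  · refine Real.continuous_exp.continuousAt.comp (continuousAt_const.mul ?_)
    exact tendsto_finsetSum _ fun i _ => (hS i).rpow_const (Or.inr (hβ i).le)
  by_cases hbad : ∃ j, LL g h (A j) (B j) z0 = 0
  · obtain ⟨j, hj⟩ := hbad
    obtain ⟨k, hk, hkβ⟩ := hram j z0 hj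
    have h1 := (cont_bad hg hh hnocz (hAB j) hj hk hkβ).1
    have h2 : ContinuousAt (fun z => ∏ i ∈ Finset.univ.erase j,
        SS g h (A i) (B i) z ^ (β i - 1)) z0 := by
      refine tendsto_finsetProd _ fun i hi => (hS i).rpow_const (Or.inl ?_)
      have hSj : SS g h (A j) (B j) z0 = 0 := by rw [SS, hj]; simp
      rcases hsep z0 i j (Finset.ne_of_mem_erase hi) with h | h
      · linarith
      · rw [hSj] at h; linarith
    refine (h1.mul h2).congr (Eventually.of_forall fun z => ?_)
    simp only [Pi.mul_apply]
    rw [← Finset.mul_prod_erase Finset.univ (fun i => SS g h (A i) (B i) z ^ (β i - 1))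
      (Finset.mem_univ j), mul_assoc]
  · push Not at hbad
    refine hO.mul ?_
    exact tendsto_finsetProd _ fun i _ => (hS i).rpow_const (Or.inl (SS_pos hnocz (hbad i)).ne')

lemma VV_curv (hg : Differentiable ℂ g) (hh : Differentiable ℂ h)
    (hnocz : ∀ z, h z ≠ 0 ∨ g z ≠ 0) {A B : ι → ℂ} {β : ι → ℝ}
    (hAB : ∀ i, Complex.normSq (A i) + Complex.normSq (B i) = 1) (δ : ℝ) {z : ℂ}
    (hL : ∀ i, LL g h (A i) (B i) z ≠ 0) (hW : WW g h z ≠ 0) :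
    ∃ p, HJ (fun w => Real.log (VV g h A B β δ w)) z p
      (OO g h z * ((∑ i, (1 - β i)) - 2 + δ * ∑ i, (β i ^ 2 * SS g h (A i) (B i) z ^ (β i - 1)
        - (β i + β i ^ 2) * SS g h (A i) (B i) z ^ (β i)))) := by
  have hS := fun i => SS_pos hnocz (hL i)
  choose p hp hp2 using fun i => HJ_logSS hg hh hnocz (hAB i) (hL i)
  have h1 := HJ.log_normSq (WW_diff hg hh) hW
  have h2 := (HJ_logNN hg hh hnocz z).const_mul (-2)
  have h3 := HJ.sum Finset.univ fun i => (hp i).const_mul (β i - 1)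
  have h4 := (HJ.sum Finset.univ fun i => (hp i).exp_mul (β i)).const_mul δ
  have h5 := ((h1.add h2).add h3).add h4
  have h6 := h5.congr (v := fun w => Real.log (VV g h A B β δ w)) (by
    have hev : ∀ᶠ w in 𝓝 z, WW g h w ≠ 0 ∧ ∀ i, LL g h (A i) (B i) w ≠ 0 := by
      refine ((WW_diff hg hh).continuous.continuousAt.eventually_ne hW).and ?_
      rw [eventually_all]
      exact fun i => (LL_diff hg hh _ _).continuous.continuousAt.eventually_ne (hL i)
    filter_upwards [hev] with w hw
    have hS := fun i => SS_pos hnocz (hw.2 i)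
    have hN := NN_pos hnocz w
    have hWp := Complex.normSq_pos.mpr hw.1
    have hO : OO g h w ≠ 0 := by rw [OO]; positivity
    have hP : ∀ i, SS g h (A i) (B i) w ^ (β i - 1) ≠ 0 := fun i =>
      (Real.rpow_pos_of_pos (hS i) _).ne'
    have hPP : ∏ i, SS g h (A i) (B i) w ^ (β i - 1) ≠ 0 :=
      Finset.prod_ne_zero_iff.mpr fun i _ => hP i
    rw [VV, Real.log_mul (mul_ne_zero hO hPP) (Real.exp_ne_zero _), Real.log_exp,
      Real.log_mul hO hPP, Real.log_prod (fun i _ => hP i), OO,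
      Real.log_div hWp.ne' (by positivity), Real.log_pow]
    have e1 : ∀ i, Real.log (SS g h (A i) (B i) w ^ (β i - 1)) =
      (β i - 1) * Real.log (SS g h (A i) (B i) w) := fun i => Real.log_rpow (hS i) _
    have e2 : ∀ i, SS g h (A i) (B i) w ^ (β i) =
      Real.exp (β i * Real.log (SS g h (A i) (B i) w)) := fun i => by
        rw [Real.rpow_def_of_pos (hS i), mul_comm]
    simp only [e1, e2]
    push_cast
    ring)
  refine ⟨_, Eq.subst (motive := fun x => HJ _ z _ x) ?_ h6⟩
  symm
  rw [mul_add, mul_sub, ← mul_assoc, mul_comm (OO g h z) δ, mul_assoc, Finset.mul_sum,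
    Finset.mul_sum]
  have e1 : ∀ i, (β i - 1) * -OO g h z = OO g h z * (1 - β i) := fun i => by ring
  simp only [e1]
  have e2 : ∀ i, β i ^ 2 * Real.exp (β i * Real.log (SS g h (A i) (B i) z)) *
      Complex.normSq (p i) + β i * Real.exp (β i * Real.log (SS g h (A i) (B i) z)) *
      -OO g h z = OO g h z * (β i ^ 2 * SS g h (A i) (B i) z ^ (β i - 1)
    - (β i + β i ^ 2) * SS g h (A i) (B i) z ^ (β i)) := by
    intro i
    rw [hp2, mul_comm (β i) (Real.log _), ← Real.rpow_def_of_pos (hS i),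
      Real.rpow_sub_one (hS i).ne']
    have := (hS i).ne'
    field_simp
    ring
  simp only [e2]
  ring

theorem core (hg : Differentiable ℂ g) (hh : Differentiable ℂ h)
    (hnocz : ∀ z, h z ≠ 0 ∨ g z ≠ 0) {A B : ι → ℂ} {β : ι → ℝ}
    (hAB : ∀ i, Complex.normSq (A i) + Complex.normSq (B i) = 1)
    (hdet : ∀ i j, i ≠ j → A i * B j - A j * B i ≠ 0)
    (hβ : ∀ i, 0 < β i) (hβ2 : ∀ i, β i ≤ 2) (hsum : 2 < ∑ i, (1 - β i))
    (hram : ∀ i z, LL g h (A i) (B i) z = 0 →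
      ∃ k : ℕ, analyticOrderAt (LL g h (A i) (B i)) z = k ∧ 1 < k * β i) (z : ℂ) :
    WW g h z = 0 ∨ ∃ i, LL g h (A i) (B i) z = 0 := by
  obtain ⟨r, hr, hr1, hsep⟩ := exists_sep hAB hdet hnocz
  obtain ⟨b, hb0, hb⟩ : ∃ b : ℝ, 0 < b ∧ ∀ i, b < β i := by
    have : ∀ᶠ b : ℝ in 𝓝[>] 0, ∀ i, b < β i := by
      rw [eventually_all]
      exact fun i => (eventually_lt_nhds (hβ i)).filter_mono nhdsWithin_le_nhds
    obtain ⟨b, h1, h2⟩ := (this.and eventually_mem_nhdsWithin).exists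
    exact ⟨b, h2, h1⟩
  set q : ℝ := (Fintype.card ι : ℝ) with hq
  have hq0 : 0 ≤ q := by positivity
  set ε : ℝ := (∑ i, (1 - β i)) - 2 with hε
  have hε0 : 0 < ε := by linarith
  set δ : ℝ := ε / (12 * (q + 1)) with hδ
  have hδ0 : 0 < δ := by positivity
  have hδq : 6 * δ * q ≤ ε / 2 := by
    have : 6 * δ * (q + 1) = ε / 2 := by rw [hδ]; field_simp; norm_num
    nlinarith
  set c0 : ℝ := min (ε / 2) (δ * b ^ 2) with hc0
  have hc0p : 0 < c0 := lt_min (by positivity) (by positivity)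
  set K : ℝ := (1 / r) ^ Fintype.card ι * Real.exp (δ * q) with hK
  have hKp : 0 < K := by positivity
  have hVc := VV_cont hg hh hnocz hAB hβ hr hsep hram δ
  have hP0 : ∀ z, 0 ≤ ∏ i, SS g h (A i) (B i) z ^ (β i - 1) := fun z =>
    Finset.prod_nonneg fun i _ => Real.rpow_nonneg (SS_nonneg hnocz _ _ _) _
  have hV0 : ∀ z, 0 ≤ VV g h A B β δ z := fun z =>
    mul_nonneg (mul_nonneg (OO_nonneg z) (hP0 z)) (Real.exp_pos _).le
  have curv : ∀ z, (∀ i, LL g h (A i) (B i) z ≠ 0) → WW g h z ≠ 0 →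
      ∃ p L, HJ (fun w => Real.log (VV g h A B β δ w)) z p L ∧ c0 / K * VV g h A B β δ z ≤ L := by
    intro z hL hW
    obtain ⟨p, hp⟩ := VV_curv hg hh hnocz (β := β) hAB δ hL hW
    refine ⟨p, _, hp, ?_⟩
    have hS := fun i => SS_pos hnocz (hL i)
    have hS1 := fun i => SS_le_one hnocz (hAB i) z
    have hpb := prod_bound hS hS1 hβ hr hr1 (hsep z)
    set T := ∑ i, SS g h (A i) (B i) z ^ (β i - 1) with hT
    have hT0 : 0 ≤ T := Finset.sum_nonneg fun i _ => Real.rpow_nonneg (hS i).le _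
    have hle1 : ∀ i, SS g h (A i) (B i) z ^ (β i) ≤ 1 := fun i =>
      Real.rpow_le_one (hS i).le (hS1 i) (hβ i).le
    have hexp : Real.exp (δ * ∑ i, SS g h (A i) (B i) z ^ (β i)) ≤ Real.exp (δ * q) := by
      gcongr
      calc ∑ i, SS g h (A i) (B i) z ^ (β i) ≤ ∑ _i : ι, (1 : ℝ) :=
            Finset.sum_le_sum fun i _ => hle1 i
        _ = q := by simp [hq]
    have hVle : VV g h A B β δ z ≤ OO g h z * (K * (1 + T)) := by
      rw [VV, mul_assoc]
      refine mul_le_mul_of_nonneg_left ?_ (OO_nonneg z)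
      calc _ ≤ ((1 / r) ^ Fintype.card ι * (1 + T)) * Real.exp (δ * q) :=
            mul_le_mul hpb hexp (Real.exp_pos _).le (by positivity)
        _ = _ := by rw [hK]; ring
    have hlow : c0 * (1 + T) ≤ ε + δ * ∑ i, (β i ^ 2 * SS g h (A i) (B i) z ^ (β i - 1)
        - (β i + β i ^ 2) * SS g h (A i) (B i) z ^ (β i)) := by
      have h1 : b ^ 2 * T - 6 * q ≤ ∑ i, (β i ^ 2 * SS g h (A i) (B i) z ^ (β i - 1)
        - (β i + β i ^ 2) * SS g h (A i) (B i) z ^ (β i)) := by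
        have : b ^ 2 * T - 6 * q = ∑ i, (b ^ 2 * SS g h (A i) (B i) z ^ (β i - 1) - 6) := by
          rw [Finset.sum_sub_distrib, ← Finset.mul_sum]
          simp [hq]; ring
        rw [this]
        refine Finset.sum_le_sum fun i _ => ?_
        have a1 : b ^ 2 * SS g h (A i) (B i) z ^ (β i - 1) ≤
            β i ^ 2 * SS g h (A i) (B i) z ^ (β i - 1) := by
          have := Real.rpow_nonneg (hS i).le (β i - 1)
          have := (hb i).le
          gcongr
        have a2 : (β i + β i ^ 2) * SS g h (A i) (B i) z ^ (β i) ≤ 6 * 1 := by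
          have := hβ i
          have := hβ2 i
          refine mul_le_mul (by nlinarith) (hle1 i) (Real.rpow_nonneg (hS i).le _) (by norm_num)
        linarith
      have h2 := mul_le_mul_of_nonneg_left h1 hδ0.le
      have h3 : c0 ≤ ε / 2 := min_le_left _ _
      have h4 : c0 * T ≤ δ * b ^ 2 * T := mul_le_mul_of_nonneg_right (min_le_right _ _) hT0
      linarith
    calc c0 / K * VV g h A B β δ z ≤ c0 / K * (OO g h z * (K * (1 + T))) :=
          mul_le_mul_of_nonneg_left hVle (by positivity)
      _ = OO g h z * (c0 * (1 + T)) := by field_simp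
      _ ≤ _ := mul_le_mul_of_nonneg_left hlow (OO_nonneg z)
  by_contra! hcon
  obtain ⟨hW, hL⟩ := hcon
  have hpos : VV g h A B β δ z ≠ 0 := by
    have hO : 0 < OO g h z := div_pos (Complex.normSq_pos.mpr hW) (pow_pos (NN_pos hnocz z) 2)
    have hP : 0 < ∏ i, SS g h (A i) (B i) z ^ (β i - 1) :=
      Finset.prod_pos fun i _ => Real.rpow_pos_of_pos (SS_pos hnocz (hL i)) _
    rw [VV]; positivity
  refine hpos (ahlfors hVc hV0 (c := c0 / K) (by positivity) ?_ z)
  intro w hw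
  by_cases hWw : WW g h w = 0
  · exfalso; simp [VV, OO, hWw] at hw
  by_cases hLw : ∀ i, LL g h (A i) (B i) w ≠ 0
  · exact curv w hLw hWw
  exfalso
  push Not at hLw
  obtain ⟨j, hj⟩ := hLw
  obtain ⟨k, hk, hkβ⟩ := hram j w hj
  have h0 := (cont_bad hg hh hnocz (hAB j) hj hk hkβ).2
  classical
  rw [VV, ← Finset.mul_prod_erase Finset.univ (fun i => SS g h (A i) (B i) w ^ (β i - 1))
      (Finset.mem_univ j), ← mul_assoc, h0] at hw
  simp at hw
end


lemma entire_zero_of_eventually {f : ℂ → ℂ} (hf : Differentiable ℂ f) {z : ℂ}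
    (hz : ∀ᶠ w in 𝓝 z, f w = 0) (w : ℂ) : f w = 0 := by
  have h1 : AnalyticOnNhd ℂ f Set.univ := fun x _ => hf.analyticAt x
  have h2 : AnalyticOnNhd ℂ (fun _ : ℂ => (0 : ℂ)) Set.univ := fun x _ => analyticAt_const
  exact congrFun (h1.eq_of_eventuallyEq h2 hz) w

lemma order_bound {f : ℂ → ℂ} (hf : Differentiable ℂ f) {z : ℂ} (hne : ∃ w, f w ≠ 0) {m : ℕ}
    (hm : 0 < m) (hz : ∀ k < m, iteratedDeriv k f z = 0) {η : ℝ} (hη : 0 < η) :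
    ∃ k : ℕ, analyticOrderAt f z = k ∧ 1 < k * (1 / (m : ℝ) + η) := by
  have h1 : (m : ℕ∞) ≤ analyticOrderAt f z :=
    (natCast_le_analyticOrderAt_iff_iteratedDeriv_eq_zero (hf.analyticAt z)).mpr hz
  have h2 : analyticOrderAt f z ≠ ⊤ := by
    intro h
    rw [analyticOrderAt_eq_top] at h
    obtain ⟨w, hw⟩ := hne
    exact hw (entire_zero_of_eventually hf h w)
  obtain ⟨k, hk⟩ := ENat.ne_top_iff_exists.mp h2
  refine ⟨k, hk.symm, ?_⟩
  rw [← hk] at h1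
  have h3 : (m : ℝ) ≤ k := by exact_mod_cast h1
  have h4 : (0 : ℝ) < m := by exact_mod_cast hm
  have h5 : (m : ℝ) * (1 / (m : ℝ) + η) = 1 + m * η := by field_simp
  have h6 : (m : ℝ) * (1 / (m : ℝ) + η) ≤ k * (1 / (m : ℝ) + η) := by gcongr
  have : 0 < m * η := by positivity
  linarith

lemma const_of_WW {g h : ℂ → ℂ} (hg : Differentiable ℂ g) (hh : Differentiable ℂ h)
    (hW : ∀ z, WW g h z = 0) :
    ∃ a b : ℂ, ¬(a = 0 ∧ b = 0) ∧ ∀ z, a * g z + b * h z = 0 := by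
  by_cases h0 : ∀ z, h z = 0
  · exact ⟨0, 1, by simp, by simp [h0]⟩
  push Not at h0
  obtain ⟨z1, hz1⟩ := h0
  refine ⟨1, -(g z1 / h z1), by simp, ?_⟩
  refine entire_zero_of_eventually (f := fun z => 1 * g z + -(g z1 / h z1) * h z) (z := z1)
    (by fun_prop) ?_
  obtain ⟨r, hr, hball⟩ := Metric.eventually_nhds_iff_ball.mp
    (hh.continuous.continuousAt.eventually_ne hz1)
  refine Metric.eventually_nhds_iff_ball.mpr ⟨r, hr, fun w hw => ?_⟩
  have hder : ∀ x ∈ Metric.ball z1 r, HasDerivAt (fun z => g z / h z) 0 x := by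
    intro x hx
    have := (hg x).hasDerivAt.div (hh x).hasDerivAt (hball x hx)
    refine HasDerivAt.congr_deriv this ?_
    have := hW x
    rw [WW] at this
    rw [this, zero_div]
  have hc : g w / h w = g z1 / h z1 :=
    Metric.isOpen_ball.is_const_of_deriv_eq_zero (convex_ball z1 r).isPreconnected
      (fun x hx => (hder x hx).differentiableAt.differentiableWithinAt)
      (fun x hx => (hder x hx).deriv) hw (Metric.mem_ball_self hr)
  rw [← hc]
  have := hball w hw
  field_simp
  ring

/-- **Classical ramification theorem from Nevanlinna theory.**  A meromorphic
function on `ℂ` is represented as the ratio `ρ = g / h` of two entire functions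
without common zeros (zeros of `g - α·h` are the `α`-points of `ρ`, zeros of
`h` are the poles, with the same multiplicities).  If `α₁, …, α_{q-1} ∈ ℂ` are
distinct (here `q = n + 1`, the remaining value being `∞`), the multiplicity of
every `α_j`-point is at least `m_j`, the multiplicity of every pole is at least
`m_q`, and `∑_{j=1}^{q} (1 - 1/m_j) > 2`, then `ρ` is constant. -/
theorem ramification_theorem_entire_plane
    (h g : ℂ → ℂ) (hh : Differentiable ℂ h) (hg : Differentiable ℂ g)
    (hnocz : ∀ z, h z ≠ 0 ∨ g z ≠ 0)
    (n : ℕ) (α : Fin n → ℂ) (hα : Function.Injective α)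
    (m : Fin n → ℕ) (mq : ℕ) (hm : ∀ j, 0 < m j) (hmq : 0 < mq)
    (hsum : 2 < (∑ j, (1 - 1 / (m j : ℝ))) + (1 - 1 / (mq : ℝ)))
    (hram : ∀ j, ∀ z, g z - α j * h z = 0 →
      ∀ k < m j, iteratedDeriv k (fun w => g w - α j * h w) z = 0)
    (hramq : ∀ z, h z = 0 → ∀ k < mq, iteratedDeriv k h z = 0) :
    ∃ a b : ℂ, ¬(a = 0 ∧ b = 0) ∧ ∀ z, a * g z + b * h z = 0 := by
  classical
  by_cases hq : ∀ z, h z = 0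
  · exact ⟨0, 1, by simp, by simp [hq]⟩
  by_cases hj : ∃ j, ∀ z, g z - α j * h z = 0
  · obtain ⟨j, hj⟩ := hj
    exact ⟨1, -α j, by simp, fun z => by rw [← hj z]; ring⟩
  push Not at hq hj
  have hnorm : ∀ j, (0 : ℝ) < 1 + Complex.normSq (α j) := fun j => by
    have := Complex.normSq_nonneg (α j); positivity
  set t : Fin n → ℂ := fun j => (((Real.sqrt (1 + Complex.normSq (α j)))⁻¹ : ℝ) : ℂ) with ht
  have ht0 : ∀ j, t j ≠ 0 := fun j => by
    have := Real.sqrt_pos.mpr (hnorm j)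
    simp only [ht]
    exact_mod_cast (inv_pos.mpr this).ne'
  set A : Option (Fin n) → ℂ := fun i => i.elim 0 t with hA
  set B : Option (Fin n) → ℂ := fun i => i.elim 1 (fun j => - t j * α j) with hB
  obtain ⟨η, hη0, hη1, hη⟩ : ∃ η : ℝ, 0 < η ∧ η ≤ 1 ∧
      2 < (∑ j, (1 - (1 / (m j : ℝ) + η))) + (1 - (1 / (mq : ℝ) + η)) := by
    set e := (∑ j, (1 - 1 / (m j : ℝ))) + (1 - 1 / (mq : ℝ)) - 2 with he
    have he0 : 0 < e := by linarith
    refine ⟨min 1 (e / (2 * (n + 1))), lt_min one_pos (by positivity), min_le_left _ _, ?_⟩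
    set η := min 1 (e / (2 * (n + 1))) with hη
    have h1 : η * (n + 1) ≤ e / 2 := by
      have : η ≤ e / (2 * (n + 1)) := min_le_right _ _
      calc η * (n + 1) ≤ e / (2 * (n + 1)) * (n + 1) := by gcongr
        _ = e / 2 := by field_simp
    have h2 : ∑ j, (1 - (1 / (m j : ℝ) + η)) = ∑ j, (1 - 1 / (m j : ℝ)) - n * η := by
      rw [show (n : ℝ) * η = ∑ _j : Fin n, η by simp, ← Finset.sum_sub_distrib]
      exact Finset.sum_congr rfl fun j _ => by ring
    rw [h2]
    linarith
  set β : Option (Fin n) → ℝ := fun i => i.elim (1 / (mq : ℝ) + η) (fun j => 1 / (m j : ℝ) + η)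
    with hβ
  have hinv : ∀ k : ℕ, 0 < k → 0 < 1 / (k : ℝ) ∧ 1 / (k : ℝ) ≤ 1 := fun k hk => by
    have h1 : (1 : ℝ) ≤ k := by exact_mod_cast hk
    exact ⟨by positivity, by rw [div_le_one (by positivity)]; exact h1⟩
  have hLn : LL g h (A none) (B none) = h := by funext z; simp [LL, hA, hB]
  have hLs : ∀ j, LL g h (A (some j)) (B (some j)) = fun z => t j * (g z - α j * h z) := fun j => by
    funext z; simp only [LL, hA, hB, Option.elim]; ring
  have hLne : ∀ i, ∃ w, LL g h (A i) (B i) w ≠ 0 := by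
    rintro (_ | j)
    · rw [hLn]; exact hq
    · rw [hLs]
      obtain ⟨w, hw⟩ := hj j
      exact ⟨w, mul_ne_zero (ht0 j) hw⟩
  have hcore := core (A := A) (B := B) (β := β) hg hh hnocz ?_ ?_ ?_ ?_ ?_ ?_
  · refine const_of_WW hg hh fun z1 => ?_
    have hev : ∀ᶠ z in 𝓝[≠] z1, ∀ i, LL g h (A i) (B i) z ≠ 0 := by
      rw [eventually_all]
      intro i
      have hd := LL_diff hg hh (A i) (B i)
      rcases (hd.analyticAt z1).eventually_eq_zero_or_eventually_ne_zero with h1 | h1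
      · obtain ⟨w, hw⟩ := hLne i
        exact absurd (entire_zero_of_eventually hd h1 w) hw
      · exact h1
    have hW0 : ∀ᶠ z in 𝓝[≠] z1, WW g h z = 0 := by
      filter_upwards [hev] with z hz
      rcases hcore z with h1 | ⟨i, h1⟩
      · exact h1
      · exact absurd h1 (hz i)
    have hWc : Tendsto (WW g h) (𝓝[≠] z1) (𝓝 (WW g h z1)) :=
      ((WW_diff hg hh).continuous.continuousAt).mono_left nhdsWithin_le_nhds
    exact tendsto_nhds_unique hWc (tendsto_const_nhds.congr' (hW0.mono fun z hz => hz.symm))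
  · rintro (_ | j)
    · simp [hA, hB]
    · have hs := Real.mul_self_sqrt (hnorm j).le
      have hp := Real.sqrt_pos.mpr (hnorm j)
      simp only [hA, hB, Option.elim, map_mul, Complex.normSq_neg, ht, Complex.normSq_ofReal]
      generalize Real.sqrt (1 + Complex.normSq (α j)) = x at *
      have : x⁻¹ * x⁻¹ + x⁻¹ * x⁻¹ * Complex.normSq (α j) =
        (1 + Complex.normSq (α j)) / (x * x) := by field_simp
      rw [this, hs, div_self (hnorm j).ne']
  · rintro (_ | i) (_ | j) hij
    · exact absurd rfl hij
    · simpa [hA, hB] using ht0 j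
    · simpa [hA, hB] using ht0 i
    · have : α i - α j ≠ 0 := sub_ne_zero.mpr fun h => hij (by rw [hα h])
      have e : A (some i) * B (some j) - A (some j) * B (some i) = t i * t j * (α i - α j) := by
        simp only [hA, hB, Option.elim]; ring
      rw [e]
      exact mul_ne_zero (mul_ne_zero (ht0 i) (ht0 j)) this
  · rintro (_ | j)
    · have := hinv mq hmq; simp only [hβ, Option.elim]; linarith
    · have := hinv (m j) (hm j); simp only [hβ, Option.elim]; linarith
  · rintro (_ | j)
    · have := hinv mq hmq; simp only [hβ, Option.elim]; linarith
    · have := hinv (m j) (hm j); simp only [hβ, Option.elim]; linarith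
  · rw [Fintype.sum_option]
    simp only [hβ, Option.elim]
    linarith
  · rintro (_ | j) z hz
    · have hne := hLne none
      rw [hLn] at hz hne ⊢
      exact order_bound hh hne hmq (hramq z hz) hη0
    · have hne := hLne (some j)
      have hd := LL_diff hg hh (A (some j)) (B (some j))
      rw [hLs] at hz hne hd ⊢
      refine order_bound hd hne (hm j) (fun k hk => ?_) hη0
      have hz' := (mul_eq_zero.mp hz).resolve_left (ht0 j)
      rw [iteratedDeriv_const_mul_field, hram j z hz' k hk, mul_zero]
end
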